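/- Let N ≥ 2, let Ω ⊂ ℝ^N be a bounded domain with C³ boundary and unit volume, and let p ∈ (1, p_N). For every λ with 0 ≤ λ ≤ λ₀(Ω, p) = Λ(Ω, 2p)/p, problem (P)_λ on Ω admits exactly one solution. -/

import Mathlib

open MeasureTheory Metric Set

noncomputable section

/-- The Laplacian of a function on Euclidean space. -/
def lapl {N : ℕ} (f : EuclideanSpace ℝ (Fin N) → ℝ) (x : EuclideanSpace ℝ (Fin N)) : ℝ :=
  ∑ i : Fin N,
    fderiv ℝ (fun y => fderiv ℝ f y (EuclideanSpace.single i (1 : ℝ))) x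
      (EuclideanSpace.single i (1 : ℝ))

/-- `(α, ψ)` is a solution of problem `(P)_λ` on `Ω`:
`ψ ∈ C²`, `-Δψ = (max (α + λψ) 0)^p` in `Ω`, `ψ = 0` on `∂Ω`, and
`∫_Ω (max (α + λψ) 0)^p = 1`. -/
def IsSol {N : ℕ} (Ω : Set (EuclideanSpace ℝ (Fin N))) (p lam α : ℝ)
    (ψ : EuclideanSpace ℝ (Fin N) → ℝ) : Prop :=
  ContDiff ℝ 2 ψ ∧
  (∀ x ∈ Ω, -lapl ψ x = (max (α + lam * ψ x) 0) ^ p) ∧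
  (∀ x ∈ frontier Ω, ψ x = 0) ∧
  (∫ x in Ω, (max (α + lam * ψ x) 0) ^ p) = 1

/-- `Ω` is a bounded domain of class `C³`: open, connected, bounded, and near every
boundary point `Ω` is the sublevel set of a `C³` function with nonvanishing gradient. -/
def IsC3Domain {N : ℕ} (Ω : Set (EuclideanSpace ℝ (Fin N))) : Prop :=
  IsOpen Ω ∧ IsConnected Ω ∧ Bornology.IsBounded Ω ∧
  ∀ x ∈ frontier Ω, ∃ (U : Set (EuclideanSpace ℝ (Fin N)))
      (f : EuclideanSpace ℝ (Fin N) → ℝ),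
    IsOpen U ∧ x ∈ U ∧ ContDiff ℝ 3 f ∧ (∀ y ∈ U, fderiv ℝ f y ≠ 0) ∧
    Ω ∩ U = {y ∈ U | f y < 0}

/-- `Λ(Ω, t)`: the infimum of `(∫_Ω ‖∇w‖²) / (∫_Ω |w|^t)^(2/t)` over nonzero smooth
compactly supported `w` with support contained in `Ω`. -/
def Lam {N : ℕ} (Ω : Set (EuclideanSpace ℝ (Fin N))) (t : ℝ) : ℝ :=
  sInf {r : ℝ | ∃ w : EuclideanSpace ℝ (Fin N) → ℝ, ContDiff ℝ (⊤ : ℕ∞) w ∧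
    HasCompactSupport w ∧ tsupport w ⊆ Ω ∧ w ≠ 0 ∧
    r = (∫ x in Ω, ‖gradient w x‖ ^ 2) / (∫ x in Ω, |w x| ^ t) ^ (2 / t)}

/-- Euclidean space of dimension `N`. -/
abbrev Eu (N : ℕ) := EuclideanSpace ℝ (Fin N)

/-- The `i`-th coordinate vector. -/
def ev {N : ℕ} (i : Fin N) : Eu N := EuclideanSpace.single i (1 : ℝ)

/-- The `i`-th partial derivative. -/
def pd {N : ℕ} (i : Fin N) (f : Eu N → ℝ) (x : Eu N) : ℝ := fderiv ℝ f x (ev i)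

/-- The `i`-th coordinate functional. -/
def cf {N : ℕ} (i : Fin N) : Eu N →L[ℝ] ℝ := EuclideanSpace.proj i

section Calculus

variable {N : ℕ}

@[simp] lemma cf_apply (i : Fin N) (x : Eu N) : cf i x = x i := rfl

lemma lapl_eq (f : Eu N → ℝ) (x : Eu N) : lapl f x = ∑ i, pd i (pd i f) x := rfl

lemma norm_ev (i : Fin N) : ‖ev i‖ = 1 := by simp [ev]

lemma ev_apply (i j : Fin N) : (ev i : Eu N) j = if j = i then 1 else 0 := by
  simp [ev]

lemma eq_sum_ev (h : Eu N) : h = ∑ i, h i • ev i := by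
  ext j
  simp [ev_apply]

lemma clm_eq_sum (L : Eu N →L[ℝ] ℝ) : L = ∑ i, L (ev i) • cf i := by
  ext h
  conv_lhs => rw [eq_sum_ev h]
  simp [mul_comm]

lemma abs_coord_le (i : Fin N) (x : Eu N) : |x i| ≤ ‖x‖ := by
  simpa using PiLp.norm_apply_le x i

lemma norm_cf_le (i : Fin N) : ‖(cf i : Eu N →L[ℝ] ℝ)‖ ≤ 1 :=
  ContinuousLinearMap.opNorm_le_bound _ zero_le_one fun x => by
    simpa using abs_coord_le i x

lemma fderiv_eq_sum_pd (f : Eu N → ℝ) (x : Eu N) : fderiv ℝ f x = ∑ i, pd i f x • cf i :=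
  clm_eq_sum _

lemma fderiv_apply_eq_sum (f : Eu N → ℝ) (x h : Eu N) :
    fderiv ℝ f x h = ∑ i, pd i f x * h i := by
  rw [fderiv_eq_sum_pd]; simp

lemma norm_sum_smul_cf_le (c : Fin N → ℝ) : ‖∑ i, c i • (cf i : Eu N →L[ℝ] ℝ)‖ ≤ ∑ i, |c i| :=
  (norm_sum_le _ _).trans (Finset.sum_le_sum fun i _ => by
    rw [norm_smul]
    simpa using mul_le_mul_of_nonneg_left (norm_cf_le i) (abs_nonneg (c i)))

lemma norm_fderiv_le_sum (f : Eu N → ℝ) (x : Eu N) : ‖fderiv ℝ f x‖ ≤ ∑ i, |pd i f x| := by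
  rw [fderiv_eq_sum_pd]; exact norm_sum_smul_cf_le _

lemma HasFDerivAt.pd_eq {f : Eu N → ℝ} {g : Fin N → ℝ} {x : Eu N}
    (h : HasFDerivAt f (∑ i, g i • cf i) x) (i : Fin N) : pd i f x = g i := by
  rw [pd, h.fderiv]; simp [ev_apply]

lemma contDiff_pd {f : Eu N → ℝ} {n m : WithTop ℕ∞} (hf : ContDiff ℝ n f) (hmn : m + 1 ≤ n)
    (i : Fin N) : ContDiff ℝ m (pd i f) :=
  (hf.fderiv_right hmn).clm_apply contDiff_const

lemma contDiff_succ_of_hasFDerivAt {f : Eu N → ℝ} {g : Fin N → Eu N → ℝ} {n : ℕ}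
    (h : ∀ x, HasFDerivAt f (∑ i, g i x • cf i) x) (hg : ∀ i, ContDiff ℝ n (g i)) :
    ContDiff ℝ (n + 1) f :=
  contDiff_succ_iff_hasFDerivAt.2 ⟨fun x => ∑ i, g i x • cf i,
    ContDiff.sum fun i _ => (hg i).smul contDiff_const, h⟩

lemma pd_add {f g : Eu N → ℝ} {x : Eu N} (i : Fin N) (hf : DifferentiableAt ℝ f x)
    (hg : DifferentiableAt ℝ g x) : pd i (fun y => f y + g y) x = pd i f x + pd i g x := by
  simp only [pd]; rw [fderiv_fun_add hf hg]; simp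

lemma pd_mul {f g : Eu N → ℝ} {x : Eu N} (i : Fin N) (hf : DifferentiableAt ℝ f x)
    (hg : DifferentiableAt ℝ g x) :
    pd i (fun y => f y * g y) x = pd i f x * g x + f x * pd i g x := by
  simp only [pd]; rw [fderiv_fun_mul hf hg]; simp; ring

lemma pd_const_mul {f : Eu N → ℝ} {x : Eu N} (i : Fin N) (c : ℝ) :
    pd i (fun y => c * f y) x = c * pd i f x := by
  by_cases hf : DifferentiableAt ℝ f x
  · simp only [pd]; rw [fderiv_const_mul hf]; simp
  · by_cases hc : c = 0
    · subst hc; simp [pd]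
    · simp only [pd]
      rw [fderiv_zero_of_not_differentiableAt hf, fderiv_zero_of_not_differentiableAt]
      · simp
      · intro h
        apply hf
        have := h.const_mul c⁻¹
        simpa [← mul_assoc, inv_mul_cancel₀ hc] using this

lemma pd_sum {ι : Type*} (s : Finset ι) {f : ι → Eu N → ℝ} {x : Eu N} (i : Fin N)
    (hf : ∀ a ∈ s, DifferentiableAt ℝ (f a) x) :
    pd i (fun y => ∑ a ∈ s, f a y) x = ∑ a ∈ s, pd i (f a) x := by
  simp only [pd]; rw [fderiv_fun_sum hf]; simp

lemma pd_coord (i j : Fin N) (x : Eu N) : pd i (fun y => y j) x = if j = i then 1 else 0 := by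
  have : (fun y : Eu N => y j) = cf j := rfl
  rw [pd, this, ContinuousLinearMap.fderiv]; simp [ev_apply]

lemma pd_congr {f g : Eu N → ℝ} {x : Eu N} (h : f =ᶠ[nhds x] g) (i : Fin N) :
    pd i f x = pd i g x := by
  simp only [pd]; rw [h.fderiv_eq]

lemma pd_congr_eventually {f g : Eu N → ℝ} {x : Eu N} (h : f =ᶠ[nhds x] g) (i : Fin N) :
    pd i f =ᶠ[nhds x] pd i g :=
  h.eventuallyEq_nhds.mono fun _ hy => pd_congr hy i

lemma lapl_congr {f g : Eu N → ℝ} {x : Eu N} (h : f =ᶠ[nhds x] g) : lapl f x = lapl g x := by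
  simp only [lapl_eq]
  exact Finset.sum_congr rfl fun i _ => pd_congr (pd_congr_eventually h i) i

lemma ContDiff.diffAt {f : Eu N → ℝ} {n : WithTop ℕ∞} (hf : ContDiff ℝ n f) (hn : n ≠ 0)
    (x : Eu N) : DifferentiableAt ℝ f x := hf.contDiffAt.differentiableAt hn

lemma ContDiff.pd_diffAt {f : Eu N → ℝ} (hf : ContDiff ℝ 2 f) (i : Fin N)
    (x : Eu N) : DifferentiableAt ℝ (pd i f) x :=
  (contDiff_pd (m := 1) hf (by norm_num) i).diffAt (by simp) x

lemma lapl_add {f g : Eu N → ℝ} (hf : ContDiff ℝ 2 f) (hg : ContDiff ℝ 2 g) (x : Eu N) :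
    lapl (fun y => f y + g y) x = lapl f x + lapl g x := by
  simp only [lapl_eq, ← Finset.sum_add_distrib]
  refine Finset.sum_congr rfl fun i _ => ?_
  have : pd i (fun y => f y + g y) = fun y => pd i f y + pd i g y := funext fun y =>
    pd_add i (hf.diffAt (by simp) y) (hg.diffAt (by simp) y)
  rw [this, pd_add i (hf.pd_diffAt i x) (hg.pd_diffAt i x)]

lemma lapl_const_mul {f : Eu N → ℝ} (c : ℝ) (x : Eu N) :
    lapl (fun y => c * f y) x = c * lapl f x := by
  simp only [lapl_eq, Finset.mul_sum]
  refine Finset.sum_congr rfl fun i _ => ?_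
  have : pd i (fun y => c * f y) = fun y => c * pd i f y := funext fun y => pd_const_mul i c
  rw [this, pd_const_mul]

lemma lapl_sub {f g : Eu N → ℝ} (hf : ContDiff ℝ 2 f) (hg : ContDiff ℝ 2 g) (x : Eu N) :
    lapl (fun y => f y - g y) x = lapl f x - lapl g x := by
  have := lapl_add (f := f) (g := fun y => (-1) * g y) hf (contDiff_const.mul hg) x
  rw [lapl_const_mul] at this
  simpa [sub_eq_add_neg] using this

lemma lapl_mul {f g : Eu N → ℝ} (hf : ContDiff ℝ 2 f) (hg : ContDiff ℝ 2 g) (x : Eu N) :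
    lapl (fun y => f y * g y) x =
      lapl f x * g x + 2 * (∑ i, pd i f x * pd i g x) + f x * lapl g x := by
  simp only [lapl_eq, Finset.sum_mul, Finset.mul_sum, ← Finset.sum_add_distrib]
  refine Finset.sum_congr rfl fun i _ => ?_
  have : pd i (fun y => f y * g y) = fun y => pd i f y * g y + f y * pd i g y := funext fun y =>
    pd_mul i (hf.diffAt (by simp) y) (hg.diffAt (by simp) y)
  rw [this, pd_add i ((hf.pd_diffAt i x).fun_mul (hg.diffAt (by simp) x))
    ((hf.diffAt (by simp) x).fun_mul (hg.pd_diffAt i x)),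
    pd_mul i (hf.pd_diffAt i x) (hg.diffAt (by simp) x),
    pd_mul i (hf.diffAt (by simp) x) (hg.pd_diffAt i x)]
  ring

/-- The vector with given coordinates. -/
def mkv (c : Fin N → ℝ) : Eu N := WithLp.toLp 2 c

@[simp] lemma mkv_apply (c : Fin N → ℝ) (i : Fin N) : mkv c i = c i := rfl

lemma contDiff_mkv {F : Type*} [NormedAddCommGroup F] [NormedSpace ℝ F] {R : Fin N → F → ℝ}
    {n : WithTop ℕ∞} (hR : ∀ a, ContDiff ℝ n (R a)) : ContDiff ℝ n fun x => mkv fun a => R a x :=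
  contDiff_euclidean.2 hR

lemma contDiff_coord {F : Type*} [NormedAddCommGroup F] [NormedSpace ℝ F] {R : F → Eu N}
    {n : WithTop ℕ∞} (hR : ContDiff ℝ n R) (a : Fin N) : ContDiff ℝ n fun x => R x a :=
  contDiff_euclidean.1 hR a

lemma pd_comp {v : Eu N → ℝ} {R : Eu N → Eu N} {x : Eu N} (hv : DifferentiableAt ℝ v (R x))
    (hR : DifferentiableAt ℝ R x) (i : Fin N) :
    pd i (fun y => v (R y)) x = ∑ a, pd a v (R x) * pd i (fun y => R y a) x := by
  have h1 : fderiv ℝ (fun y => v (R y)) x = (fderiv ℝ v (R x)).comp (fderiv ℝ R x) :=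
    fderiv_comp x hv hR
  have h2 : ∀ a, pd i (fun y => R y a) x = fderiv ℝ R x (ev i) a := fun a => by
    have : HasFDerivAt (fun y => R y a) ((cf a).comp (fderiv ℝ R x)) x :=
      (cf a).hasFDerivAt.comp x hR.hasFDerivAt
    rw [pd, this.fderiv]; simp
  rw [pd, h1, ContinuousLinearMap.comp_apply, fderiv_apply_eq_sum]
  simp [h2]

lemma lapl_comp {v : Eu N → ℝ} {R : Eu N → Eu N} (hv : ContDiff ℝ 2 v) (hR : ContDiff ℝ 2 R)
    (x : Eu N) : lapl (fun y => v (R y)) x =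
      (∑ a, ∑ b, (∑ i, pd i (fun y => R y a) x * pd i (fun y => R y b) x) * pd b (pd a v) (R x))
        + ∑ a, lapl (fun y => R y a) x * pd a v (R x) := by
  have hRd : ∀ y, DifferentiableAt ℝ R y := fun y => hR.contDiffAt.differentiableAt (by simp)
  have e1 : ∀ i, pd i (fun y => v (R y)) =
      fun y => ∑ a, pd a v (R y) * pd i (fun y => R y a) y := fun i => funext fun y =>
    pd_comp (hv.diffAt (by simp) _) (hRd y) i
  have hc : ∀ a, ContDiff ℝ 2 (fun y => R y a) := fun a => contDiff_coord hR a
  have d1 : ∀ a, DifferentiableAt ℝ (fun y => pd a v (R y)) x := fun a =>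
    (hv.pd_diffAt a (R x)).comp x (hRd x)
  have e2 : ∀ i, pd i (pd i (fun y => v (R y))) x = ∑ a,
      ((∑ b, pd b (pd a v) (R x) * pd i (fun y => R y b) x) * pd i (fun y => R y a) x
        + pd a v (R x) * pd i (pd i (fun y => R y a)) x) := fun i => by
    rw [e1 i, pd_sum]
    · refine Finset.sum_congr rfl fun a _ => ?_
      rw [pd_mul i (d1 a) ((hc a).pd_diffAt i x), pd_comp (hv.pd_diffAt a _) (hRd x)]
    · exact fun a _ => (d1 a).mul ((hc a).pd_diffAt i x)
  simp only [lapl_eq, e2, Finset.sum_add_distrib]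
  congr 1
  · rw [Finset.sum_comm]
    refine Finset.sum_congr rfl fun a _ => ?_
    simp only [Finset.sum_mul]
    rw [Finset.sum_comm]
    refine Finset.sum_congr rfl fun b _ => Finset.sum_congr rfl fun i _ => by ring
  · rw [Finset.sum_comm]
    refine Finset.sum_congr rfl fun a _ => ?_
    rw [Finset.sum_mul]
    exact Finset.sum_congr rfl fun i _ => by ring

end Calculus

section MaxPrinciple

variable {N : ℕ}

lemma hasDerivAt_line {f : Eu N → ℝ} (x : Eu N) (i : Fin N) (t : ℝ)
    (hf : DifferentiableAt ℝ f (x + t • ev i)) :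
    HasDerivAt (fun t : ℝ => f (x + t • ev i)) (pd i f (x + t • ev i)) t := by
  have h1 : HasDerivAt (fun t : ℝ => x + t • (ev i : Eu N)) (ev i) t := by
    simpa using ((hasDerivAt_id t).smul_const (ev i : Eu N)).const_add x
  exact hf.hasFDerivAt.comp_hasDerivAt t h1

lemma pd_pd_nonpos_of_isLocalMax {f : Eu N → ℝ} (hf : ContDiff ℝ 2 f) {x : Eu N}
    (hx : IsLocalMax f x) (i : Fin N) : pd i (pd i f) x ≤ 0 := by
  by_contra! hpos
  set g : ℝ → ℝ := fun t => f (x + t • ev i) with hg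
  have hcont : Continuous fun t : ℝ => x + t • (ev i : Eu N) := by fun_prop
  have d1 : deriv g = fun t => pd i f (x + t • ev i) := funext fun t =>
    (hasDerivAt_line x i t (hf.diffAt (by simp) _)).deriv
  have d2 : deriv (deriv g) 0 = pd i (pd i f) x := by
    rw [d1]
    simpa using (hasDerivAt_line x i 0 (hf.pd_diffAt i _)).deriv
  have hmax : IsLocalMax g 0 := by
    have : Filter.Tendsto (fun t : ℝ => x + t • (ev i : Eu N)) (nhds 0) (nhds x) := by
      simpa using hcont.tendsto 0
    have h2 := this.eventually hx
    simpa [IsLocalMax, IsMaxFilter, hg] using h2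
  have hmin : IsLocalMin g 0 := by
    refine isLocalMin_of_deriv_deriv_pos (by rw [d2]; exact hpos) hmax.deriv_eq_zero ?_
    exact (hf.continuous.comp hcont).continuousAt
  have hconst : g =ᶠ[nhds 0] fun _ => g 0 := by
    filter_upwards [hmax, hmin] with t h1 h2 using le_antisymm h1 h2
  have h0 : deriv (deriv g) 0 = 0 := by
    have h1 : deriv g =ᶠ[nhds 0] deriv (fun _ => g 0) := hconst.deriv
    rw [h1.deriv_eq]; simp
  linarith

/-- The square of the Euclidean norm. -/
def nsq (x : Eu N) : ℝ := ∑ i, x i * x i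

lemma nsq_eq (x : Eu N) : nsq x = ‖x‖ ^ 2 := by
  rw [EuclideanSpace.norm_sq_eq]; simp [nsq, pow_two]

lemma contDiff_nsq {n : WithTop ℕ∞} : ContDiff ℝ n (nsq : Eu N → ℝ) :=
  ContDiff.sum fun i _ => (cf i).contDiff.mul (cf i).contDiff

lemma pd_nsq (i : Fin N) (x : Eu N) : pd i nsq x = 2 * x i := by
  have hd : ∀ j : Fin N, DifferentiableAt ℝ (fun y : Eu N => y j) x := fun j =>
    (cf j).differentiableAt
  have : (nsq : Eu N → ℝ) = fun y => ∑ i, y i * y i := rfl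
  rw [this, pd_sum _ _ fun j _ => (hd j).fun_mul (hd j)]
  simp only [pd_mul i (hd _) (hd _), pd_coord]
  rw [Finset.sum_add_distrib]; simp; ring

lemma lapl_nsq (x : Eu N) : lapl nsq x = 2 * N := by
  have : ∀ i : Fin N, pd i nsq = fun x => 2 * x i := fun i => funext fun x => pd_nsq i x
  simp only [lapl_eq, this, pd_const_mul, pd_coord]
  simp; ring

lemma lapl_const (c : ℝ) (x : Eu N) : lapl (fun _ => c) x = 0 := by
  simp [lapl]

theorem max_principle (hN : 0 < N) {Ω : Set (Eu N)} (hΩ : IsOpen Ω) (hb : Bornology.IsBounded Ω)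
    {w : Eu N → ℝ} (hw : ContDiff ℝ 2 w) {s : ℝ} (hs : 0 ≤ s)
    (hle : ∀ x ∈ Ω, -lapl w x + s * w x ≤ 0) (hbd : ∀ x ∈ frontier Ω, w x ≤ 0) :
    ∀ x ∈ closure Ω, w x ≤ 0 := by
  intro x0 hx0
  by_contra! hpos
  obtain ⟨B, hB0, hB⟩ := hb.closure.exists_pos_norm_le
  obtain ⟨ε, hε, hε2⟩ : ∃ ε > 0, ε * B ^ 2 < w x0 :=
    ⟨w x0 / (2 * B ^ 2), by positivity, by field_simp; linarith⟩
  set h : Eu N → ℝ := fun x => w x + ε * nsq x with hh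
  have hhc : ContDiff ℝ 2 h := hw.add (contDiff_const.mul contDiff_nsq)
  have hcomp : IsCompact (closure Ω) := hb.isCompact_closure
  obtain ⟨y, hy, hmax⟩ := hcomp.exists_isMaxOn ⟨x0, hx0⟩ hhc.continuous.continuousOn
  have hnn : ∀ x, 0 ≤ nsq x := fun x : Eu N => by rw [nsq_eq]; positivity
  have h1 : h x0 ≤ h y := hmax hx0
  have hyB : ε * nsq y ≤ ε * B ^ 2 := by
    rw [nsq_eq]; gcongr; exact hB y hy
  have hwy : 0 < w y := by
    have := mul_nonneg hε.le (hnn x0)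
    simp only [hh] at h1; linarith
  by_cases hyΩ : y ∈ Ω
  · have hloc : IsLocalMax h y :=
      Filter.eventually_of_mem (hΩ.mem_nhds hyΩ) fun z hz => hmax (subset_closure hz)
    have h2 : lapl h y ≤ 0 := Finset.sum_nonpos fun i _ => pd_pd_nonpos_of_isLocalMax hhc hloc i
    have h3 : lapl h y = lapl w y + ε * (2 * N) := by
      rw [hh, lapl_add hw (contDiff_const.mul contDiff_nsq), lapl_const_mul, lapl_nsq]
    have h4 := hle y hyΩ
    have h5 := mul_nonneg hs hwy.le
    have h6 : 0 < ε * (2 * N) := by positivity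
    linarith
  · exact absurd (hbd y ⟨hy, by rwa [hΩ.interior_eq]⟩) (not_le.2 hwy)

theorem eq_zero_of_max_principle (hN : 0 < N) {Ω : Set (Eu N)} (hΩ : IsOpen Ω)
    (hb : Bornology.IsBounded Ω) {w : Eu N → ℝ} (hw : ContDiff ℝ 2 w) {s : ℝ} (hs : 0 ≤ s)
    (hle : ∀ x ∈ Ω, -lapl w x + s * w x = 0) (hbd : ∀ x ∈ frontier Ω, w x = 0) :
    ∀ x ∈ closure Ω, w x = 0 := by
  intro x hx
  refine le_antisymm (max_principle hN hΩ hb hw hs (fun x hx => (hle x hx).le)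
    (fun x hx => (hbd x hx).le) x hx) ?_
  have := max_principle hN hΩ hb (w := fun x => (-1) * w x) (contDiff_const.mul hw) hs
    (fun x hx => by rw [lapl_const_mul]; linarith [hle x hx])
    (fun x hx => by rw [hbd x hx]; simp) x hx
  linarith

end MaxPrinciple

section Kernels

variable {N : ℕ}

lemma nsq_nonneg (x : Eu N) : 0 ≤ nsq x := by rw [nsq_eq]; positivity

lemma integrable_exp_nsq {b : ℝ} (hb : 0 < b) :
    Integrable (fun z : Eu N => Real.exp (-b * nsq z)) := by
  simp only [nsq_eq]
  by_contra h
  have h1 := GaussianFourier.integral_rexp_neg_mul_sq_norm (V := Eu N) hb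
  rw [integral_undef h] at h1
  have : 0 < (Real.pi / b) ^ (↑(Module.finrank ℝ (Eu N)) / 2 : ℝ) := by
    have := Real.pi_pos
    positivity
  linarith

/-- The normalised Gaussian. -/
def gam (z : Eu N) : ℝ :=
  (∫ y : Eu N, Real.exp (-(1 / 2) * nsq y))⁻¹ * Real.exp (-(1 / 2) * nsq z)

lemma gam_const_pos : 0 < ∫ y : Eu N, Real.exp (-(1 / 2) * nsq y) := by
  simp only [nsq_eq]
  rw [GaussianFourier.integral_rexp_neg_mul_sq_norm (V := Eu N) (by norm_num)]
  have := Real.pi_pos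
  positivity

lemma gam_pos (z : Eu N) : 0 < gam z :=
  mul_pos (inv_pos.2 gam_const_pos) (Real.exp_pos _)

lemma integral_gam : ∫ z : Eu N, gam z = 1 := by
  simp only [gam]
  rw [integral_const_mul, inv_mul_cancel₀ gam_const_pos.ne']

/-- Polynomials times the Gaussian. -/
inductive GK : (Eu N → ℝ) → Prop
  | base : GK gam
  | coord (j : Fin N) {η : Eu N → ℝ} : GK η → GK (fun z => z j * η z)
  | smul (c : ℝ) {η : Eu N → ℝ} : GK η → GK (fun z => c * η z)
  | add {η θ : Eu N → ℝ} : GK η → GK θ → GK (fun z => η z + θ z)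

lemma GK.contDiff {η : Eu N → ℝ} (h : GK η) {n : WithTop ℕ∞} : ContDiff ℝ n η := by
  induction h with
  | base => exact contDiff_const.mul (Real.contDiff_exp.comp (contDiff_const.mul contDiff_nsq))
  | coord j _ ih => exact (cf j).contDiff.mul ih
  | smul c _ ih => exact contDiff_const.mul ih
  | add _ _ ih1 ih2 => exact ih1.add ih2

lemma GK.diffAt {η : Eu N → ℝ} (h : GK η) (z : Eu N) : DifferentiableAt ℝ η z :=
  (h.contDiff (n := 1)).diffAt (by simp) z

lemma GK.continuous {η : Eu N → ℝ} (h : GK η) : Continuous η := (h.contDiff (n := 0)).continuous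

lemma pd_gam (i : Fin N) (z : Eu N) : pd i gam z = -(z i) * gam z := by
  have h1 : HasFDerivAt nsq (fderiv ℝ nsq z) z :=
    ((contDiff_nsq (n := 1)).diffAt (by simp) z).hasFDerivAt
  have h2 := ((h1.const_mul (-(1 / 2))).exp).const_mul
    (∫ y : Eu N, Real.exp (-(1 / 2) * nsq y))⁻¹
  have h3 : fderiv ℝ nsq z (ev i) = 2 * z i := pd_nsq i z
  have h4 : HasFDerivAt gam _ z := h2
  rw [pd, h4.fderiv]
  simp [h3, gam]
  ring

lemma pd_coord_mul {η : Eu N → ℝ} {z : Eu N} (i j : Fin N) (h : DifferentiableAt ℝ η z) :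
    pd i (fun z => z j * η z) z = (if j = i then 1 else 0) * η z + z j * pd i η z := by
  have h1 : DifferentiableAt ℝ (fun y : Eu N => y j) z := (cf j).differentiableAt
  rw [pd_mul i h1 h, pd_coord]

lemma abs_integral_le_of_le {α : Type*} [MeasurableSpace α] {μ : Measure α} {f g : α → ℝ}
    (hg : Integrable g μ) (h : ∀ z, |f z| ≤ g z) : |∫ z, f z ∂μ| ≤ ∫ z, g z ∂μ := by
  rw [← Real.norm_eq_abs]
  exact norm_integral_le_of_norm_le hg (Filter.Eventually.of_forall h)

lemma GK.gpd {η : Eu N → ℝ} (h : GK η) (i : Fin N) : GK (pd i η) := by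
  induction h with
  | base =>
    have : pd i (gam : Eu N → ℝ) = fun z => (-1) * (z i * gam z) := funext fun z => by
      rw [pd_gam]; ring
    rw [this]
    exact (GK.base.coord i).smul _
  | @coord j η h ih =>
    have : pd i (fun z => z j * η z) =
        fun z => (if j = i then 1 else 0) * η z + z j * pd i η z := funext fun z => by
      rw [pd_coord_mul i j (h.diffAt z)]
    rw [this]
    exact (h.smul _).add (ih.coord j)
  | @smul c η h ih =>
    have : pd i (fun z => c * η z) = fun z => c * pd i η z := funext fun z => pd_const_mul i c
    rw [this]
    exact ih.smul c
  | @add η θ h1 h2 ih1 ih2 =>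
    have : pd i (fun z => η z + θ z) = fun z => pd i η z + pd i θ z := funext fun z =>
      pd_add i (h1.diffAt z) (h2.diffAt z)
    rw [this]
    exact ih1.add ih2

lemma abs_le_exp_sq {δ : ℝ} (hδ : 0 < δ) (t : ℝ) : |t| ≤ (1 + δ⁻¹) * Real.exp (δ * t ^ 2) := by
  have h1 : |t| ≤ 1 + t ^ 2 := by nlinarith [sq_nonneg (|t| - 1), sq_abs t, abs_nonneg t]
  have h2 : 1 + δ * t ^ 2 ≤ Real.exp (δ * t ^ 2) := by linarith [Real.add_one_le_exp (δ * t ^ 2)]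
  have h3 : 1 + t ^ 2 ≤ (1 + δ⁻¹) * (1 + δ * t ^ 2) := by
    have : δ⁻¹ * δ = 1 := inv_mul_cancel₀ hδ.ne'
    have h5 : 0 < δ⁻¹ := inv_pos.2 hδ
    nlinarith [sq_nonneg t, mul_nonneg hδ.le (sq_nonneg t)]
  exact h1.trans (h3.trans (mul_le_mul_of_nonneg_left h2 (by positivity)))

lemma GK.bound_exp {η : Eu N → ℝ} (h : GK η) : ∀ a < (1 / 2 : ℝ),
    ∃ C, 0 ≤ C ∧ ∀ z, |η z| ≤ C * Real.exp (-a * nsq z) := by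
  induction h with
  | base =>
    refine fun a ha => ⟨_, (inv_pos.2 (gam_const_pos (N := N))).le, fun z => ?_⟩
    rw [abs_of_pos (gam_pos z), gam]
    have := nsq_nonneg z
    have := (inv_pos.2 (gam_const_pos (N := N))).le
    gcongr
  | @coord j η h ih =>
    intro a ha
    obtain ⟨C, hC, hb⟩ := ih ((a + 1 / 2) / 2) (by linarith)
    set δ := (1 / 2 - a) / 2 with hδ
    have hδ0 : 0 < δ := by rw [hδ]; linarith
    refine ⟨(1 + δ⁻¹) * C, by positivity, fun z => ?_⟩
    have h1 : |z j| ≤ (1 + δ⁻¹) * Real.exp (δ * nsq z) := by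
      have := (abs_coord_le j z).trans ((le_abs_self _).trans (abs_le_exp_sq hδ0 ‖z‖))
      rwa [← nsq_eq] at this
    rw [abs_mul]
    calc |z j| * |η z| ≤ ((1 + δ⁻¹) * Real.exp (δ * nsq z)) *
          (C * Real.exp (-((a + 1 / 2) / 2) * nsq z)) := by
          gcongr; exact hb z
      _ = (1 + δ⁻¹) * C * (Real.exp (δ * nsq z) * Real.exp (-((a + 1 / 2) / 2) * nsq z)) := by ring
      _ = _ := by rw [← Real.exp_add]; congr 2; rw [hδ]; ring
  | smul c h ih =>
    intro a ha
    obtain ⟨C, hC, hb⟩ := ih a ha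
    refine ⟨|c| * C, by positivity, fun z => ?_⟩
    rw [abs_mul, mul_assoc]
    exact mul_le_mul_of_nonneg_left (hb z) (abs_nonneg c)
  | add h1 h2 ih1 ih2 =>
    intro a ha
    obtain ⟨C, hC, hb⟩ := ih1 a ha
    obtain ⟨D, hD, hd⟩ := ih2 a ha
    refine ⟨C + D, by positivity, fun z => ?_⟩
    rw [add_mul]
    exact (abs_add_le _ _).trans (add_le_add (hb z) (hd z))

lemma GK.bounded {η : Eu N → ℝ} (h : GK η) : ∃ C, 0 ≤ C ∧ ∀ z, |η z| ≤ C := by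
  obtain ⟨C, hC, hb⟩ := h.bound_exp 0 (by norm_num)
  exact ⟨C, hC, fun z => by simpa using hb z⟩

lemma GK.integrable {η : Eu N → ℝ} (h : GK η) : Integrable η := by
  obtain ⟨C, hC, hb⟩ := h.bound_exp (1 / 4) (by norm_num)
  exact ((integrable_exp_nsq (by norm_num)).const_mul C).mono' h.continuous.aestronglyMeasurable
    (Filter.Eventually.of_forall hb)

lemma GK.integrable_mul_norm {η : Eu N → ℝ} (h : GK η) :
    Integrable (fun z => |η z| * (1 + ‖z‖)) := by
  have h1 : Integrable (fun z => |η z| + ∑ i, |z i * η z|) :=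
    h.integrable.abs.add (integrable_finsetSum _ fun i _ => (h.coord i).integrable.abs)
  refine h1.mono' (by have := h.continuous; fun_prop) (Filter.Eventually.of_forall fun z => ?_)
  rw [Real.norm_of_nonneg (by positivity)]
  have h2 : ‖z‖ ≤ ∑ i, |z i| := by
    conv_lhs => rw [eq_sum_ev z]
    refine (norm_sum_le _ _).trans (Finset.sum_le_sum fun i _ => ?_)
    rw [norm_smul, norm_ev, mul_one, Real.norm_eq_abs]
  simp only [abs_mul]
  rw [← Finset.sum_mul]
  nlinarith [abs_nonneg (η z)]

lemma sqrt_le_one_add {t : ℝ} (ht : 0 ≤ t) : √t ≤ 1 + t := by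
  nlinarith [Real.sq_sqrt ht, sq_nonneg (√t - 1), Real.sqrt_nonneg t]

lemma GK.integrable_mul_sqrt {η : Eu N → ℝ} (h : GK η) :
    Integrable (fun z => |η z| * √‖z‖) := by
  refine h.integrable_mul_norm.mono' (by have := h.continuous; fun_prop)
    (Filter.Eventually.of_forall fun z => ?_)
  rw [Real.norm_of_nonneg (by positivity)]
  exact mul_le_mul_of_nonneg_left (sqrt_le_one_add (norm_nonneg z)) (abs_nonneg _)

lemma GK.integral_pd {η : Eu N → ℝ} (h : GK η) (i : Fin N) : ∫ z, pd i η z = 0 := by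
  have := integral_mul_fderiv_eq_neg_fderiv_mul_of_integrable (μ := (volume : Measure (Eu N)))
    (f := fun _ : Eu N => (1 : ℝ)) (g := η) (v := ev i) (by simp)
    (by simp only [one_mul]; exact (h.gpd i).integrable) (by simpa using h.integrable) (by simp)
    (fun x _ => h.diffAt x)
  simpa [pd] using this

/-- Averages of `φ` at scale `r` against the kernel `η`. -/
def Aop (η φ : Eu N → ℝ) (r : ℝ) (x : Eu N) : ℝ := ∫ z, η z * φ (x + r • z)

lemma GK.integrable_mul_bdd {η φ : Eu N → ℝ} (h : GK η) (hφ : Continuous φ) {M : ℝ}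
    (hM : ∀ y, |φ y| ≤ M) (r : ℝ) (x : Eu N) : Integrable (fun z => η z * φ (x + r • z)) :=
  h.integrable.mul_bdd (c := M) (by fun_prop) (Filter.Eventually.of_forall fun z => hM _)

lemma Aop_abs_le {η φ : Eu N → ℝ} (h : GK η) {M : ℝ}
    (hM : ∀ y, |φ y| ≤ M) (r : ℝ) (x : Eu N) : |Aop η φ r x| ≤ (∫ z, |η z|) * M := by
  rw [Aop, ← integral_mul_const]
  refine abs_integral_le_of_le (h.integrable.abs.mul_const M) fun z => ?_
  rw [abs_mul]
  exact mul_le_mul_of_nonneg_left (hM _) (abs_nonneg _)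

/-- Hölder continuity with exponent one half. -/
def Hol (B : ℝ) (φ : Eu N → ℝ) : Prop := ∀ x y, |φ x - φ y| ≤ B * √‖x - y‖

lemma Aop_abs_le_hol {η φ : Eu N → ℝ} (h : GK η) (h0 : ∫ z, η z = 0) (hφ : Continuous φ)
    {M B : ℝ} (hM : ∀ y, |φ y| ≤ M) (hB : Hol B φ) {r : ℝ} (hr : 0 ≤ r)
    (x : Eu N) : |Aop η φ r x| ≤ (∫ z, |η z| * √‖z‖) * (B * √r) := by
  have e : Aop η φ r x = ∫ z, η z * (φ (x + r • z) - φ x) := by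
    simp only [mul_sub]
    rw [integral_sub (h.integrable_mul_bdd hφ hM r x) (h.integrable.mul_const _),
      integral_mul_const, h0, zero_mul, sub_zero, Aop]
  rw [e, ← integral_mul_const]
  refine abs_integral_le_of_le (h.integrable_mul_sqrt.mul_const _) fun z => ?_
  rw [abs_mul, mul_assoc]
  refine mul_le_mul_of_nonneg_left ?_ (abs_nonneg _)
  refine (hB _ _).trans (le_of_eq ?_)
  rw [add_sub_cancel_left, norm_smul, Real.norm_of_nonneg hr, Real.sqrt_mul hr]
  ring

lemma continuous_Aop {η φ : Eu N → ℝ} (h : GK η) (hφ : Continuous φ) {M : ℝ}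
    (hM : ∀ y, |φ y| ≤ M) : Continuous fun q : ℝ × Eu N => Aop η φ q.1 q.2 := by
  have := h.continuous
  refine continuous_of_dominated (bound := fun z => |η z| * M) (fun q => by fun_prop)
    (fun q => Filter.Eventually.of_forall fun z => ?_) (h.integrable.abs.mul_const M)
    (Filter.Eventually.of_forall fun z => by fun_prop)
  rw [Real.norm_eq_abs, abs_mul]
  exact mul_le_mul_of_nonneg_left (hM _) (abs_nonneg _)

lemma integral_comp_affine (f : Eu N → ℝ) (x : Eu N) {r : ℝ} (hr : 0 < r) :
    ∫ z, f (x + r • z) = (r ^ N)⁻¹ * ∫ y, f y := by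
  have h1 := Measure.integral_comp_smul (volume : Measure (Eu N)) (fun y => f (x + y)) r
  rw [h1, integral_add_left_eq_self, abs_of_pos (by positivity)]
  simp

lemma Aop_eq {η φ : Eu N → ℝ} {r : ℝ} (hr : 0 < r) (x : Eu N) :
    Aop η φ r x = (r ^ N)⁻¹ * ∫ y, η (r⁻¹ • (y - x)) * φ y := by
  rw [← integral_comp_affine _ x hr, Aop]
  simp [smul_smul, inv_mul_cancel₀ hr.ne']

lemma Aop_abs_le_l1 {η φ : Eu N → ℝ} {C : ℝ} (hC : ∀ z, |η z| ≤ C)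
    (hφ : Integrable φ) {r : ℝ} (hr : 0 < r) (x : Eu N) :
    |Aop η φ r x| ≤ (r ^ N)⁻¹ * (C * ∫ y, |φ y|) := by
  rw [Aop_eq hr, abs_mul, abs_of_pos (a := (r ^ N)⁻¹) (by positivity)]
  refine mul_le_mul_of_nonneg_left ?_ (by positivity)
  rw [← integral_const_mul]
  refine abs_integral_le_of_le (hφ.abs.const_mul C) fun z => ?_
  rw [abs_mul]
  exact mul_le_mul_of_nonneg_right (hC _) (abs_nonneg _)

lemma hasFDerivAt_Aop {η φ : Eu N → ℝ} (h : GK η) (hφ : Integrable φ) {r : ℝ} (hr : 0 < r)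
    (x : Eu N) :
    HasFDerivAt (fun x => Aop η φ r x) (∑ i, (-r⁻¹ * Aop (pd i η) φ r x) • cf i) x := by
  choose C hC0 hC using fun i => (h.gpd i).bounded
  have hcη := h.continuous
  have hcp : ∀ i, Continuous (pd i η) := fun i => (h.gpd i).continuous
  have hφm := hφ.aestronglyMeasurable
  obtain ⟨C0, _, hC0'⟩ := h.bounded
  have hInt : ∀ {θ : Eu N → ℝ}, GK θ → ∀ x, Integrable (fun y => θ (r⁻¹ • (y - x)) * φ y) := by
    intro θ hθ x
    obtain ⟨C, _, hC⟩ := hθ.bounded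
    have := hθ.continuous
    exact hφ.bdd_mul (c := C) (by fun_prop) (Filter.Eventually.of_forall fun z => hC _)
  have key := hasFDerivAt_integral_of_dominated_of_fderiv_le (μ := (volume : Measure (Eu N)))
    (F := fun x y => η (r⁻¹ • (y - x)) * φ y) (x₀ := x) (s := univ)
    (F' := fun x y => ∑ i, (-r⁻¹ * (pd i η (r⁻¹ • (y - x)) * φ y)) • (cf i : Eu N →L[ℝ] ℝ))
    (bound := fun y => ∑ i, r⁻¹ * C i * |φ y|) Filter.univ_mem
    (Filter.Eventually.of_forall fun x => (hInt h x).aestronglyMeasurable) (hInt h x)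
    (by
      refine Finset.aestronglyMeasurable_fun_sum _ fun i _ => ?_
      exact (((hInt (h.gpd i) x).aestronglyMeasurable).const_mul _).smul_const _)
    (Filter.Eventually.of_forall fun y x _ => by
      refine (norm_sum_smul_cf_le _).trans (Finset.sum_le_sum fun i _ => ?_)
      rw [abs_mul, abs_neg, abs_mul, abs_of_pos (inv_pos.2 hr), ← mul_assoc]
      gcongr
      exact hC i _)
    (integrable_finsetSum _ fun i _ => hφ.abs.const_mul _)
    (Filter.Eventually.of_forall fun y x _ => by
      have h1 : HasFDerivAt (fun x : Eu N => r⁻¹ • (y - x))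
          (r⁻¹ • (-ContinuousLinearMap.id ℝ (Eu N))) x := by
        exact HasFDerivAt.const_smul ((hasFDerivAt_id (𝕜 := ℝ) x).const_sub y) r⁻¹
      have h2 := ((h.diffAt (r⁻¹ • (y - x))).hasFDerivAt.comp x h1).mul_const (φ y)
      refine h2.congr_fderiv ?_
      rw [fderiv_eq_sum_pd]
      ext v
      simp only [smul_apply, ContinuousLinearMap.comp_apply,
        sum_apply, cf_apply, smul_eq_mul, neg_apply,
        ContinuousLinearMap.id_apply, Finset.mul_sum]
      refine Finset.sum_congr rfl fun i _ => ?_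
      simp only [PiLp.smul_apply, PiLp.neg_apply, smul_eq_mul]
      ring)
  have e1 : (fun x => Aop η φ r x) = fun x => (r ^ N)⁻¹ * ∫ y, η (r⁻¹ • (y - x)) * φ y :=
    funext fun x => Aop_eq hr x
  rw [e1]
  refine (key.const_mul _).congr_fderiv ?_
  rw [integral_finsetSum _ fun i _ => ((hInt (h.gpd i) x).const_mul _).smul_const _,
    Finset.smul_sum]
  refine Finset.sum_congr rfl fun i _ => ?_
  rw [integral_smul_const, integral_const_mul, Aop_eq hr, smul_smul]
  congr 1
  ring

lemma hasDerivAt_Aop {η φ : Eu N → ℝ} (h : GK η) (hφ : Integrable φ) {r : ℝ} (hr : 0 < r)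
    (x : Eu N) : HasDerivAt (fun r => Aop η φ r x)
      (-r⁻¹ * ∑ i, Aop (pd i fun z => z i * η z) φ r x) r := by
  choose C hC0 hC using fun i => ((h.gpd i).coord i).bounded
  have hInt : ∀ {θ : Eu N → ℝ}, GK θ → ∀ r : ℝ, Integrable (fun y => θ (r⁻¹ • (y - x)) * φ y) := by
    intro θ hθ r
    obtain ⟨C, _, hC⟩ := hθ.bounded
    have := hθ.continuous
    exact hφ.bdd_mul (c := C) (by fun_prop) (Filter.Eventually.of_forall fun z => hC _)
  have key := (hasDerivAt_integral_of_dominated_loc_of_deriv_le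
    (μ := (volume : Measure (Eu N))) (F := fun r y => η (r⁻¹ • (y - x)) * φ y) (x₀ := r)
    (s := Ioi (r / 2))
    (F' := fun r y => ∑ i, -r⁻¹ * ((r⁻¹ • (y - x)) i * pd i η (r⁻¹ • (y - x)) * φ y))
    (bound := fun y => ∑ i, (r / 2)⁻¹ * C i * |φ y|) (Ioi_mem_nhds (by linarith))
    (Filter.Eventually.of_forall fun r => (hInt h r).aestronglyMeasurable) (hInt h r)
    (Finset.aestronglyMeasurable_fun_sum _ fun i _ =>
      ((hInt ((h.gpd i).coord i) r).aestronglyMeasurable).const_mul _)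
    (Filter.Eventually.of_forall fun y t ht => by
      refine (norm_sum_le _ _).trans (Finset.sum_le_sum fun i _ => ?_)
      have ht' : r / 2 < t := ht
      have ht0 : 0 < t := by linarith
      rw [Real.norm_eq_abs, abs_mul, abs_neg, abs_mul, abs_of_pos (inv_pos.2 ht0), ← mul_assoc]
      gcongr
      exact hC i _)
    (integrable_finsetSum _ fun i _ => hφ.abs.const_mul _)
    (Filter.Eventually.of_forall fun y t ht => by
      have ht' : r / 2 < t := ht
      have ht0 : 0 < t := by linarith
      have h1 : HasDerivAt (fun t : ℝ => t⁻¹ • (y - x)) (-(t ^ 2)⁻¹ • (y - x)) t :=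
        (hasDerivAt_inv ht0.ne').smul_const _
      have h2 := ((h.diffAt (t⁻¹ • (y - x))).hasFDerivAt.comp_hasDerivAt t h1).mul_const (φ y)
      refine h2.congr_deriv ?_
      rw [fderiv_apply_eq_sum, Finset.sum_mul]
      refine Finset.sum_congr rfl fun i _ => ?_
      simp only [PiLp.smul_apply, smul_eq_mul]
      field_simp)).2
  have h3 : HasDerivAt (fun r : ℝ => (r ^ N)⁻¹) (-(N * r⁻¹ * (r ^ N)⁻¹)) r := by
    have := (hasDerivAt_pow N r).fun_inv (by positivity)
    refine this.congr_deriv ?_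
    rcases N with _ | n
    · simp
    · simp only [Nat.add_sub_cancel]; field_simp; ring
  have h4 := h3.mul key
  have e1 : (fun r => Aop η φ r x) =ᶠ[nhds r]
      fun r => (r ^ N)⁻¹ * ∫ y, η (r⁻¹ • (y - x)) * φ y :=
    Filter.eventually_of_mem (Ioi_mem_nhds hr) fun t ht => Aop_eq ht x
  refine (h4.congr_of_eventuallyEq e1).congr_deriv ?_
  have e2 : ∀ i, Aop (pd i fun z => z i * η z) φ r x =
      (r ^ N)⁻¹ * ((∫ y, η (r⁻¹ • (y - x)) * φ y) +
        ∫ y, (r⁻¹ • (y - x)) i * pd i η (r⁻¹ • (y - x)) * φ y) := fun i => by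
    rw [Aop_eq hr, ← integral_add (hInt h r) (hInt ((h.gpd i).coord i) r)]
    congr 1
    refine integral_congr_ae (Filter.Eventually.of_forall fun y => ?_)
    simp only
    rw [pd_coord_mul i i (h.diffAt _)]
    simp; ring
  simp only [e2]
  rw [integral_finsetSum _ fun i _ => (hInt ((h.gpd i).coord i) r).const_mul _,
    Finset.sum_congr rfl fun i _ => integral_const_mul _ _, ← Finset.mul_sum, ← Finset.mul_sum,
    Finset.sum_add_distrib]
  simp
  ring

end Kernels

section Smoothing

variable {N : ℕ}

lemma hasCompactSupport_pd {k : Eu N → ℝ} (hk : HasCompactSupport k) (i : Fin N) :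
    HasCompactSupport (pd i k) := hk.fderiv_apply ℝ (ev i)

lemma exists_bound {k : Eu N → ℝ} (hk : HasCompactSupport k) (hc : Continuous k) :
    ∃ M, 0 ≤ M ∧ ∀ y, |k y| ≤ M := by
  obtain ⟨M, hM⟩ := hc.bounded_above_of_compact_support hk
  exact ⟨M, (norm_nonneg _).trans (hM 0), hM⟩

/-- The covector on `ℝ × E` with time component `a` and space components `c`. -/
def stcov (a : ℝ) (c : Fin N → ℝ) : ℝ × Eu N →L[ℝ] ℝ :=
  a • ContinuousLinearMap.fst ℝ ℝ (Eu N) +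
    ∑ i, c i • (cf i).comp (ContinuousLinearMap.snd ℝ ℝ (Eu N))

lemma stcov_apply (a : ℝ) (c : Fin N → ℝ) (q : ℝ × Eu N) :
    stcov a c q = a * q.1 + ∑ i, c i * q.2 i := by simp [stcov]

lemma smul_stcov (b a : ℝ) (c : Fin N → ℝ) : b • stcov a c = stcov (b * a) fun i => b * c i := by
  refine ContinuousLinearMap.ext fun q => ?_
  simp [stcov_apply, mul_add, Finset.mul_sum, mul_assoc]

lemma add_stcov (a b : ℝ) (c d : Fin N → ℝ) :
    stcov a c + stcov b d = stcov (a + b) fun i => c i + d i := by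
  refine ContinuousLinearMap.ext fun q => ?_
  simp [stcov_apply, add_mul, Finset.sum_add_distrib]
  ring

lemma contDiff_succ_of_stcov {f g : ℝ × Eu N → ℝ} {c : Fin N → ℝ × Eu N → ℝ} {n : ℕ}
    (h : ∀ q, HasFDerivAt f (stcov (g q) fun i => c i q) q) (hg : ContDiff ℝ n g)
    (hc : ∀ i, ContDiff ℝ n (c i)) : ContDiff ℝ (n + 1 : ℕ) f := by
  push_cast
  exact contDiff_succ_iff_hasFDerivAt.2 ⟨_, (hg.smul contDiff_const).add
    (ContDiff.sum fun i _ => (hc i).smul contDiff_const), h⟩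

lemma norm_stcov_le (a : ℝ) (c : Fin N → ℝ) : ‖stcov a c‖ ≤ |a| + ∑ i, |c i| := by
  refine ContinuousLinearMap.opNorm_le_bound _ (by positivity) fun q => ?_
  rw [stcov_apply, add_mul, Finset.sum_mul]
  refine (abs_add_le _ _).trans (add_le_add ?_ ((Finset.abs_sum_le_sum_abs _ _).trans ?_))
  · rw [abs_mul]
    exact mul_le_mul_of_nonneg_left (norm_fst_le q) (abs_nonneg _)
  · refine Finset.sum_le_sum fun i _ => ?_
    rw [abs_mul]
    exact mul_le_mul_of_nonneg_left ((abs_coord_le i _).trans (norm_snd_le q)) (abs_nonneg _)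

lemma continuous_stcov {a : Eu N → ℝ} {c : Fin N → Eu N → ℝ} (ha : Continuous a)
    (hc : ∀ i, Continuous (c i)) : Continuous fun z => stcov (a z) fun i => c i z :=
  (ha.smul continuous_const).add (continuous_finsetSum _ fun i _ => (hc i).smul continuous_const)

lemma eq_stcov (L : ℝ × Eu N →L[ℝ] ℝ) : L = stcov (L (1, 0)) fun i => L (0, ev i) := by
  refine ContinuousLinearMap.ext fun v => ?_
  have : v = v.1 • ((1 : ℝ), (0 : Eu N)) + ∑ i, v.2 i • ((0 : ℝ), (ev i : Eu N)) := by
    refine Prod.ext ?_ ?_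
    · simp [Prod.fst_sum]
    · simp only [Prod.snd_add, Prod.snd_sum, Prod.smul_snd, smul_zero, zero_add]
      exact eq_sum_ev v.2
  conv_lhs => rw [this]
  rw [map_add, map_sum, stcov_apply, map_smul, smul_eq_mul, mul_comm]
  simp only [map_smul, smul_eq_mul, mul_comm]

lemma hasFDerivAt_kernel_mul {η k : Eu N → ℝ} (hk : ContDiff ℝ 1 k) (z : Eu N) (q : ℝ × Eu N) :
    HasFDerivAt (fun q : ℝ × Eu N => η z * k (q.2 + q.1 • z))
      (stcov (∑ i, z i * η z * pd i k (q.2 + q.1 • z))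
        fun i => η z * pd i k (q.2 + q.1 • z)) q := by
  set L := ContinuousLinearMap.snd ℝ ℝ (Eu N) +
    (ContinuousLinearMap.fst ℝ ℝ (Eu N)).smulRight z with hL
  have hLv : ∀ v, L v = v.2 + v.1 • z := fun v => by simp [hL]
  have h1 : HasFDerivAt (fun q : ℝ × Eu N => q.2 + q.1 • z) L q := by
    simp only [← hLv]
    exact L.hasFDerivAt
  have h2 := (((hk.diffAt (by simp) (q.2 + q.1 • z))).hasFDerivAt.comp q h1).const_mul (η z)
  refine h2.congr_fderiv (ContinuousLinearMap.ext fun v => ?_)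
  rw [smul_apply, ContinuousLinearMap.comp_apply, fderiv_apply_eq_sum, stcov_apply, hLv,
    smul_eq_mul, Finset.mul_sum, Finset.sum_mul, ← Finset.sum_add_distrib]
  refine Finset.sum_congr rfl fun i _ => ?_
  simp only [PiLp.add_apply, PiLp.smul_apply, smul_eq_mul]
  ring

lemma hasFDerivAt_Aop_joint {η k : Eu N → ℝ} (h : GK η) (hk : ContDiff ℝ 1 k)
    (hs : HasCompactSupport k) (q : ℝ × Eu N) :
    HasFDerivAt (fun q : ℝ × Eu N => Aop η k q.1 q.2)
      (stcov (∑ i, Aop (fun z => z i * η z) (pd i k) q.1 q.2)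
        fun i => Aop η (pd i k) q.1 q.2) q := by
  have hpc : ∀ i, Continuous (pd i k) := fun i =>
    (contDiff_pd (m := 0) hk (by norm_num) i).continuous
  choose M hM0 hM using fun i => exists_bound (hasCompactSupport_pd hs i) (hpc i)
  obtain ⟨M0, _, hM0'⟩ := exists_bound hs hk.continuous
  have hηc := h.continuous
  have hkc := hk.continuous
  have i1 : ∀ i (q : ℝ × Eu N), Integrable fun z => z i * η z * pd i k (q.2 + q.1 • z) :=
    fun i q => (h.coord i).integrable_mul_bdd (hpc i) (hM i) q.1 q.2
  have hbd : ∀ (z : Eu N) (q : ℝ × Eu N), ‖stcov (∑ i, z i * η z * pd i k (q.2 + q.1 • z))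
        fun i => η z * pd i k (q.2 + q.1 • z)‖ ≤
      (∑ i, |z i * η z| * M i) + ∑ i, |η z| * M i := fun z q => by
    have a1 : |∑ i, z i * η z * pd i k (q.2 + q.1 • z)| ≤ ∑ i, |z i * η z| * M i :=
      (Finset.abs_sum_le_sum_abs _ _).trans (Finset.sum_le_sum fun i _ => by
        rw [abs_mul]
        exact mul_le_mul_of_nonneg_left (hM i _) (abs_nonneg _))
    have a2 : ∑ i, |η z * pd i k (q.2 + q.1 • z)| ≤ ∑ i, |η z| * M i :=
      Finset.sum_le_sum fun i _ => by
        rw [abs_mul]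
        exact mul_le_mul_of_nonneg_left (hM i _) (abs_nonneg _)
    exact (norm_stcov_le _ _).trans (add_le_add a1 a2)
  have hbi : Integrable fun z : Eu N => (∑ i, |z i * η z| * M i) + ∑ i, |η z| * M i :=
    (integrable_finsetSum _ fun i _ => (h.coord i).integrable.abs.mul_const _).add
      (integrable_finsetSum _ fun i _ => h.integrable.abs.mul_const _)
  have hF' : ∀ q : ℝ × Eu N, Integrable fun z : Eu N =>
      stcov (∑ i, z i * η z * pd i k (q.2 + q.1 • z))
        fun i => η z * pd i k (q.2 + q.1 • z) := fun q =>
    hbi.mono' (continuous_stcov (by fun_prop) (by fun_prop)).aestronglyMeasurable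
      (Filter.Eventually.of_forall fun z => hbd z q)
  have key := hasFDerivAt_integral_of_dominated_of_fderiv_le (μ := (volume : Measure (Eu N)))
    (F := fun q : ℝ × Eu N => fun z => η z * k (q.2 + q.1 • z)) (x₀ := q) (s := univ)
    (F' := fun q z => stcov (∑ i, z i * η z * pd i k (q.2 + q.1 • z))
        fun i => η z * pd i k (q.2 + q.1 • z))
    (bound := fun z => (∑ i, |z i * η z| * M i) + ∑ i, |η z| * M i)
    Filter.univ_mem
    (Filter.Eventually.of_forall fun x =>
      (h.integrable_mul_bdd hkc hM0' x.1 x.2).aestronglyMeasurable)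
    (h.integrable_mul_bdd hkc hM0' q.1 q.2)
    (hF' q).aestronglyMeasurable
    (Filter.Eventually.of_forall fun z q _ => hbd z q)
    hbi (Filter.Eventually.of_forall fun z q _ => hasFDerivAt_kernel_mul hk z q)
  refine key.congr_fderiv ?_
  rw [eq_stcov (∫ z, _)]
  congr 1
  · rw [ContinuousLinearMap.integral_apply (hF' q)]
    simp only [stcov_apply]
    simp only [Aop]
    rw [← integral_finsetSum _ fun i _ => i1 i q]
    simp
  · funext i
    rw [ContinuousLinearMap.integral_apply (hF' q)]
    simp only [stcov_apply]
    simp [Aop, ev_apply]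

lemma mul_Aop_pd {η k : Eu N → ℝ} (h : GK η) (hk : ContDiff ℝ 1 k)
    (hs : HasCompactSupport k) (i : Fin N) (r : ℝ) (x : Eu N) :
    r * Aop η (pd i k) r x = -Aop (pd i η) k r x := by
  have hpc : Continuous (pd i k) := (contDiff_pd (m := 0) hk (by norm_num) i).continuous
  obtain ⟨M, _, hM⟩ := exists_bound (hasCompactSupport_pd hs i) hpc
  obtain ⟨M0, _, hM0⟩ := exists_bound hs hk.continuous
  have hd : ∀ z, HasFDerivAt (fun z : Eu N => k (x + r • z))
      ((fderiv ℝ k (x + r • z)).comp (r • ContinuousLinearMap.id ℝ (Eu N))) z := fun z =>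
    (hk.diffAt (by simp) (x + r • z)).hasFDerivAt.comp z
      (((hasFDerivAt_id (𝕜 := ℝ) z).const_smul r).const_add x)
  have e : ∀ z, fderiv ℝ (fun z : Eu N => k (x + r • z)) z (ev i) = r * pd i k (x + r • z) :=
    fun z => by rw [(hd z).fderiv]; simp [pd]
  have i1 := h.integrable_mul_bdd hpc hM r x
  have := integral_mul_fderiv_eq_neg_fderiv_mul_of_integrable (μ := (volume : Measure (Eu N)))
    (f := η) (g := fun z => k (x + r • z)) (v := ev i)
    ((h.gpd i).integrable_mul_bdd hk.continuous hM0 r x)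
    (by simp only [e]; refine (i1.const_mul r).congr (Filter.Eventually.of_forall fun z => ?_)
        simp only; ring)
    (h.integrable_mul_bdd hk.continuous hM0 r x) (fun z _ => h.diffAt z)
    (fun z _ => (hd z).differentiableAt)
  simp only [e] at this
  rw [Aop, Aop, ← integral_const_mul, show (∫ z, pd i η z * k (x + r • z)) = _ from rfl]
  refine Eq.trans ?_ this
  exact integral_congr_ae (Filter.Eventually.of_forall fun z => by simp only; ring)

lemma contDiff_Aop {m : ℕ} : ∀ {η k : Eu N → ℝ}, GK η → ContDiff ℝ m k → HasCompactSupport k →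
    ContDiff ℝ m fun q : ℝ × Eu N => Aop η k q.1 q.2 := by
  induction m with
  | zero =>
    intro η k h hk hs
    obtain ⟨M0, _, hM0⟩ := exists_bound hs hk.continuous
    exact contDiff_zero.2 (continuous_Aop h hk.continuous hM0)
  | succ m ih =>
    intro η k h hk hs
    have hp : ∀ i, ContDiff ℝ m (pd i k) := fun i => contDiff_pd hk (by norm_cast) i
    refine contDiff_succ_of_stcov (fun q => hasFDerivAt_Aop_joint h (hk.of_le (by
      norm_cast; omega)) hs q) ?_ ?_
    · exact ContDiff.sum fun i _ => ih (h.coord i) (hp i) (hasCompactSupport_pd hs i)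
    · exact fun i => ih h (hp i) (hasCompactSupport_pd hs i)

lemma contDiff_pow_mul_Aop {m : ℕ} (hm : 1 ≤ m) (j : ℕ) : ∀ {η k : Eu N → ℝ}, GK η →
    ContDiff ℝ m k → HasCompactSupport k →
    ContDiff ℝ (m + j : ℕ) fun q : ℝ × Eu N => q.1 ^ j * Aop η k q.1 q.2 := by
  induction j with
  | zero => intro η k h hk hs; simpa using contDiff_Aop h hk hs
  | succ j ih =>
    intro η k h hk hs
    have hk1 : ContDiff ℝ 1 k := hk.of_le (by exact_mod_cast hm)
    rw [← add_assoc]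
    refine contDiff_succ_of_stcov
      (g := fun q : ℝ × Eu N => (j + 1) * (q.1 ^ j * Aop η k q.1 q.2) -
        ∑ i, q.1 ^ j * Aop (pd i fun z => z i * η z) k q.1 q.2)
      (c := fun i q => (-1) * (q.1 ^ j * Aop (pd i η) k q.1 q.2)) (fun q => ?_) ?_ ?_
    · have h1 : HasFDerivAt (fun q : ℝ × Eu N => q.1 ^ (j + 1))
          (stcov ((j + 1) * q.1 ^ j) (fun _ => 0)) q := by
        have := (hasFDerivAt_fst (𝕜 := ℝ) (p := q)).pow (j + 1)
        refine this.congr_fderiv ?_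
        ext v <;> simp [stcov]
      refine (h1.mul (hasFDerivAt_Aop_joint h hk1 hs q)).congr_fderiv ?_
      have e1 : ∀ i, q.1 * Aop (fun z => z i * η z) (pd i k) q.1 q.2 = _ := fun i =>
        mul_Aop_pd (h.coord i) hk1 hs i q.1 q.2
      have e2 : ∀ i, q.1 * Aop η (pd i k) q.1 q.2 = _ := fun i =>
        mul_Aop_pd h hk1 hs i q.1 q.2
      rw [smul_stcov, smul_stcov, add_stcov]
      congr 1
      · rw [pow_succ, mul_assoc, Finset.mul_sum, Finset.sum_congr rfl fun i _ => e1 i,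
          Finset.sum_neg_distrib, ← Finset.mul_sum]
        ring
      · funext i
        rw [pow_succ, mul_assoc, e2 i]
        ring
    · exact (contDiff_const.mul (ih h hk hs)).sub
        (ContDiff.sum fun i _ => ih ((h.coord i).gpd i) hk hs)
    · exact fun i => contDiff_const.mul (ih (h.gpd i) hk hs)

end Smoothing

section Potential

variable {N : ℕ}

/-- The superposition over all scales of the averages of `φ` against `η`, with weight `ω`. -/
def PI (ω : ℝ → ℝ) (η φ : Eu N → ℝ) (x : Eu N) : ℝ := ∫ r in Ioi (0 : ℝ), ω r * Aop η φ r x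

/-- The Gaussian damping factor. -/
def ES (s r : ℝ) : ℝ := Real.exp (-(s / 2) * r ^ 2)

lemma ES_pos (s r : ℝ) : 0 < ES s r := Real.exp_pos _

lemma ES_le_one {s : ℝ} (hs : 0 ≤ s) (r : ℝ) : ES s r ≤ 1 :=
  Real.exp_le_one_iff.2 (by nlinarith [mul_nonneg hs (sq_nonneg r)])

lemma continuous_ES (s : ℝ) : Continuous (ES s) := by unfold ES; fun_prop

lemma integrable_rpow_ES {s q : ℝ} (hs : 0 < s) (hq : -1 < q) :
    IntegrableOn (fun r => r ^ q * ES s r) (Ioi 0) :=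
  integrableOn_rpow_mul_exp_neg_mul_sq (half_pos hs) hq

lemma integral_rpow_ES_le {s q : ℝ} (hs : 2 ≤ s) (hq : -1 / 2 ≤ q) :
    ∫ r in Ioi (0 : ℝ), r ^ q * ES s r ≤ Real.Gamma ((q + 1) / 2) * (s / 2) ^ (-1 / 4 : ℝ) := by
  have h := integral_rpow_mul_exp_neg_mul_rpow (p := 2) (q := q) (b := s / 2) two_pos
    (by linarith) (by linarith)
  simp only [Real.rpow_two] at h
  unfold ES
  rw [h]
  have h1 : (s / 2) ^ (-(q + 1) / 2 : ℝ) ≤ (s / 2) ^ (-1 / 4 : ℝ) :=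
    Real.rpow_le_rpow_of_exponent_le (by linarith) (by linarith)
  have h2 : 0 < Real.Gamma ((q + 1) / 2) := Real.Gamma_pos_of_pos (by linarith)
  have h3 : 0 ≤ (s / 2) ^ (-(q + 1) / 2 : ℝ) := Real.rpow_nonneg (by linarith) _
  rw [mul_comm]
  exact mul_le_mul_of_nonneg_left (by linarith) h2.le

lemma aesm_PI {ω : ℝ → ℝ} {η φ : Eu N → ℝ} (hω : ContinuousOn ω (Ioi 0)) (h : GK η)
    (hφ : Continuous φ) {M : ℝ} (hM : ∀ y, |φ y| ≤ M) (x : Eu N) :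
    AEStronglyMeasurable (fun r => ω r * Aop η φ r x) (volume.restrict (Ioi 0)) :=
  (hω.mul ((continuous_Aop h hφ hM).comp
    (continuous_id.prodMk continuous_const)).continuousOn).aestronglyMeasurable measurableSet_Ioi

lemma integrableOn_PI {ω : ℝ → ℝ} {η φ : Eu N → ℝ} (hω : ContinuousOn ω (Ioi 0)) (h : GK η)
    (hφ : Continuous φ) {M : ℝ} (hM : ∀ y, |φ y| ≤ M) {b : ℝ → ℝ} (hb : IntegrableOn b (Ioi 0))
    {x : Eu N} (hle : ∀ r, 0 < r → |ω r * Aop η φ r x| ≤ b r) :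
    IntegrableOn (fun r => ω r * Aop η φ r x) (Ioi 0) :=
  hb.mono' (aesm_PI hω h hφ hM x) ((ae_restrict_iff' measurableSet_Ioi).2
    (Filter.Eventually.of_forall fun r hr => hle r hr))

lemma abs_PI_le {ω : ℝ → ℝ} {η φ : Eu N → ℝ} {b : ℝ → ℝ} (hb : IntegrableOn b (Ioi 0))
    {x : Eu N} (hle : ∀ r, 0 < r → |ω r * Aop η φ r x| ≤ b r) :
    |PI ω η φ x| ≤ ∫ r in Ioi (0 : ℝ), b r := by
  rw [← Real.norm_eq_abs]
  exact norm_integral_le_of_norm_le hb ((ae_restrict_iff' measurableSet_Ioi).2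
    (Filter.Eventually.of_forall fun r hr => hle r hr))

lemma continuous_PI {ω : ℝ → ℝ} {η φ : Eu N → ℝ} (hω : ContinuousOn ω (Ioi 0)) (h : GK η)
    (hφ : Continuous φ) {M : ℝ} (hM : ∀ y, |φ y| ≤ M) {b : ℝ → ℝ} (hb : IntegrableOn b (Ioi 0))
    (hle : ∀ x r, 0 < r → |ω r * Aop η φ r x| ≤ b r) : Continuous (PI ω η φ) := by
  refine continuous_of_dominated (fun x => aesm_PI hω h hφ hM x) (fun x =>
    (ae_restrict_iff' measurableSet_Ioi).2 (Filter.Eventually.of_forall fun r hr => hle x r hr)) hb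
    (Filter.Eventually.of_forall fun r => ?_)
  exact continuous_const.mul ((continuous_Aop h hφ hM).comp (continuous_const.prodMk continuous_id))

lemma hasFDerivAt_PI {ω : ℝ → ℝ} {η φ : Eu N → ℝ} (hω : ContinuousOn ω (Ioi 0)) (h : GK η)
    (hφ : Continuous φ) (hφi : Integrable φ) {M : ℝ} (hM : ∀ y, |φ y| ≤ M) {b0 b1 : ℝ → ℝ}
    (hb0 : IntegrableOn b0 (Ioi 0)) (hb1 : IntegrableOn b1 (Ioi 0))
    (h0 : ∀ x r, 0 < r → |ω r * Aop η φ r x| ≤ b0 r)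
    (h1 : ∀ i x r, 0 < r → |-(ω r * r⁻¹) * Aop (pd i η) φ r x| ≤ b1 r) (x : Eu N) :
    HasFDerivAt (PI ω η φ) (∑ i, PI (fun r => -(ω r * r⁻¹)) (pd i η) φ x • cf i) x := by
  have hω' : ContinuousOn (fun r => -(ω r * r⁻¹)) (Ioi 0) :=
    (hω.mul (continuousOn_inv₀.mono fun r hr => ne_of_gt hr)).neg
  have hInt : ∀ i x, IntegrableOn (fun r => -(ω r * r⁻¹) * Aop (pd i η) φ r x) (Ioi 0) :=
    fun i x => integrableOn_PI hω' (h.gpd i) hφ hM hb1 (h1 i x)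
  have key := hasFDerivAt_integral_of_dominated_of_fderiv_le (𝕜 := ℝ)
    (μ := volume.restrict (Ioi (0 : ℝ))) (F := fun x r => ω r * Aop η φ r x) (s := univ)
    (F' := fun x r => ∑ i, (-(ω r * r⁻¹) * Aop (pd i η) φ r x) • cf i)
    (bound := fun r => ∑ _i : Fin N, b1 r) (x₀ := x) Filter.univ_mem
    (Filter.Eventually.of_forall fun x => aesm_PI hω h hφ hM x)
    (integrableOn_PI hω h hφ hM hb0 (h0 x))
    (Finset.aestronglyMeasurable_fun_sum _ fun i _ => (hInt i x).aestronglyMeasurable.smul_const _)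
    ((ae_restrict_iff' measurableSet_Ioi).2 (Filter.Eventually.of_forall fun r hr x _ =>
      (norm_sum_smul_cf_le _).trans (Finset.sum_le_sum fun i _ => h1 i x r hr)))
    (integrable_finsetSum _ fun i _ => hb1)
    ((ae_restrict_iff' measurableSet_Ioi).2 (Filter.Eventually.of_forall fun r hr x _ => ?_))
  · refine key.congr_fderiv ?_
    rw [integral_finsetSum _ fun i _ => (hInt i x).smul_const _]
    refine Finset.sum_congr rfl fun i _ => ?_
    rw [integral_smul_const]
    rfl
  · refine ((hasFDerivAt_Aop h hφi hr x).const_mul (ω r)).congr_fderiv ?_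
    rw [Finset.smul_sum]
    refine Finset.sum_congr rfl fun i _ => ?_
    rw [smul_smul]
    congr 1
    ring

/-- Bounded, Hölder continuous, compactly supported densities. -/
structure Dat (φ : Eu N → ℝ) (M B : ℝ) : Prop where
  cont : Continuous φ
  supp : HasCompactSupport φ
  bdd : ∀ y, |φ y| ≤ M
  hol : Hol B φ

lemma Dat.int {φ : Eu N → ℝ} {M B : ℝ} (h : Dat φ M B) : Integrable φ :=
  h.cont.integrable_of_hasCompactSupport h.supp

lemma Dat.nonneg {φ : Eu N → ℝ} {M B : ℝ} (h : Dat φ M B) : 0 ≤ M :=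
  (abs_nonneg _).trans (h.bdd 0)

lemma Hol.nonneg {φ : Eu N → ℝ} {B : ℝ} (h : Hol B φ) {x y : Eu N} (hxy : x ≠ y) : 0 ≤ B := by
  have h1 := (abs_nonneg _).trans (h x y)
  exact nonneg_of_mul_nonneg_left h1 (Real.sqrt_pos.2 (norm_pos_iff.2 (sub_ne_zero.2 hxy)))

/-- The resolvent `(s - Δ)⁻¹ φ` on the whole space. -/
def pot (s : ℝ) (φ : Eu N → ℝ) : Eu N → ℝ := PI (fun r => r * ES s r) gam φ

lemma hol_Aop_bound {η φ : Eu N → ℝ} (h : GK η) {M B : ℝ} (hφ : Dat φ M B) {K : ℝ}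
    (hK : ∀ i, ∫ z, |pd i η z| * √‖z‖ ≤ K) (hB : 0 ≤ B) {r : ℝ} (hr : 0 < r) (x y : Eu N) :
    |Aop η φ r x - Aop η φ r y| ≤ N * K * B * ‖x - y‖ * (r⁻¹ * √r) := by
  have := Convex.norm_image_sub_le_of_norm_hasFDerivWithin_le (𝕜 := ℝ) (s := univ)
    (f := fun x => Aop η φ r x) (C := N * (r⁻¹ * (K * (B * √r)))) (x := y) (y := x)
    (fun x _ => (hasFDerivAt_Aop h hφ.int hr x).hasFDerivWithinAt) (fun x _ => ?_) convex_univ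
    (mem_univ _) (mem_univ _)
  · rw [Real.norm_eq_abs] at this
    refine this.trans (le_of_eq (by ring))
  · refine (norm_sum_smul_cf_le _).trans ?_
    have : (N : ℝ) * (r⁻¹ * (K * (B * √r))) = ∑ _i : Fin N, r⁻¹ * (K * (B * √r)) := by simp
    rw [this]
    refine Finset.sum_le_sum fun i _ => ?_
    rw [abs_mul, abs_neg, abs_of_pos (inv_pos.2 hr)]
    refine mul_le_mul_of_nonneg_left ?_ (inv_pos.2 hr).le
    exact (Aop_abs_le_hol (h.gpd i) (h.integral_pd i) hφ.cont hφ.bdd hφ.hol hr.le x).trans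
      (mul_le_mul_of_nonneg_right (hK i) (by positivity))

lemma inv_mul_sqrt {r : ℝ} (hr : 0 < r) : r⁻¹ * √r = r ^ (-1 / 2 : ℝ) := by
  rw [Real.sqrt_eq_rpow, ← Real.rpow_neg_one, ← Real.rpow_add hr]
  norm_num

lemma inv_mul_inv_mul_sqrt {r : ℝ} (hr : 0 < r) : r⁻¹ * (r⁻¹ * √r) = r ^ (-3 / 2 : ℝ) := by
  rw [inv_mul_sqrt hr, ← Real.rpow_neg_one, ← Real.rpow_add hr]
  norm_num

/-- Hölder continuity of singular superpositions, by splitting scales at the distance. -/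
lemma hol_of_scales {W : ℝ → Eu N → ℝ} {a b : ℝ} (x y : Eu N)
    (hInt : ∀ x, IntegrableOn (fun r => W r x) (Ioi 0))
    (h1 : ∀ r, 0 < r → |W r x - W r y| ≤ a * r ^ (-1 / 2 : ℝ))
    (h2 : ∀ r, 0 < r → |W r x - W r y| ≤ b * ‖x - y‖ * r ^ (-3 / 2 : ℝ)) :
    |(∫ r in Ioi (0 : ℝ), W r x) - ∫ r in Ioi (0 : ℝ), W r y| ≤ (2 * a + 2 * b) * √‖x - y‖ := by
  rcases eq_or_ne x y with rfl | hxy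
  · simp
  have hd : 0 < ‖x - y‖ := norm_pos_iff.2 (sub_ne_zero.2 hxy)
  set d := ‖x - y‖ with hd'
  have hD : IntegrableOn (fun r => W r x - W r y) (Ioi 0) := (hInt x).sub (hInt y)
  rw [← integral_sub (hInt x) (hInt y), ← Ioc_union_Ioi_eq_Ioi hd.le,
    setIntegral_union (Ioc_disjoint_Ioi le_rfl) measurableSet_Ioi
      (hD.mono_set Ioc_subset_Ioi_self) (hD.mono_set (Ioi_subset_Ioi hd.le)), add_mul]
  refine (abs_add_le _ _).trans (add_le_add ?_ ?_)
  · have e1 : IntegrableOn (fun r : ℝ => a * r ^ (-1 / 2 : ℝ)) (Ioc 0 d) :=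
      ((intervalIntegrable_iff_integrableOn_Ioc_of_le hd.le).1
        (intervalIntegral.intervalIntegrable_rpow' (by norm_num))).const_mul a
    have := norm_integral_le_of_norm_le (f := fun r => W r x - W r y) e1
      ((ae_restrict_iff' measurableSet_Ioc).2 (Filter.Eventually.of_forall fun r hr => h1 r hr.1))
    refine this.trans (le_of_eq ?_)
    rw [integral_const_mul, ← intervalIntegral.integral_of_le hd.le,
      integral_rpow (Or.inl (by norm_num)), Real.sqrt_eq_rpow]
    norm_num
    ring
  · have e1 : IntegrableOn (fun r : ℝ => b * d * r ^ (-3 / 2 : ℝ)) (Ioi d) :=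
      (integrableOn_Ioi_rpow_of_lt (by norm_num) hd).const_mul (b * d)
    have := norm_integral_le_of_norm_le (f := fun r => W r x - W r y) e1
      ((ae_restrict_iff' measurableSet_Ioi).2 (Filter.Eventually.of_forall fun r hr =>
        h2 r (hd.trans hr)))
    refine this.trans (le_of_eq ?_)
    rw [integral_const_mul, integral_Ioi_rpow_of_lt (by norm_num) hd, Real.sqrt_eq_rpow]
    have : d * d ^ (-(1 / 2) : ℝ) = d ^ (1 / 2 : ℝ) := by
      nth_rewrite 1 [← Real.rpow_one d]
      rw [← Real.rpow_add hd]
      norm_num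
    rw [show (-3 / 2 + 1 : ℝ) = -(1 / 2) by norm_num, ← this]
    ring

end Potential

section PotentialBounds

variable {N : ℕ}

lemma gam_GK : GK (gam : Eu N → ℝ) := GK.base

lemma continuousOn_inv_mul_ES (s : ℝ) : ContinuousOn (fun r => r⁻¹ * ES s r) (Ioi 0) :=
  (continuousOn_inv₀.mono fun _ hr => ne_of_gt hr).mul (continuous_ES s).continuousOn

/-- A uniform constant for the kernels entering the second derivatives of the potential. -/
lemma exists_kernel_const (N : ℕ) : ∃ K : ℝ, 0 ≤ K ∧
    (∫ z : Eu N, |gam z| ≤ K) ∧ (∀ i, ∫ z : Eu N, |pd i gam z| ≤ K) ∧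
    (∀ i j, ∫ z : Eu N, |pd j (pd i gam) z| * √‖z‖ ≤ K) ∧
    (∀ i j k, ∫ z : Eu N, |pd k (pd j (pd i gam)) z| * √‖z‖ ≤ K) := by
  have n1 : ∀ f : Eu N → ℝ, 0 ≤ ∫ z, |f z| := fun f => integral_nonneg fun z => abs_nonneg _
  have n2 : ∀ f : Eu N → ℝ, 0 ≤ ∫ z, |f z| * √‖z‖ :=
    fun f => integral_nonneg fun z => by positivity
  have m1 : ∀ (f : Fin N → ℝ), (∀ i, 0 ≤ f i) → ∀ i, f i ≤ ∑ j, f j := fun f hf i =>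
    Finset.single_le_sum (fun j _ => hf j) (Finset.mem_univ i)
  have s1 := Finset.sum_nonneg fun i (_ : i ∈ (Finset.univ : Finset (Fin N))) => n1 (pd i gam)
  have s2 := Finset.sum_nonneg fun i (_ : i ∈ (Finset.univ : Finset (Fin N))) =>
    Finset.sum_nonneg fun j (_ : j ∈ (Finset.univ : Finset (Fin N))) => n2 (pd j (pd i gam))
  have s3 := Finset.sum_nonneg fun i (_ : i ∈ (Finset.univ : Finset (Fin N))) =>
    Finset.sum_nonneg fun j (_ : j ∈ (Finset.univ : Finset (Fin N))) =>
    Finset.sum_nonneg fun k (_ : k ∈ (Finset.univ : Finset (Fin N))) => n2 (pd k (pd j (pd i gam)))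
  refine ⟨(∫ z : Eu N, |gam z|) + (∑ i, ∫ z : Eu N, |pd i gam z|) +
    (∑ i, ∑ j, ∫ z : Eu N, |pd j (pd i gam) z| * √‖z‖) +
    ∑ i, ∑ j, ∑ k, ∫ z : Eu N, |pd k (pd j (pd i gam)) z| * √‖z‖, ?_, ?_, fun i => ?_,
    fun i j => ?_, fun i j k => ?_⟩
  · have := n1 gam; linarith
  · linarith
  · have := m1 _ (fun i => n1 (pd i gam)) i
    have := n1 gam
    linarith
  · have h1 := m1 _ (fun j => n2 (pd j (pd i gam))) j
    have h2 := m1 _ (fun i => Finset.sum_nonneg fun j (_ : j ∈ (Finset.univ : Finset (Fin N))) =>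
      n2 (pd j (pd i gam))) i
    have := n1 gam
    linarith
  · have h1 := m1 _ (fun k => n2 (pd k (pd j (pd i gam)))) k
    have h2 := m1 _ (fun j => Finset.sum_nonneg fun k (_ : k ∈ (Finset.univ : Finset (Fin N))) =>
      n2 (pd k (pd j (pd i gam)))) j
    have h3 := m1 _ (fun i => Finset.sum_nonneg fun j (_ : j ∈ (Finset.univ : Finset (Fin N))) =>
      Finset.sum_nonneg fun k (_ : k ∈ (Finset.univ : Finset (Fin N))) =>
      n2 (pd k (pd j (pd i gam)))) i
    have := n1 gam
    linarith

variable {s M B K : ℝ} {φ : Eu N → ℝ}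

lemma bound_ES_mul (hφ : Dat φ M B) (hK : ∫ z : Eu N, |gam z| ≤ K) (x : Eu N) (r : ℝ)
    (hr : 0 < r) : |r * ES s r * Aop gam φ r x| ≤ K * M * (r ^ (1 : ℝ) * ES s r) := by
  rw [abs_mul, abs_of_pos (mul_pos hr (ES_pos s r)), Real.rpow_one]
  have := (Aop_abs_le gam_GK hφ.bdd r x).trans (mul_le_mul_of_nonneg_right hK hφ.nonneg)
  have h2 := mul_pos hr (ES_pos s r)
  nlinarith

lemma bound_ES (hφ : Dat φ M B) {i : Fin N} (hK : ∫ z : Eu N, |pd i gam z| ≤ K) (x : Eu N)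
    (r : ℝ) : |-ES s r * Aop (pd i gam) φ r x| ≤ K * M * (r ^ (0 : ℝ) * ES s r) := by
  rw [abs_mul, abs_neg, abs_of_pos (ES_pos s r), Real.rpow_zero, one_mul, mul_comm]
  exact mul_le_mul_of_nonneg_right ((Aop_abs_le (gam_GK.gpd i) hφ.bdd r x).trans
    (mul_le_mul_of_nonneg_right hK hφ.nonneg)) (ES_pos s r).le

lemma bound_inv_ES (hφ : Dat φ M B) (hB : 0 ≤ B) {i j : Fin N}
    (hK : ∫ z : Eu N, |pd j (pd i gam) z| * √‖z‖ ≤ K) (x : Eu N) (r : ℝ) (hr : 0 < r) :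
    |r⁻¹ * ES s r * Aop (pd j (pd i gam)) φ r x| ≤ K * B * (r ^ (-1 / 2 : ℝ) * ES s r) := by
  rw [abs_mul, abs_of_pos (mul_pos (inv_pos.2 hr) (ES_pos s r)), ← inv_mul_sqrt hr]
  have := (Aop_abs_le_hol ((gam_GK.gpd i).gpd j) ((gam_GK.gpd i).integral_pd j) hφ.cont
    hφ.bdd hφ.hol hr.le x).trans (mul_le_mul_of_nonneg_right hK (by positivity))
  have h2 := mul_pos (inv_pos.2 hr) (ES_pos s r)
  nlinarith

lemma hasFDerivAt_pot (hs : 0 < s) (hφ : Dat φ M B) (x : Eu N) :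
    HasFDerivAt (pot s φ) (∑ i, PI (fun r => -ES s r) (pd i gam) φ x • cf i) x := by
  obtain ⟨K, -, hK1, hK2, -⟩ := exists_kernel_const N
  have e : ∀ i, PI (fun r => -ES s r) (pd i gam) φ x =
      PI (fun r => -(r * ES s r * r⁻¹)) (pd i gam) φ x := fun i =>
    setIntegral_congr_fun measurableSet_Ioi fun r hr => by
      have : r ≠ 0 := ne_of_gt hr
      simp only
      congr 2
      field_simp
  simp only [e]
  refine hasFDerivAt_PI (continuous_id.mul (continuous_ES s)).continuousOn gam_GK hφ.cont hφ.int
    hφ.bdd ((integrable_rpow_ES hs (q := 1) (by norm_num)).const_mul (K * M))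
    ((integrable_rpow_ES hs (q := 0) (by norm_num)).const_mul (K * M)) (bound_ES_mul hφ hK1)
    (fun i x r hr => ?_) x
  have : r ≠ 0 := ne_of_gt hr
  have e2 : r * ES s r * r⁻¹ = ES s r := by field_simp
  change |-(r * ES s r * r⁻¹) * _| ≤ _
  rw [e2]
  exact bound_ES hφ (hK2 i) x r

lemma hasFDerivAt_pot_pd (hs : 0 < s) (hφ : Dat φ M B) (hB : 0 ≤ B) (i : Fin N) (x : Eu N) :
    HasFDerivAt (PI (fun r => -ES s r) (pd i gam) φ)
      (∑ j, PI (fun r => r⁻¹ * ES s r) (pd j (pd i gam)) φ x • cf j) x := by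
  obtain ⟨K, -, -, hK2, hK3, -⟩ := exists_kernel_const N
  have e : (fun r => r⁻¹ * ES s r) = fun r => -(-ES s r * r⁻¹) := by ext r; ring
  rw [e]
  refine hasFDerivAt_PI (continuous_ES s).neg.continuousOn (gam_GK.gpd i) hφ.cont hφ.int
    hφ.bdd ((integrable_rpow_ES hs (q := 0) (by norm_num)).const_mul (K * M))
    ((integrable_rpow_ES hs (q := -1 / 2) (by norm_num)).const_mul (K * B))
    (fun x r _ => bound_ES hφ (hK2 i) x r) (fun j x r hr => ?_) x
  have e2 : -(-ES s r * r⁻¹) = r⁻¹ * ES s r := by ring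
  change |-(-ES s r * r⁻¹) * _| ≤ _
  rw [e2]
  exact bound_inv_ES hφ hB (hK3 i j) x r hr

lemma pd_pot (hs : 0 < s) (hφ : Dat φ M B) (i : Fin N) :
    pd i (pot s φ) = PI (fun r => -ES s r) (pd i gam) φ :=
  funext fun x => (hasFDerivAt_pot hs hφ x).pd_eq i

lemma pd_pd_pot (hs : 0 < s) (hφ : Dat φ M B) (hB : 0 ≤ B) (i j : Fin N) :
    pd j (pd i (pot s φ)) = PI (fun r => r⁻¹ * ES s r) (pd j (pd i gam)) φ := by
  rw [pd_pot hs hφ]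
  exact funext fun x => (hasFDerivAt_pot_pd hs hφ hB i x).pd_eq j

lemma contDiff_pot (hs : 0 < s) (hφ : Dat φ M B) (hB : 0 ≤ B) : ContDiff ℝ 2 (pot s φ) := by
  obtain ⟨K, -, -, -, hK3, -⟩ := exists_kernel_const N
  refine contDiff_succ_of_hasFDerivAt (n := 1) (hasFDerivAt_pot hs hφ) fun i => ?_
  refine contDiff_succ_of_hasFDerivAt (n := 0) (hasFDerivAt_pot_pd hs hφ hB i) fun j => ?_
  exact contDiff_zero.2 (continuous_PI (continuousOn_inv_mul_ES s) ((gam_GK.gpd i).gpd j) hφ.cont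
    hφ.bdd ((integrable_rpow_ES hs (q := -1 / 2) (by norm_num)).const_mul (K * B))
    (bound_inv_ES hφ hB (hK3 i j)))

lemma lapl_pot (hs : 0 < s) (hφ : Dat φ M B) (hB : 0 ≤ B) (x : Eu N) :
    -lapl (pot s φ) x + s * pot s φ x = φ x := by
  obtain ⟨K, -, hK1, hK2, hK3, -⟩ := exists_kernel_const N
  have i1 : IntegrableOn (fun r => r * ES s r * Aop gam φ r x) (Ioi 0) :=
    integrableOn_PI (continuous_id.mul (continuous_ES s)).continuousOn gam_GK hφ.cont hφ.bdd
      ((integrable_rpow_ES hs (q := 1) (by norm_num)).const_mul (K * M)) (bound_ES_mul hφ hK1 x)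
  have i2 : ∀ i, IntegrableOn (fun r => r⁻¹ * ES s r * Aop (pd i (pd i gam)) φ r x) (Ioi 0) :=
    fun i => integrableOn_PI (continuousOn_inv_mul_ES s) ((gam_GK.gpd i).gpd i) hφ.cont hφ.bdd
      ((integrable_rpow_ES hs (q := -1 / 2) (by norm_num)).const_mul (K * B))
      (bound_inv_ES hφ hB (hK3 i i) x)
  have e1 : lapl (pot s φ) x =
      ∫ r in Ioi (0 : ℝ), ∑ i, r⁻¹ * ES s r * Aop (pd i (pd i gam)) φ r x := by
    rw [lapl_eq, integral_finsetSum _ fun i _ => i2 i]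
    exact Finset.sum_congr rfl fun i _ => by rw [pd_pd_pot hs hφ hB]; rfl
  have hgz : ∀ i : Fin N, (fun z : Eu N => z i * gam z) = fun z => -1 * pd i gam z := fun i => by
    ext z
    rw [pd_gam]
    ring
  have hA : ∀ (i : Fin N) r, Aop (pd i fun z => z i * gam z) φ r x =
      -Aop (pd i (pd i gam)) φ r x := fun i r => by
    rw [hgz]
    have : (pd i fun z => -1 * pd i gam z) = fun z : Eu N => -pd i (pd i gam) z := by
      ext z
      rw [pd_const_mul]
      ring
    rw [this]
    simp only [Aop, neg_mul]
    exact integral_neg _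
  have hder : ∀ r ∈ Ioi (0 : ℝ), HasDerivAt (fun r => ES s r * Aop gam φ r x)
      ((∑ i, r⁻¹ * ES s r * Aop (pd i (pd i gam)) φ r x) - s * (r * ES s r * Aop gam φ r x)) r := by
    intro r hr
    have h1 : HasDerivAt (ES s) (ES s r * (-(s / 2) * (2 * r))) r := by
      have := ((hasDerivAt_pow 2 r).const_mul (-(s / 2))).exp
      exact this.congr_deriv (by simp [ES])
    refine (h1.fun_mul (hasDerivAt_Aop gam_GK hφ.int hr x)).congr_deriv ?_
    have e3 : ∑ i, r⁻¹ * ES s r * Aop (pd i (pd i gam)) φ r x =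
        r⁻¹ * ES s r * ∑ i, Aop (pd i (pd i gam)) φ r x := by rw [Finset.mul_sum]
    simp only [hA, Finset.sum_neg_distrib, e3]
    ring
  have hlim : Filter.Tendsto (fun r => ES s r * Aop gam φ r x) Filter.atTop (nhds 0) := by
    have hES : Filter.Tendsto (ES s) Filter.atTop (nhds 0) := by
      refine Real.tendsto_exp_atBot.comp ?_
      exact (Filter.tendsto_pow_atTop (by norm_num)).const_mul_atTop_of_neg (by linarith)
    have := hES.mul_const (K * M)
    rw [zero_mul] at this
    refine squeeze_zero_norm (fun r => ?_) this
    rw [norm_mul, Real.norm_eq_abs, abs_of_pos (ES_pos s r)]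
    exact mul_le_mul_of_nonneg_left ((Aop_abs_le gam_GK hφ.bdd r x).trans
      (mul_le_mul_of_nonneg_right hK1 hφ.nonneg)) (ES_pos s r).le
  have hc : Continuous fun r => ES s r * Aop gam φ r x :=
    (continuous_ES s).mul ((continuous_Aop gam_GK hφ.cont hφ.bdd).comp
      (continuous_id.prodMk continuous_const))
  have key := integral_Ioi_of_hasDerivAt_of_tendsto hc.continuousWithinAt hder
    ((integrable_finsetSum _ fun i _ => i2 i).sub (i1.const_mul s)) hlim
  rw [integral_sub (integrable_finsetSum _ fun i _ => i2 i) (i1.const_mul s), ← e1,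
    integral_const_mul] at key
  have h0 : ES s 0 * Aop gam φ 0 x = φ x := by
    simp [ES, Aop, integral_mul_const, integral_gam]
  rw [h0] at key
  change -lapl (pot s φ) x + s * (∫ r in Ioi (0 : ℝ), r * ES s r * Aop gam φ r x) = φ x
  linarith

/-- Regularity and decay in `s` of the whole space resolvent. -/
theorem pot_spec (N : ℕ) : ∃ C : ℝ, 0 ≤ C ∧ ∀ (s M B : ℝ) (φ : Eu N → ℝ), 2 ≤ s → 0 ≤ B →
    Dat φ M B →
    (∀ x, |pot s φ x| ≤ C * M * (s / 2) ^ (-1 / 4 : ℝ)) ∧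
    (∀ i x, |pd i (pot s φ) x| ≤ C * M * (s / 2) ^ (-1 / 4 : ℝ)) ∧
    (∀ i j x, |pd j (pd i (pot s φ)) x| ≤ C * B * (s / 2) ^ (-1 / 4 : ℝ)) ∧
    (∀ i j, Hol (C * B) (pd j (pd i (pot s φ)))) := by
  obtain ⟨K, hK0, hK1, hK2, hK3, hK4⟩ := exists_kernel_const N
  set G := Real.Gamma ((1 + 1) / 2) + Real.Gamma ((0 + 1) / 2) + Real.Gamma ((-1 / 2 + 1) / 2)
    with hG
  have g1 : 0 < Real.Gamma ((1 + 1) / 2) := Real.Gamma_pos_of_pos (by norm_num)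
  have g2 : 0 < Real.Gamma ((0 + 1) / 2) := Real.Gamma_pos_of_pos (by norm_num)
  have g3 : 0 < Real.Gamma ((-1 / 2 + 1) / 2) := Real.Gamma_pos_of_pos (by norm_num)
  refine ⟨K * G + 2 * (2 * K) + 2 * (N * K), by positivity, fun s M B φ hs hB hφ => ?_⟩
  have hs0 : 0 < s := by linarith
  have hκ : 0 ≤ (s / 2) ^ (-1 / 4 : ℝ) := Real.rpow_nonneg (by linarith) _
  have hM := hφ.nonneg
  have hC : K * G ≤ K * G + 2 * (2 * K) + 2 * (N * K) := by
    have : 0 ≤ (N : ℝ) * K := by positivity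
    linarith
  have bd : ∀ (q D g : ℝ), -1 / 2 ≤ q → 0 ≤ D → Real.Gamma ((q + 1) / 2) ≤ G →
      ∫ r in Ioi (0 : ℝ), K * D * (r ^ q * ES s r) ≤
      (K * G + 2 * (2 * K) + 2 * (N * K)) * D * (s / 2) ^ (-1 / 4 : ℝ) := by
    intro q D g hq hD hg
    rw [integral_const_mul]
    calc _ ≤ K * D * (G * (s / 2) ^ (-1 / 4 : ℝ)) := by
          refine mul_le_mul_of_nonneg_left ((integral_rpow_ES_le hs hq).trans ?_) (by positivity)
          exact mul_le_mul_of_nonneg_right hg hκ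
      _ = K * G * D * (s / 2) ^ (-1 / 4 : ℝ) := by ring
      _ ≤ _ := by gcongr
  refine ⟨fun x => ?_, fun i x => ?_, fun i j x => ?_, fun i j => ?_⟩
  · exact (abs_PI_le ((integrable_rpow_ES hs0 (q := 1) (by norm_num)).const_mul (K * M))
      (bound_ES_mul hφ hK1 x)).trans (bd 1 M 0 (by norm_num) hM (by linarith))
  · rw [pd_pot hs0 hφ]
    exact (abs_PI_le ((integrable_rpow_ES hs0 (q := 0) (by norm_num)).const_mul (K * M))
      (fun r _ => bound_ES hφ (hK2 i) x r)).trans (bd 0 M 0 (by norm_num) hM (by linarith))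
  · rw [pd_pd_pot hs0 hφ hB]
    exact (abs_PI_le ((integrable_rpow_ES hs0 (q := -1 / 2) (by norm_num)).const_mul (K * B))
      (bound_inv_ES hφ hB (hK3 i j) x)).trans (bd (-1 / 2) B 0 (by norm_num) hB (by linarith))
  · rw [pd_pd_pot hs0 hφ hB]
    intro x y
    refine (hol_of_scales (a := 2 * K * B) (b := N * K * B) x y (fun x =>
      integrableOn_PI (continuousOn_inv_mul_ES s) ((gam_GK.gpd i).gpd j) hφ.cont hφ.bdd
        ((integrable_rpow_ES hs0 (q := -1 / 2) (by norm_num)).const_mul (K * B))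
        (bound_inv_ES hφ hB (hK3 i j) x)) (fun r hr => ?_) (fun r hr => ?_)).trans ?_
    · have h1 := bound_inv_ES (s := s) hφ hB (hK3 i j) x r hr
      have h2 := bound_inv_ES (s := s) hφ hB (hK3 i j) y r hr
      have h3 := ES_le_one hs0.le r
      have h4 : 0 ≤ K * B * r ^ (-1 / 2 : ℝ) := mul_nonneg (by positivity) (Real.rpow_nonneg hr.le _)
      have h5 := mul_le_mul_of_nonneg_left h3 h4
      rw [← mul_assoc] at h1 h2
      refine (abs_sub _ _).trans ?_
      linarith
    · rw [← mul_sub, abs_mul, abs_of_pos (mul_pos (inv_pos.2 hr) (ES_pos s r))]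
      have h1 := hol_Aop_bound ((gam_GK.gpd i).gpd j) hφ (hK4 i j) hB hr x y
      have h3 := ES_le_one hs0.le r
      calc _ ≤ r⁻¹ * 1 * (N * K * B * ‖x - y‖ * (r⁻¹ * √r)) := by gcongr
        _ = N * K * B * ‖x - y‖ * (r⁻¹ * (r⁻¹ * √r)) := by ring
        _ = _ := by rw [inv_mul_inv_mul_sqrt hr]
    · refine mul_le_mul_of_nonneg_right ?_ (Real.sqrt_nonneg _)
      have : 0 ≤ K * G * B := by positivity
      linarith

end PotentialBounds

section PotentialSup

variable {N : ℕ}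

lemma Aop_nonneg {φ : Eu N → ℝ} (h : ∀ y, 0 ≤ φ y) (r : ℝ) (x : Eu N) : 0 ≤ Aop gam φ r x :=
  integral_nonneg fun z => mul_nonneg (gam_pos z).le (h _)

lemma pot_nonneg {φ : Eu N → ℝ} (h : ∀ y, 0 ≤ φ y) (s : ℝ) (x : Eu N) : 0 ≤ pot s φ x :=
  setIntegral_nonneg measurableSet_Ioi fun r hr =>
    mul_nonneg (mul_nonneg (le_of_lt hr) (ES_pos s r).le) (Aop_nonneg h r x)

/-- Interpolation bound of the potential between the sup norm and the integral of the density. -/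
theorem pot_sup_le {θ : ℝ} (hθ0 : 0 < θ) (hθ1 : θ < 1) (hN : N * (1 - θ) < 2) :
    ∃ C : ℝ, 0 ≤ C ∧ ∀ (φ : Eu N → ℝ) (M B : ℝ), Dat φ M B → ∫ y, |φ y| ≤ 1 →
      ∀ x, pot 2 φ x ≤ C * M ^ θ := by
  obtain ⟨G, hG0, hG⟩ := (gam_GK (N := N)).bounded
  refine ⟨∫ r in Ioi (0 : ℝ), G ^ (1 - θ) * (r ^ (1 - N * (1 - θ)) * ES 2 r),
    setIntegral_nonneg measurableSet_Ioi fun r hr => ?_, fun φ M B hφ h1 x => ?_⟩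
  · exact mul_nonneg (Real.rpow_nonneg hG0 _)
      (mul_nonneg (Real.rpow_nonneg (le_of_lt hr) _) (ES_pos _ _).le)
  have hi : IntegrableOn (fun r : ℝ => G ^ (1 - θ) * (r ^ (1 - N * (1 - θ)) * ES 2 r)) (Ioi 0) :=
    (integrable_rpow_ES two_pos (by linarith)).const_mul _
  rw [← integral_mul_const]
  refine (le_abs_self _).trans (abs_PI_le (hi.mul_const (M ^ θ)) fun r hr => ?_)
  have hgam : ∫ z : Eu N, |gam z| = 1 := by
    simp only [abs_of_pos (gam_pos _)]
    exact integral_gam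
  have a1 : |Aop gam φ r x| ≤ M := by
    have := Aop_abs_le gam_GK hφ.bdd r x
    rwa [hgam, one_mul] at this
  have a2 : |Aop gam φ r x| ≤ (r ^ N)⁻¹ * G :=
    (Aop_abs_le_l1 hG hφ.int hr x).trans (by
      have : G * ∫ y, |φ y| ≤ G * 1 := mul_le_mul_of_nonneg_left h1 hG0
      rw [mul_one] at this
      gcongr)
  have a3 : |Aop gam φ r x| ≤ M ^ θ * ((r ^ N)⁻¹ * G) ^ (1 - θ) := by
    rcases eq_or_lt_of_le (abs_nonneg (Aop gam φ r x)) with h0 | h0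
    · rw [← h0]
      exact mul_nonneg (Real.rpow_nonneg hφ.nonneg _) (Real.rpow_nonneg (by positivity) _)
    · calc |Aop gam φ r x| = |Aop gam φ r x| ^ θ * |Aop gam φ r x| ^ (1 - θ) := by
            rw [← Real.rpow_add h0]; simp
        _ ≤ _ := mul_le_mul (Real.rpow_le_rpow h0.le a1 hθ0.le)
            (Real.rpow_le_rpow h0.le a2 (by linarith)) (Real.rpow_nonneg h0.le _)
            (Real.rpow_nonneg hφ.nonneg _)
  have a4 : ((r ^ N)⁻¹ * G) ^ (1 - θ) = r ^ (-(N * (1 - θ))) * G ^ (1 - θ) := by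
    rw [Real.mul_rpow (by positivity) hG0, Real.rpow_neg hr.le, Real.rpow_mul hr.le,
      Real.rpow_natCast, Real.inv_rpow (by positivity)]
  have a5 : r ^ (1 - N * (1 - θ)) = r * r ^ (-(N * (1 - θ))) := by
    rw [sub_eq_add_neg, Real.rpow_add hr, Real.rpow_one]
  rw [abs_mul, abs_of_pos (mul_pos hr (ES_pos 2 r)), a5]
  rw [a4] at a3
  refine (mul_le_mul_of_nonneg_left a3 (mul_pos hr (ES_pos 2 r)).le).trans (le_of_eq ?_)
  ring

/-- Termwise differentiation of a series of functions. -/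
lemma hasFDerivAt_tsum_pd {u : ℕ → Eu N → ℝ} {c : ℕ → ℝ} (hc : Summable c)
    (hu : ∀ n, Differentiable ℝ (u n)) (h0 : ∀ n x, |u n x| ≤ c n)
    (h1 : ∀ i n x, |pd i (u n) x| ≤ c n) (x : Eu N) :
    HasFDerivAt (fun x => ∑' n, u n x) (∑ i, (∑' n, pd i (u n) x) • cf i) x := by
  have hs0 : ∀ x, Summable fun n => u n x := fun x =>
    Summable.of_norm_bounded hc fun n => h0 n x
  have hs1 : ∀ i x, Summable fun n => pd i (u n) x := fun i x =>
    Summable.of_norm_bounded hc fun n => h1 i n x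
  have key := hasFDerivAt_tsum (𝕜 := ℝ) (f := u) (f' := fun n x => ∑ i, pd i (u n) x • cf i)
    (u := fun n => ∑ _i : Fin N, c n) (summable_sum fun i _ => hc)
    (fun n x => fderiv_eq_sum_pd (u n) x ▸ (hu n x).hasFDerivAt)
    (fun n x => (norm_sum_smul_cf_le _).trans (Finset.sum_le_sum fun i _ => h1 i n x)) (hs0 0) x
  refine key.congr_fderiv ?_
  rw [Summable.tsum_finsetSum fun i _ => (hs1 i x).smul_const _]
  exact Finset.sum_congr rfl fun i _ => (hs1 i x).tsum_smul_const _

/-- Second order bounds of a function. -/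
structure C2Bd (u : Eu N → ℝ) (C : ℝ) : Prop where
  reg : ContDiff ℝ 2 u
  b0 : ∀ x, |u x| ≤ C
  b1 : ∀ i x, |pd i u x| ≤ C
  b2 : ∀ i j x, |pd j (pd i u) x| ≤ C

lemma C2Bd.mono {u : Eu N → ℝ} {C C' : ℝ} (h : C2Bd u C) (hC : C ≤ C') : C2Bd u C' :=
  ⟨h.reg, fun x => (h.b0 x).trans hC, fun i x => (h.b1 i x).trans hC,
    fun i j x => (h.b2 i j x).trans hC⟩

lemma C2Bd.tsum {u : ℕ → Eu N → ℝ} {c : ℕ → ℝ} (hc : Summable c) (h : ∀ n, C2Bd (u n) (c n)) :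
    C2Bd (fun x => ∑' n, u n x) (∑' n, c n) ∧
      ∀ x, lapl (fun x => ∑' n, u n x) x = ∑' n, lapl (u n) x := by
  have hd := fun n => (h n).reg.differentiable (by simp)
  have hd1 := fun i n => fun x => (h n).reg.pd_diffAt i x
  have t0 := fun x => hasFDerivAt_tsum_pd hc hd (fun n => (h n).b0) (fun i n => (h n).b1 i) x
  have t1 := fun i x => hasFDerivAt_tsum_pd hc (hd1 i) (fun n => (h n).b1 i)
    (fun j n => (h n).b2 i j) x
  have e1 : ∀ i, pd i (fun x => ∑' n, u n x) = fun x => ∑' n, pd i (u n) x :=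
    fun i => funext fun x => (t0 x).pd_eq i
  have e2 : ∀ i j, pd j (pd i (fun x => ∑' n, u n x)) = fun x => ∑' n, pd j (pd i (u n)) x :=
    fun i j => by rw [e1]; exact funext fun x => (t1 i x).pd_eq j
  have bd : ∀ f : ℕ → ℝ, (∀ n, |f n| ≤ c n) → |∑' n, f n| ≤ ∑' n, c n := fun f hf => by
    rw [← Real.norm_eq_abs]
    exact tsum_of_norm_bounded hc.hasSum hf
  refine ⟨⟨?_, fun x => bd _ fun n => (h n).b0 x, fun i x => ?_, fun i j x => ?_⟩, fun x => ?_⟩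
  · refine contDiff_succ_of_hasFDerivAt (n := 1) t0 fun i => ?_
    refine contDiff_succ_of_hasFDerivAt (n := 0) (t1 i) fun j => contDiff_zero.2 ?_
    exact continuous_tsum (fun n => (contDiff_pd (m := 0) (contDiff_pd (m := 1) (h n).reg
      (by norm_num) i) (by norm_num) j).continuous) hc fun n x => (h n).b2 i j x
  · rw [e1]; exact bd _ fun n => (h n).b1 i x
  · rw [e2]; exact bd _ fun n => (h n).b2 i j x
  · simp only [lapl_eq, e2]
    exact (Summable.tsum_finsetSum fun i _ =>
      Summable.of_norm_bounded hc fun n => (h n).b2 i i x).symm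

lemma C2Bd.lip {u : Eu N → ℝ} {C : ℝ} (h : C2Bd u C) (x y : Eu N) :
    |u x - u y| ≤ N * C * ‖x - y‖ := by
  refine Convex.norm_image_sub_le_of_norm_fderiv_le (𝕜 := ℝ) (s := univ) (f := u)
    (fun x _ => h.reg.differentiable (by simp) x) (fun x _ => ?_) convex_univ (mem_univ _)
    (mem_univ _)
  refine (norm_fderiv_le_sum _ _).trans ((Finset.sum_le_sum fun i _ => h.b1 i x).trans ?_)
  simp

lemma C2Bd.add {u v : Eu N → ℝ} {C D : ℝ} (hu : C2Bd u C) (hv : C2Bd v D) :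
    C2Bd (fun x => u x + v x) (C + D) := by
  have e1 : ∀ i, pd i (fun x => u x + v x) = fun x => pd i u x + pd i v x := fun i =>
    funext fun x => pd_add _ (hu.reg.differentiable (by simp) x) (hv.reg.differentiable (by simp) x)
  have e2 : ∀ i j, pd j (pd i (fun x => u x + v x)) = fun x => pd j (pd i u) x + pd j (pd i v) x :=
    fun i j => by
      rw [e1]
      exact funext fun x => pd_add _ (hu.reg.pd_diffAt i x) (hv.reg.pd_diffAt i x)
  refine ⟨hu.reg.add hv.reg, fun x => ?_, fun i x => ?_, fun i j x => ?_⟩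
  · exact (abs_add_le _ _).trans (add_le_add (hu.b0 x) (hv.b0 x))
  · rw [e1]; exact (abs_add_le _ _).trans (add_le_add (hu.b1 i x) (hv.b1 i x))
  · rw [e2]; exact (abs_add_le _ _).trans (add_le_add (hu.b2 i j x) (hv.b2 i j x))

lemma C2Bd.const_mul {u : Eu N → ℝ} {C : ℝ} (hu : C2Bd u C) (a : ℝ) :
    C2Bd (fun x => a * u x) (|a| * C) := by
  have e1 : ∀ i, pd i (fun x => a * u x) = fun x => a * pd i u x := fun i =>
    funext fun x => pd_const_mul _ _
  have e2 : ∀ i j, pd j (pd i (fun x => a * u x)) = fun x => a * pd j (pd i u) x :=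
    fun i j => by rw [e1]; exact funext fun x => pd_const_mul _ _
  refine ⟨contDiff_const.mul hu.reg, fun x => ?_, fun i x => ?_, fun i j x => ?_⟩
  · rw [abs_mul]; exact mul_le_mul_of_nonneg_left (hu.b0 x) (abs_nonneg _)
  · rw [e1, abs_mul]; exact mul_le_mul_of_nonneg_left (hu.b1 i x) (abs_nonneg _)
  · rw [e2, abs_mul]; exact mul_le_mul_of_nonneg_left (hu.b2 i j x) (abs_nonneg _)

/-- A compactly supported `C²` function has second order bounds. -/
lemma exists_C2Bd {u : Eu N → ℝ} (hu : ContDiff ℝ 2 u) (hs : HasCompactSupport u) :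
    ∃ C, 0 ≤ C ∧ C2Bd u C := by
  have c1 := fun i => contDiff_pd (m := 1) hu (by norm_num) i
  have c2 := fun i j => contDiff_pd (m := 0) (c1 i) (by norm_num) j
  obtain ⟨a, ha0, ha⟩ := exists_bound hs hu.continuous
  choose b hb0 hb using fun i => exists_bound (hasCompactSupport_pd hs i) (c1 i).continuous
  choose c hc0 hc using fun i j =>
    exists_bound (hasCompactSupport_pd (hasCompactSupport_pd hs i) j) (c2 i j).continuous
  have s1 := Finset.sum_nonneg fun i (_ : i ∈ (Finset.univ : Finset (Fin N))) => hb0 i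
  have s2 := fun i => Finset.sum_nonneg fun j (_ : j ∈ (Finset.univ : Finset (Fin N))) => hc0 i j
  have s3 := Finset.sum_nonneg fun i (_ : i ∈ (Finset.univ : Finset (Fin N))) => s2 i
  refine ⟨a + ∑ i, b i + ∑ i, ∑ j, c i j, by positivity, hu, fun x => ?_, fun i x => ?_,
    fun i j x => ?_⟩
  · have := ha x; linarith
  · have := hb i x
    have := Finset.single_le_sum (fun i _ => hb0 i) (Finset.mem_univ i)
    linarith
  · have := hc i j x
    have := Finset.single_le_sum (fun i _ => s2 i) (Finset.mem_univ i)
    have := Finset.single_le_sum (fun j _ => hc0 i j) (Finset.mem_univ j)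
    linarith

end PotentialSup

section Boundary

variable {N : ℕ}

/-- A bump at `x` supported in a neighbourhood of `x`. -/
lemma exists_bump {x : Eu N} {U : Set (Eu N)} (hU : U ∈ nhds x) :
    ∃ f : ContDiffBump x, tsupport f ⊆ U := by
  obtain ⟨r, hr, h⟩ := Metric.nhds_basis_closedBall.mem_iff.1 hU
  exact ⟨⟨r / 2, r, by positivity, by linarith⟩, by rw [ContDiffBump.tsupport_eq]; exact h⟩

/-- A smooth cutoff equal to one near a compact set and supported in a given neighbourhood. -/
lemma exists_cutoff {K U : Set (Eu N)} (hK : IsCompact K) (hU : IsOpen U) (hKU : K ⊆ U) :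
    ∃ ξ : Eu N → ℝ, (∀ n : ℕ, ContDiff ℝ n ξ) ∧ HasCompactSupport ξ ∧ tsupport ξ ⊆ U ∧
      (∀ x, 0 ≤ ξ x) ∧ (∀ x, ξ x ≤ 1) ∧ ∃ V, IsOpen V ∧ K ⊆ V ∧ ∀ x ∈ V, ξ x = 1 := by
  classical
  choose f hf using fun x : K => exists_bump (hU.mem_nhds (hKU x.2))
  obtain ⟨t, ht⟩ := hK.elim_nhds_subcover' (fun x hx => ball x (f ⟨x, hx⟩).rIn)
    fun x hx => ball_mem_nhds _ (f ⟨x, hx⟩).rIn_pos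
  have hsub : tsupport (fun x => 1 - ∏ i ∈ t, (1 - f i x)) ⊆ ⋃ i ∈ t, tsupport (f i) := by
    refine closure_minimal (fun x hx => ?_)
      (t.finite_toSet.isClosed_biUnion fun i _ => isClosed_tsupport _)
    by_contra hcon
    refine hx ?_
    have : ∀ i ∈ t, f i x = 0 := fun i hi => image_eq_zero_of_notMem_tsupport fun h =>
      hcon (mem_biUnion hi h)
    simp only
    rw [Finset.prod_congr rfl fun i hi => by rw [this i hi]]
    simp
  refine ⟨fun x => 1 - ∏ i ∈ t, (1 - f i x), fun n => ?_, ?_, ?_, fun x => ?_, fun x => ?_,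
    ⋃ i ∈ t, ball (i : Eu N) (f i).rIn, isOpen_biUnion fun i _ => isOpen_ball, ht, fun x hx => ?_⟩
  · exact contDiff_const.sub (contDiff_prod fun i _ => contDiff_const.sub (f i).contDiff)
  · exact (t.finite_toSet.isCompact_biUnion fun i _ => (f i).hasCompactSupport).of_isClosed_subset
      (isClosed_tsupport _) hsub
  · exact hsub.trans (iUnion₂_subset fun i _ => hf i)
  · have : ∏ i ∈ t, (1 - f i x) ≤ 1 := Finset.prod_le_one
      (fun i _ => sub_nonneg.2 (f i).le_one) fun i _ => by linarith [(f i).nonneg' x]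
    linarith
  · have : 0 ≤ ∏ i ∈ t, (1 - f i x) := Finset.prod_nonneg fun i _ => sub_nonneg.2 (f i).le_one
    linarith
  · obtain ⟨i, hi, hx⟩ := mem_iUnion₂.1 hx
    have h1 : f i x = 1 := (f i).one_of_mem_closedBall (ball_subset_closedBall hx)
    have : ∏ i ∈ t, (1 - f i x) = 0 := Finset.prod_eq_zero hi (by rw [h1, sub_self])
    simp only [this, sub_zero]

lemma frontier_notMem {Ω : Set (Eu N)} (h : IsOpen Ω) {x : Eu N} (hx : x ∈ frontier Ω) : x ∉ Ω := by
  rw [h.frontier_eq] at hx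
  exact hx.2

lemma isCompact_frontier {Ω : Set (Eu N)} (h : Bornology.IsBounded Ω) : IsCompact (frontier Ω) :=
  (h.isCompact_closure).of_isClosed_subset isClosed_frontier frontier_subset_closure

/-- Local defining functions vanish on the boundary. -/
lemma local_def_eq_zero {Ω U : Set (Eu N)} (hΩ : IsOpen Ω) (hU : IsOpen U) {f : Eu N → ℝ}
    (hf : Continuous f) (h : Ω ∩ U = {y ∈ U | f y < 0}) {y : Eu N} (hy : y ∈ frontier Ω)
    (hyU : y ∈ U) : f y = 0 := by
  refine le_antisymm ?_ ?_
  · have h1 : y ∈ closure (Ω ∩ U) := by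
      rw [inter_comm]
      exact hU.inter_closure ⟨hyU, frontier_subset_closure hy⟩
    exact closure_minimal (t := {y | f y ≤ 0}) (fun z hz => by
      rw [h] at hz
      exact hz.2.le) (isClosed_le hf continuous_const) h1
  · by_contra hcon
    have : y ∈ Ω ∩ U := by rw [h]; exact ⟨hyU, not_le.1 hcon⟩
    exact frontier_notMem hΩ hy this.1

/-- If `f` decreases strictly in a direction at a zero then it is negative shortly after. -/
lemma eventually_neg_of_fderiv {f : Eu N → ℝ} (hf : Differentiable ℝ f) {y v : Eu N}
    (h0 : f y = 0) (hv : fderiv ℝ f y v < 0) : ∀ᶠ t in nhdsWithin (0 : ℝ) (Ioi 0),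
      f (y + t • v) < 0 := by
  have h1 : HasDerivAt (fun t : ℝ => f (y + t • v)) (fderiv ℝ f y v) 0 := by
    have h2 : HasDerivAt (fun t : ℝ => y + t • v) v 0 := by
      simpa using ((hasDerivAt_id (0 : ℝ)).smul_const v).const_add y
    have h3 : HasFDerivAt f (fderiv ℝ f y) (y + (0 : ℝ) • v) := by
      rw [zero_smul, add_zero]
      exact (hf y).hasFDerivAt
    exact h3.comp_hasDerivAt (0 : ℝ) h2
  have h2 := h1.hasDerivWithinAt (s := Ioi 0)
  rw [hasDerivWithinAt_iff_tendsto_slope' (by simp)] at h2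
  filter_upwards [h2.eventually (gt_mem_nhds hv), self_mem_nhdsWithin] with t ht ht0
  rw [slope_def_field] at ht
  have ht0' : (0 : ℝ) < t := ht0
  simp only [zero_smul, add_zero, h0, sub_zero] at ht
  by_contra hcon
  exact absurd ht (not_lt.2 (div_nonneg (not_lt.1 hcon) ht0'.le))

/-- A global defining function of a `C³` domain. -/
lemma exists_defining {Ω : Set (Eu N)} (hΩ : IsC3Domain Ω) :
    ∃ (F : Eu N → ℝ) (V : Set (Eu N)), ContDiff ℝ 3 F ∧ HasCompactSupport F ∧ IsOpen V ∧
      frontier Ω ⊆ V ∧ (∀ y ∈ Ω ∩ V, F y < 0) ∧ (∀ y, y ∉ Ω → 0 ≤ F y) ∧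
      (∀ y ∈ frontier Ω, F y = 0) ∧ ∀ y ∈ frontier Ω, fderiv ℝ F y ≠ 0 := by
  classical
  obtain ⟨hΩo, -, hΩb, hloc⟩ := hΩ
  choose U f hU hxU hf hdf hUf using fun x : frontier Ω => hloc x x.2
  choose β hβ using fun x : frontier Ω => exists_bump ((hU x).mem_nhds (hxU x))
  obtain ⟨t, ht⟩ := (isCompact_frontier hΩb).elim_nhds_subcover'
    (fun x hx => ball x (β ⟨x, hx⟩).rOut) fun x hx => ball_mem_nhds _ (β ⟨x, hx⟩).rOut_pos
  have hsupp : ∀ i y, β i y ≠ 0 → y ∈ U i := fun i y hy => hβ i (subset_tsupport _ hy)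
  have hneg : ∀ i y, y ∈ Ω → β i y ≠ 0 → f i y < 0 := fun i y hy hi => by
    have : y ∈ Ω ∩ U i := ⟨hy, hsupp i y hi⟩
    rw [hUf] at this
    exact this.2
  have hpos : ∀ i y, y ∉ Ω → β i y ≠ 0 → 0 ≤ f i y := fun i y hy hi => by
    by_contra hcon
    have : y ∈ Ω ∩ U i := by rw [hUf]; exact ⟨hsupp i y hi, not_le.1 hcon⟩
    exact hy this.1
  have hzero : ∀ i y, y ∈ frontier Ω → y ∈ U i → f i y = 0 := fun i y hy hi =>
    local_def_eq_zero hΩo (hU i) (hf i).continuous (hUf i) hy hi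
  have hd : ∀ i, Differentiable ℝ (f i) := fun i => (hf i).differentiable (by simp)
  have hβd : ∀ i, Differentiable ℝ (β i) := fun i => ((β i).contDiff (n := 1)).differentiable (by simp)
  refine ⟨fun y => ∑ i ∈ t, β i y * f i y, ⋃ i ∈ t, ball (i : Eu N) (β i).rOut, ?_, ?_,
    isOpen_biUnion fun i _ => isOpen_ball, ht, fun y hy => ?_, fun y hy => ?_, fun y hy => ?_,
    fun y hy h0 => ?_⟩
  · exact ContDiff.sum fun i _ => (β i).contDiff.mul (hf i)
  · refine HasCompactSupport.intro
      (t.finite_toSet.isCompact_biUnion fun i _ => (β i).hasCompactSupport) fun x hx => ?_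
    refine Finset.sum_eq_zero fun i hi => ?_
    rw [image_eq_zero_of_notMem_tsupport fun h => hx (mem_biUnion hi h), zero_mul]
  · obtain ⟨i, hi, hyi⟩ := mem_iUnion₂.1 hy.2
    have hp := (β i).pos_of_mem_ball hyi
    refine Finset.sum_neg' (fun j hj => ?_) ⟨i, hi, ?_⟩
    · rcases eq_or_ne (β j y) 0 with h | h
      · rw [h, zero_mul]
      · exact mul_nonpos_of_nonneg_of_nonpos ((β j).nonneg) (hneg j y hy.1 h).le
    · exact mul_neg_of_pos_of_neg hp (hneg i y hy.1 hp.ne')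
  · refine Finset.sum_nonneg fun j hj => ?_
    rcases eq_or_ne (β j y) 0 with h | h
    · rw [h, zero_mul]
    · exact mul_nonneg ((β j).nonneg) (hpos j y hy h)
  · refine Finset.sum_eq_zero fun j hj => ?_
    rcases eq_or_ne (β j y) 0 with h | h
    · rw [h, zero_mul]
    · rw [hzero j y hy (hsupp j y h), mul_zero]
  · obtain ⟨i, hi, hyi⟩ := mem_iUnion₂.1 (ht hy)
    have hp := (β i).pos_of_mem_ball hyi
    have hyU := hsupp i y hp.ne'
    obtain ⟨v, hv⟩ : ∃ v, fderiv ℝ (f i) y v < 0 := by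
      obtain ⟨w, hw⟩ : ∃ w, fderiv ℝ (f i) y w ≠ 0 := by
        by_contra! hcon
        exact hdf i y hyU (ContinuousLinearMap.ext hcon)
      rcases lt_or_gt_of_ne hw with h | h
      · exact ⟨w, h⟩
      · exact ⟨-w, by rw [map_neg]; linarith⟩
    have hle : ∀ j ∈ t, β j y ≠ 0 → fderiv ℝ (f j) y v ≤ 0 := by
      intro j hj hjy
      by_contra hcon
      have hyUj := hsupp j y hjy
      have h1 := eventually_neg_of_fderiv (hd i) (hzero i y hy hyU) hv
      have h2 := eventually_neg_of_fderiv (f := fun z => -f j z) (y := y) (v := v)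
        (hd j).neg (by rw [hzero j y hy hyUj, neg_zero])
        (by rw [fderiv_fun_neg, neg_apply]; linarith)
      have hline : Filter.Tendsto (fun t : ℝ => y + t • v) (nhdsWithin (0 : ℝ) (Ioi 0)) (nhds y) := by
        have : Continuous fun t : ℝ => y + t • v := by fun_prop
        have := this.tendsto 0
        rw [zero_smul, add_zero] at this
        exact this.mono_left nhdsWithin_le_nhds
      have h3 := hline.eventually ((hU i).mem_nhds hyU)
      have h4 := hline.eventually ((hU j).mem_nhds hyUj)
      obtain ⟨s, hs1, hs2, hs3, hs4⟩ := (h1.and (h2.and (h3.and h4))).exists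
      have h5 : y + s • v ∈ Ω ∩ U i := by rw [hUf]; exact ⟨hs3, hs1⟩
      have h6 : y + s • v ∈ Ω ∩ U j := ⟨h5.1, hs4⟩
      rw [hUf] at h6
      have := h6.2
      linarith
    have e : fderiv ℝ (fun y => ∑ i ∈ t, β i y * f i y) y v = ∑ i ∈ t, β i y * fderiv ℝ (f i) y v := by
      rw [fderiv_fun_sum fun j _ => (hβd j y).fun_mul (hd j y), sum_apply]
      refine Finset.sum_congr rfl fun j _ => ?_
      rw [fderiv_fun_mul (hβd j y) (hd j y)]
      rcases eq_or_ne (β j y) 0 with h | h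
      · have : fderiv ℝ (β j) y = 0 := by
          have : IsLocalMin (β j) y := Filter.Eventually.of_forall fun z => by
            rw [h]; exact (β j).nonneg
          exact this.fderiv_eq_zero
        simp [h, this]
      · simp [hzero j y hy (hsupp j y h)]
    rw [h0] at e
    have : ∑ i ∈ t, β i y * fderiv ℝ (f i) y v < 0 := by
      refine Finset.sum_neg' (fun j hj => ?_) ⟨i, hi, mul_neg_of_pos_of_neg hp hv⟩
      rcases eq_or_ne (β j y) 0 with h | h
      · rw [h, zero_mul]
      · exact mul_nonpos_of_nonneg_of_nonpos ((β j).nonneg) (hle j hj h)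
    simp at e
    linarith

end Boundary

section Reflection

variable {N : ℕ}

lemma pd_mul_of_zero {F P : Eu N → ℝ} {x : Eu N} (hF : DifferentiableAt ℝ F x) (h0 : F x = 0)
    (hP : ContinuousAt P x) (i : Fin N) : pd i (fun y => F y * P y) x = pd i F x * P x := by
  have h : HasFDerivAt (fun y => F y * P y) (P x • fderiv ℝ F x) x := by
    rw [hasFDerivAt_iff_isLittleO]
    have h1 := (hasFDerivAt_iff_isLittleO.1 hF.hasFDerivAt).const_mul_left (P x)
    have h2 : (fun y => F y - F x) =O[nhds x] fun y => y - x := hF.hasFDerivAt.isBigO_sub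
    have h3 : (fun y => P y - P x) =o[nhds x] fun _ => (1 : ℝ) := by
      rw [Asymptotics.isLittleO_one_iff]
      have := hP.tendsto.sub_const (P x)
      rwa [sub_self] at this
    have h4 := h2.norm_right.mul_isLittleO h3
    simp only [mul_one] at h4
    refine (h1.add h4.of_norm_right).congr_left fun y => ?_
    simp [h0]
    ring
  rw [pd, h.fderiv]
  simp [pd, mul_comm]

lemma lapl_sq_mul {F h : Eu N → ℝ} {x : Eu N} (hF : ContDiff ℝ 2 F) (hh : ContDiff ℝ 1 h)
    (h0 : F x = 0) :
    lapl (fun y => F y ^ 2 * h y) x = 2 * (∑ i, pd i F x ^ 2) * h x := by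
  have e : ∀ i, pd i (fun y => F y ^ 2 * h y) =
      fun y => F y * (2 * pd i F y * h y + F y * pd i h y) := fun i => funext fun y => by
    have d := hF.diffAt (by simp) y
    have e1 : pd i (fun y => F y ^ 2) y = 2 * F y * pd i F y := by
      simp only [pow_two]
      rw [pd_mul i d d]
      ring
    rw [pd_mul i (d.fun_pow 2) (hh.diffAt (by simp) y), e1]
    ring
  rw [lapl_eq, Finset.mul_sum, Finset.sum_mul]
  refine Finset.sum_congr rfl fun i _ => ?_
  have c1 := (contDiff_pd (m := 1) hF (by norm_num) i).continuous
  have c2 := (contDiff_pd (m := 0) hh (by norm_num) i).continuous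
  have c3 := hF.continuous
  have c4 := hh.continuous
  rw [e, pd_mul_of_zero (hF.diffAt (by simp) x) h0 (by fun_prop), h0]
  ring

lemma Aop_gam_zero (k : Eu N → ℝ) (x : Eu N) : Aop gam k 0 x = k x := by
  simp [Aop, integral_mul_const, integral_gam]

/-- Quotient by a function which does not vanish on the support of the numerator. -/
lemma contDiff_div_of_tsupport {ξ D : Eu N → ℝ} {n : WithTop ℕ∞} (hξ : ContDiff ℝ n ξ)
    (hD : ContDiff ℝ n D) (h : ∀ x ∈ tsupport ξ, D x ≠ 0) : ContDiff ℝ n fun x => ξ x / D x := by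
  rw [contDiff_iff_contDiffAt]
  intro x
  by_cases hx : x ∈ tsupport ξ
  · exact hξ.contDiffAt.div hD.contDiffAt (h x hx)
  · refine (contDiffAt_const (c := 0)).congr_of_eventuallyEq ?_
    filter_upwards [(isClosed_tsupport ξ).isOpen_compl.mem_nhds hx] with y hy
    rw [image_eq_zero_of_notMem_tsupport hy, zero_div]

lemma norm_le_sum_coord (x : Eu N) : ‖x‖ ≤ ∑ i, |x i| := by
  nth_rewrite 1 [eq_sum_ev x]
  refine (norm_sum_le _ _).trans (Finset.sum_le_sum fun i _ => ?_)
  rw [norm_smul, norm_ev, mul_one, Real.norm_eq_abs]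

/-- Regularised smoothings along the values of a function. -/
lemma contDiff_pow_mul_Aop_comp {m : ℕ} (hm : 1 ≤ m) (j : ℕ) {k F : Eu N → ℝ}
    (hk : ContDiff ℝ m k) (hs : HasCompactSupport k) (hF : ContDiff ℝ (m + j : ℕ) F) :
    ContDiff ℝ (m + j : ℕ) fun x => F x ^ j * Aop gam k (F x) x :=
  (contDiff_pow_mul_Aop hm j gam_GK hk hs).comp (hF.prodMk contDiff_id)

lemma contDiff_Aop_comp {m : ℕ} {k F : Eu N → ℝ} (hk : ContDiff ℝ m k)
    (hs : HasCompactSupport k) (hF : ContDiff ℝ m F) : ContDiff ℝ m fun x => Aop gam k (F x) x :=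
  (contDiff_Aop gam_GK hk hs).comp (hF.prodMk contDiff_id)

/-- A `C³` map which is a reflection across the boundary to second order. -/
structure IsBdryReflection (Ω : Set (Eu N)) (R : Eu N → Eu N) : Prop where
  reg : ContDiff ℝ 3 R
  lip : ∃ L, 0 ≤ L ∧ ∀ x y, ‖R x - R y‖ ≤ L * ‖x - y‖
  fix : ∀ x ∈ frontier Ω, R x = x
  orth : ∀ x ∈ frontier Ω, ∀ a b, ∑ i, pd i (fun y => R y a) x * pd i (fun y => R y b) x =
    if a = b then 1 else 0
  harm : ∀ x ∈ frontier Ω, ∀ a, lapl (fun y => R y a) x = 0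
  out : ∃ V, IsOpen V ∧ frontier Ω ⊆ V ∧ ∀ x ∈ Ω ∩ V, R x ∉ Ω

end Reflection

section ReflectionExists

variable {N : ℕ}

/-- A defining function together with a regular inverse of the squared gradient. -/
lemma exists_defining_inv {Ω : Set (Eu N)} (hΩ : IsC3Domain Ω) :
    ∃ (F q : Eu N → ℝ) (V : Set (Eu N)), ContDiff ℝ 3 F ∧ HasCompactSupport F ∧ ContDiff ℝ 2 q ∧
      HasCompactSupport q ∧ IsOpen V ∧ frontier Ω ⊆ V ∧ (∀ y ∈ Ω ∩ V, F y < 0) ∧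
      (∀ y ∈ frontier Ω, F y = 0) ∧ ∀ y ∈ frontier Ω, q y * ∑ i, pd i F y ^ 2 = 1 := by
  obtain ⟨F, V, hF, hFs, hV, hVs, hneg, -, hz, hd⟩ := exists_defining hΩ
  have hD : ContDiff ℝ 2 fun y => ∑ i, pd i F y ^ 2 :=
    ContDiff.sum fun i _ => (contDiff_pd (m := 2) hF (by norm_num) i).pow 2
  have hpos : ∀ y ∈ frontier Ω, ∑ i, pd i F y ^ 2 ≠ 0 := fun y hy h0 => by
    rw [Finset.sum_eq_zero_iff_of_nonneg fun i _ => sq_nonneg _] at h0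
    refine hd y hy ?_
    rw [fderiv_eq_sum_pd F y]
    refine Finset.sum_eq_zero fun i hi => ?_
    rw [pow_eq_zero_iff two_ne_zero |>.1 (h0 i hi), zero_smul]
  obtain ⟨ξ, hξ, hξs, hξU, -, -, W, -, hW, hW1⟩ := exists_cutoff (isCompact_frontier hΩ.2.2.1)
    (isOpen_ne_fun hD.continuous continuous_const) hpos
  refine ⟨F, fun y => ξ y / ∑ i, pd i F y ^ 2, V, hF, hFs,
    contDiff_div_of_tsupport (hξ 2) hD fun x hx => hξU hx, ?_, hV, hVs, hneg, hz, fun y hy => ?_⟩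
  · simp only [div_eq_mul_inv]
    exact hξs.mul_right
  · beta_reduce
    rw [hW1 y (hW hy), one_div, inv_mul_cancel₀ (hpos y hy)]

lemma lipschitz_id_add {P : Fin N → Eu N → ℝ} (hP : ∀ i, ContDiff ℝ 2 (P i))
    (hs : ∀ i, HasCompactSupport (P i)) :
    ∃ L, 0 ≤ L ∧ ∀ x y, ‖mkv (fun i => x i + P i x) - mkv (fun i => y i + P i y)‖ ≤ L * ‖x - y‖ := by
  choose C hC hPC using fun i => exists_C2Bd (hP i) (hs i)
  refine ⟨∑ i, (1 + N * C i), Finset.sum_nonneg fun i _ => by have := hC i; positivity,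
    fun x y => (norm_le_sum_coord _).trans ?_⟩
  rw [Finset.sum_mul]
  refine Finset.sum_le_sum fun i _ => ?_
  have h1 := (hPC i).lip x y
  have h2 := abs_coord_le i (x - y)
  simp only [PiLp.sub_apply, mkv_apply] at h2 ⊢
  calc |x i + P i x - (y i + P i y)| = |(x i - y i) + (P i x - P i y)| := by congr 1; ring
    _ ≤ _ := (abs_add_le _ _).trans (by linarith)

lemma exists_reflection {Ω : Set (Eu N)} (hΩ : IsC3Domain Ω) : ∃ R, IsBdryReflection Ω R := by
  obtain ⟨F, q, V, hF, hFs, hq, hqs, hV, hVs, hneg, hz, hq1⟩ := exists_defining_inv hΩ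
  have hF2 : ContDiff ℝ 2 F := hF.of_le (by norm_num)
  have hpF : ∀ i, ContDiff ℝ 2 (pd i F) := fun i => contDiff_pd (m := 2) hF (by norm_num) i
  set m : Fin N → Eu N → ℝ := fun i y => q y * pd i F y with hm
  have hmc : ∀ i, ContDiff ℝ 2 (m i) := fun i => hq.mul (hpF i)
  have hms : ∀ i, HasCompactSupport (m i) := fun i => hqs.mul_right
  set g : Fin N → Eu N → ℝ := fun i x => Aop gam (m i) (F x) x with hg
  have hgc : ∀ i, ContDiff ℝ 2 (g i) := fun i =>
    contDiff_Aop_comp (m := 2) (hmc i) (hms i) hF2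
  set k : Fin N → Eu N → ℝ := fun i y =>
    q y * (lapl F y * g i y + 2 * ∑ j, pd j F y * pd j (g i) y) with hk
  have hlF : ContDiff ℝ 1 (lapl F) := by
    have : lapl F = fun x => ∑ i, pd i (pd i F) x := funext fun x => lapl_eq F x
    rw [this]
    exact ContDiff.sum fun i _ => contDiff_pd (m := 1) (hpF i) (by norm_num) i
  have hkc : ∀ i, ContDiff ℝ 1 (k i) := fun i =>
    (hq.of_le (by norm_num)).mul ((hlF.mul ((hgc i).of_le (by norm_num))).add
      (contDiff_const.mul (ContDiff.sum fun j _ => ((hpF j).of_le (by norm_num)).mul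
        (contDiff_pd (m := 1) (hgc i) (by norm_num) j))))
  have hks : ∀ i, HasCompactSupport (k i) := fun i => hqs.mul_right
  set h : Fin N → Eu N → ℝ := fun i x => Aop gam (k i) (F x) x with hh
  have hhc : ∀ i, ContDiff ℝ 1 (h i) := fun i =>
    contDiff_Aop_comp (m := 1) (hkc i) (hks i) (hF.of_le (by norm_num))
  have hFg : ∀ i, ContDiff ℝ 3 fun x => F x * g i x := fun i => by
    have := contDiff_pow_mul_Aop_comp (m := 2) (by norm_num) 1 (hmc i) (hms i) (F := F) hF
    simp only [pow_one] at this
    exact this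
  have hFh : ∀ i, ContDiff ℝ 3 fun x => F x ^ 2 * h i x := fun i =>
    contDiff_pow_mul_Aop_comp (m := 1) (by norm_num) 2 (hkc i) (hks i) (F := F) hF
  set P : Fin N → Eu N → ℝ := fun i x => -2 * (F x * g i x) + F x ^ 2 * h i x with hP
  have hPc : ∀ i, ContDiff ℝ 3 (P i) := fun i => (contDiff_const.mul (hFg i)).add (hFh i)
  have hPs : ∀ i, HasCompactSupport (P i) := fun i => by
    have : P i = fun x => F x * (-2 * g i x + F x * h i x) := funext fun x => by
      simp only [hP]; ring
    rw [this]
    exact hFs.mul_right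
  set R : Eu N → Eu N := fun x => mkv fun i => x i + P i x with hR
  have hcoord : ∀ i : Fin N, ContDiff ℝ 3 fun x : Eu N => x i := fun i => contDiff_coord contDiff_id i
  have hRc : ContDiff ℝ 3 R := contDiff_mkv fun i => (hcoord i).add (hPc i)
  have hgz : ∀ x ∈ frontier Ω, ∀ i, g i x = q x * pd i F x := fun x hx i => by
    simp only [hg, hz x hx, Aop_gam_zero, hm]
  have hhz : ∀ x ∈ frontier Ω, ∀ i, h i x = k i x := fun x hx i => by
    simp only [hh, hz x hx, Aop_gam_zero]
  have hfix : ∀ x ∈ frontier Ω, R x = x := fun x hx => by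
    ext i
    simp [hR, hP, hz x hx]
  have hpdR : ∀ x ∈ frontier Ω, ∀ a j, pd j (fun y => R y a) x =
      (if a = j then 1 else 0) - 2 * q x * pd a F x * pd j F x := fun x hx a j => by
    have d : ∀ {f : Eu N → ℝ}, ContDiff ℝ 3 f → DifferentiableAt ℝ f x := fun hf =>
      hf.diffAt (by simp) x
    have e1 : pd j (fun y => F y * g a y) x = pd j F x * g a x :=
      pd_mul_of_zero (d hF) (hz x hx) (hgc a).continuous.continuousAt j
    have e2 : pd j (fun y => F y ^ 2 * h a y) x = 0 := by
      have : (fun y => F y ^ 2 * h a y) = fun y => F y * (F y * h a y) := funext fun y => by ring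
      rw [this, pd_mul_of_zero (d hF) (P := fun y => F y * h a y) (hz x hx)
        (hF.continuous.mul (hhc a).continuous).continuousAt j, hz x hx]
      ring
    have e3 : pd j (fun y => R y a) x = pd j (fun y => y a) x + pd j (P a) x :=
      pd_add j (d (hcoord a)) (d (hPc a))
    have e4 : pd j (P a) x = pd j (fun y => -2 * (F y * g a y)) x + pd j (fun y => F y ^ 2 * h a y) x :=
      pd_add j (d (contDiff_const.mul (hFg a))) (d (hFh a))
    rw [e3, e4, pd_coord, pd_const_mul, e1, e2, hgz x hx]
    ring
  refine ⟨R, hRc, lipschitz_id_add (fun i => (hPc i).of_le (by norm_num)) hPs, hfix, ?_, ?_, ?_⟩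
  · intro x hx a b
    simp only [hpdR x hx]
    have : ∀ i, ((if a = i then (1:ℝ) else 0) - 2 * q x * pd a F x * pd i F x) *
        ((if b = i then 1 else 0) - 2 * q x * pd b F x * pd i F x) =
        (if a = i then (if b = i then 1 else 0) else 0)
        - (if a = i then 2 * q x * pd b F x * pd i F x else 0)
        - (if b = i then 2 * q x * pd a F x * pd i F x else 0)
        + 4 * q x * pd a F x * pd b F x * (q x * pd i F x ^ 2) := fun i => by
      split_ifs <;> ring
    simp only [this, Finset.sum_add_distrib, Finset.sum_sub_distrib, ← Finset.mul_sum, hq1 x hx]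
    simp only [Finset.sum_ite_eq, Finset.mem_univ, if_true]
    by_cases hab : a = b
    · simp [hab]; ring
    · simp [hab, Ne.symm hab]; ring
  · intro x hx a
    have c2 : ∀ {f : Eu N → ℝ}, ContDiff ℝ 3 f → ContDiff ℝ 2 f := fun hf => hf.of_le (by norm_num)
    have e3 : lapl (fun y => R y a) x = lapl (fun y => y a) x + lapl (P a) x :=
      lapl_add (c2 (hcoord a)) (c2 (hPc a)) x
    have e4 : lapl (P a) x = lapl (fun y => -2 * (F y * g a y)) x + lapl (fun y => F y ^ 2 * h a y) x :=
      lapl_add (c2 (contDiff_const.mul (hFg a))) (c2 (hFh a)) x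
    have e5 : lapl (fun y : Eu N => y a) x = 0 := by
      rw [lapl_eq]
      refine Finset.sum_eq_zero fun i _ => ?_
      have : pd i (fun y : Eu N => y a) = fun _ => if a = i then 1 else 0 :=
        funext fun y => pd_coord i a y
      rw [this]
      simp [pd]
    rw [e3, e4, e5, lapl_const_mul, lapl_sq_mul hF2 (hhc a) (hz x hx), lapl_mul hF2 (hgc a),
      hhz x hx, hz x hx]
    simp only [hk]
    have := hq1 x hx
    linear_combination (2 * (lapl F x * g a x + 2 * ∑ j, pd j F x * pd j (g a) x)) * this
  · have key : ∀ x₀ ∈ frontier Ω, ∀ᶠ x in nhds x₀, x ∈ Ω → R x ∉ Ω := by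
      intro x₀ hx₀
      set H : Eu N × Eu N → ℝ := fun z => ∑ i, pd i F z.2 * (2 * g i z.1 - F z.1 * h i z.1) with hH
      have hHc : Continuous H := by
        refine continuous_finsetSum _ fun i _ => ?_
        have := (hpF i).continuous
        have := (hgc i).continuous
        have := (hhc i).continuous
        have := hF.continuous
        fun_prop
      have hH0 : H (x₀, x₀) = 2 := by
        simp only [hH, hz x₀ hx₀, hgz x₀ hx₀]
        have : ∀ i, pd i F x₀ * (2 * (q x₀ * pd i F x₀) - 0 * h i x₀) =
          2 * (q x₀ * pd i F x₀ ^ 2) := fun i => by ring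
        simp only [this, ← Finset.mul_sum, hq1 x₀ hx₀]
        norm_num
      have hH1 : ∀ᶠ z in nhds (x₀, x₀), 1 < H z :=
        hHc.continuousAt.eventually (lt_mem_nhds (by rw [hH0]; norm_num))
      obtain ⟨δ, hδ, hb⟩ := Metric.eventually_nhds_iff_ball.1 hH1
      have hRx : ∀ᶠ x in nhds x₀, R x ∈ ball x₀ δ ∩ V :=
        hRc.continuous.continuousAt.eventually (by
          rw [hfix x₀ hx₀]
          exact Filter.inter_mem (ball_mem_nhds _ hδ) (hV.mem_nhds (hVs hx₀)))
      filter_upwards [hRx, ball_mem_nhds x₀ hδ, hV.mem_nhds (hVs hx₀)] with x hx hxb hxV hxΩ hRΩ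
      obtain ⟨y, hy, hye⟩ := domain_mvt (f := F) (s := univ)
        (fun z _ => (hF.diffAt (by simp) z).hasFDerivAt.hasFDerivWithinAt) convex_univ
        (mem_univ x) (mem_univ (R x))
      have hyb : y ∈ ball x₀ δ := (convex_ball x₀ δ).segment_subset hxb hx.1 hy
      have h1 : 1 < H (x, y) := hb _ (by
        rw [← ball_prod_same]
        exact ⟨hxb, hyb⟩)
      have h2 : fderiv ℝ F y (R x - x) = -F x * H (x, y) := by
        rw [fderiv_apply_eq_sum, hH, Finset.mul_sum]
        refine Finset.sum_congr rfl fun i _ => ?_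
        simp only [hR, hP, PiLp.sub_apply, mkv_apply]
        ring
      have h3 := hneg x ⟨hxΩ, hxV⟩
      have h4 := hneg (R x) ⟨hRΩ, hx.2⟩
      nlinarith
    refine ⟨interior {x | x ∈ Ω → R x ∉ Ω}, isOpen_interior, fun x hx => ?_, fun x hx => ?_⟩
    · exact mem_interior_iff_mem_nhds.2 (key x hx)
    · exact interior_subset hx.2 hx.1

/-- A function with vanishing boundary values and prescribed boundary Laplacian. -/
lemma exists_bdry_corrector {Ω : Set (Eu N)} (hΩ : IsC3Domain Ω) :
    ∃ w : Eu N → ℝ, ContDiff ℝ 3 w ∧ HasCompactSupport w ∧ (∀ x ∈ frontier Ω, w x = 0) ∧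
      ∀ x ∈ frontier Ω, lapl w x = -1 := by
  obtain ⟨F, q, V, hF, hFs, hq, hqs, hV, hVs, hneg, hz, hq1⟩ := exists_defining_inv hΩ
  have hF2 : ContDiff ℝ 2 F := hF.of_le (by norm_num)
  have hq' : ContDiff ℝ 1 q := hq.of_le (by norm_num)
  refine ⟨fun x => -(1 / 2) * (F x ^ 2 * Aop gam q (F x) x), contDiff_const.mul
    (contDiff_pow_mul_Aop_comp (m := 1) (by norm_num) 2 hq' hqs (F := F) hF), ?_,
    fun x hx => by simp [hz x hx], fun x hx => ?_⟩
  · have : (fun x => -(1 / 2) * (F x ^ 2 * Aop gam q (F x) x)) =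
        fun x => F x * (-(1 / 2) * F x * Aop gam q (F x) x) := funext fun x => by ring
    rw [this]
    exact hFs.mul_right
  · rw [lapl_const_mul, lapl_sq_mul hF2
      (contDiff_Aop_comp (m := 1) hq' hqs (hF.of_le (by norm_num))) (hz x hx), hz x hx, Aop_gam_zero]
    linear_combination -hq1 x hx

end ReflectionExists

section HolderTools

variable {N : ℕ}

lemma lip_of_pd_le {w : Eu N → ℝ} {W : ℝ} (hw : ContDiff ℝ 1 w) (h : ∀ i x, |pd i w x| ≤ W)
    (x y : Eu N) : |w x - w y| ≤ N * W * ‖x - y‖ := by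
  refine Convex.norm_image_sub_le_of_norm_fderiv_le (𝕜 := ℝ) (s := univ) (f := w)
    (fun x _ => hw.differentiable (by simp) x) (fun x _ => ?_) convex_univ (mem_univ _)
    (mem_univ _)
  refine (norm_fderiv_le_sum _ _).trans ((Finset.sum_le_sum fun i _ => h i x).trans ?_)
  simp

lemma hol_of_bdd_lip {w : Eu N → ℝ} {W L : ℝ} (hL : 0 ≤ L) (hW : ∀ x, |w x| ≤ W)
    (h : ∀ x y, |w x - w y| ≤ L * ‖x - y‖) : Hol (2 * W + L) w := by
  intro x y
  have hW0 : 0 ≤ W := (abs_nonneg _).trans (hW 0)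
  have hs := Real.sqrt_nonneg ‖x - y‖
  have hq := Real.mul_self_sqrt (norm_nonneg (x - y))
  rcases le_total (√‖x - y‖) 1 with h1 | h1
  · have := h x y
    have h2 : ‖x - y‖ ≤ √‖x - y‖ := by nlinarith
    nlinarith [mul_le_mul_of_nonneg_left h2 hL, mul_nonneg hW0 hs]
  · have h2 : |w x - w y| ≤ 2 * W := (abs_sub _ _).trans (by linarith [hW x, hW y])
    nlinarith [mul_le_mul_of_nonneg_left h1 hW0, mul_nonneg hL hs]

lemma hol_of_C1_bounds {w : Eu N → ℝ} {W W' : ℝ} (hw : ContDiff ℝ 1 w) (h0 : 0 ≤ W')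
    (hb : ∀ x, |w x| ≤ W) (h : ∀ i x, |pd i w x| ≤ W') : Hol (2 * W + N * W') w :=
  hol_of_bdd_lip (by positivity) hb (lip_of_pd_le hw h)

lemma exists_hol {a : Eu N → ℝ} (ha : ContDiff ℝ 1 a) (hs : HasCompactSupport a) :
    ∃ H, 0 ≤ H ∧ Hol H a := by
  obtain ⟨W, hW0, hW⟩ := exists_bound hs ha.continuous
  choose b hb0 hb using fun i => exists_bound (hasCompactSupport_pd hs i)
    (contDiff_pd (m := 0) ha (by norm_num) i).continuous
  have hs := Finset.sum_nonneg fun i (_ : i ∈ (Finset.univ : Finset (Fin N))) => hb0 i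
  refine ⟨2 * W + N * ∑ i, b i, by positivity, hol_of_C1_bounds ha hs hW fun i x => ?_⟩
  exact (hb i x).trans (Finset.single_le_sum (fun i _ => hb0 i) (Finset.mem_univ i))

lemma Hol.continuous {f : Eu N → ℝ} {B : ℝ} (h : Hol B f) : Continuous f := by
  rw [continuous_iff_continuousAt]
  intro x
  refine tendsto_iff_norm_sub_tendsto_zero.2 ?_
  have hc : Continuous fun y : Eu N => B * √‖y - x‖ := by fun_prop
  have ht := hc.tendsto x
  simp only [sub_self, norm_zero, Real.sqrt_zero, mul_zero] at ht
  exact squeeze_zero (fun y => norm_nonneg _) (fun y => h y x) ht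

lemma Hol.mono {f : Eu N → ℝ} {B C : ℝ} (h : Hol B f) (hBC : B ≤ C) : Hol C f := fun x y =>
  (h x y).trans (mul_le_mul_of_nonneg_right hBC (Real.sqrt_nonneg _))

lemma Hol.add {f g : Eu N → ℝ} {B C : ℝ} (hf : Hol B f) (hg : Hol C g) :
    Hol (B + C) fun x => f x + g x := fun x y => by
  have : f x + g x - (f y + g y) = (f x - f y) + (g x - g y) := by ring
  rw [this, add_mul]
  exact (abs_add_le _ _).trans (add_le_add (hf x y) (hg x y))

lemma Hol.const_mul {f : Eu N → ℝ} {B : ℝ} (hf : Hol B f) (c : ℝ) :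
    Hol (|c| * B) fun x => c * f x := fun x y => by
  rw [← mul_sub, abs_mul, mul_assoc]
  exact mul_le_mul_of_nonneg_left (hf x y) (abs_nonneg _)

lemma Hol.sum {ι : Type*} (s : Finset ι) {f : ι → Eu N → ℝ} {B : ι → ℝ}
    (h : ∀ i, Hol (B i) (f i)) : Hol (∑ i ∈ s, B i) fun x => ∑ i ∈ s, f i x := fun x y => by
  rw [← Finset.sum_sub_distrib, Finset.sum_mul]
  exact (Finset.abs_sum_le_sum_abs _ _).trans (Finset.sum_le_sum fun i _ => h i x y)

lemma Hol.mul_comp {a w : Eu N → ℝ} {R : Eu N → Eu N} {A H W H' L : ℝ} (hL : 0 ≤ L)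
    (hA : ∀ x, |a x| ≤ A) (hH : Hol H a) (hH0 : 0 ≤ H) (hW : ∀ x, |w x| ≤ W) (hH' : Hol H' w)
    (hH0' : 0 ≤ H') (hR : ∀ x y, ‖R x - R y‖ ≤ L * ‖x - y‖) :
    Hol (A * (H' * √L) + H * W) fun x => a x * w (R x) := fun x y => by
  have hA0 := (abs_nonneg _).trans (hA 0)
  have h1 : |w (R x) - w (R y)| ≤ H' * √L * √‖x - y‖ := by
    refine (hH' _ _).trans ?_
    rw [mul_assoc, ← Real.sqrt_mul hL]
    exact mul_le_mul_of_nonneg_left (Real.sqrt_le_sqrt (hR x y)) hH0'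
  have e : a x * w (R x) - a y * w (R y) =
      a x * (w (R x) - w (R y)) + (a x - a y) * w (R y) := by ring
  have hs := Real.sqrt_nonneg ‖x - y‖
  calc |a x * w (R x) - a y * w (R y)|
      ≤ |a x| * |w (R x) - w (R y)| + |a x - a y| * |w (R y)| := by
        rw [e]
        refine (abs_add_le _ _).trans ?_
        rw [abs_mul, abs_mul]
    _ ≤ A * (H' * √L * √‖x - y‖) + H * √‖x - y‖ * W :=
        add_le_add (mul_le_mul (hA x) h1 (abs_nonneg _) hA0)
          (mul_le_mul (hH x y) (hW _) (abs_nonneg _) (mul_nonneg hH0 hs))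
    _ = _ := by ring

lemma exists_mem_frontier {S Ω : Set (Eu N)} (hS : IsPreconnected S) {x y : Eu N} (hx : x ∈ S)
    (hxΩ : x ∈ Ω) (hy : y ∈ S) (hyΩ : y ∉ Ω) : ∃ z ∈ S, z ∈ frontier Ω := by
  by_contra! hc
  have hsub : S ⊆ interior Ω ∪ interior Ωᶜ := fun z hz => by
    rw [interior_compl]
    by_contra h
    rw [mem_union, not_or, notMem_compl_iff] at h
    exact hc z hz ⟨h.2, h.1⟩
  have h1 : x ∈ interior Ω := (hsub hx).resolve_right fun h => interior_subset h hxΩ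
  have h2 : y ∈ interior Ωᶜ := (hsub hy).resolve_left fun h => hyΩ (interior_subset h)
  obtain ⟨z, -, hz1, hz2⟩ := hS _ _ isOpen_interior isOpen_interior hsub ⟨x, hx, h1⟩ ⟨y, hy, h2⟩
  exact interior_subset hz2 (interior_subset hz1)

/-- Extension by zero of a function vanishing on the boundary. -/
lemma Hol.indicator {Ω : Set (Eu N)} {g : Eu N → ℝ} {B : ℝ} (hg : Hol B g) (hB : 0 ≤ B)
    (h0 : ∀ x ∈ frontier Ω, g x = 0) : Hol B (Ω.indicator g) := by
  have key : ∀ x ∈ Ω, ∀ y ∉ Ω, |g x| ≤ B * √‖x - y‖ := fun x hx y hy => by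
    obtain ⟨z, hz, hzf⟩ := exists_mem_frontier (convex_segment x y).isPreconnected
      (left_mem_segment ℝ x y) hx (right_mem_segment ℝ x y) hy
    have h1 := hg x z
    rw [h0 z hzf, sub_zero] at h1
    refine h1.trans (mul_le_mul_of_nonneg_left (Real.sqrt_le_sqrt ?_) hB)
    obtain ⟨a, b, ha, hb, hab, rfl⟩ := hz
    have : x - (a • x + b • y) = b • (x - y) := by
      rw [← sub_eq_zero]
      have : a = 1 - b := by linarith
      subst this
      module
    rw [this, norm_smul, Real.norm_of_nonneg hb]
    nlinarith [norm_nonneg (x - y)]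
  intro x y
  by_cases hx : x ∈ Ω <;> by_cases hy : y ∈ Ω
  · simpa [hx, hy] using hg x y
  · simpa [hx, hy] using key x hx y hy
  · have := key y hy x hx
    rw [norm_sub_rev]
    simpa [hx, hy] using this
  · simp only [indicator_of_notMem hx, indicator_of_notMem hy, sub_self, abs_zero]
    positivity

/-- Hölder functions on the whole space vanishing off `Ω`. -/
structure HolZ (Ω : Set (Eu N)) (φ : Eu N → ℝ) (B : ℝ) : Prop where
  hol : Hol B φ
  zero : ∀ x ∉ Ω, φ x = 0

lemma exists_ne_euclid (hN : 0 < N) : ∃ x y : Eu N, x ≠ y :=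
  ⟨ev ⟨0, hN⟩, 0, fun h => by have := norm_ev (N := N) ⟨0, hN⟩; rw [h, norm_zero] at this; norm_num at this⟩

lemma HolZ.nonneg {Ω : Set (Eu N)} {φ : Eu N → ℝ} {B : ℝ} (h : HolZ Ω φ B) (hN : 0 < N) : 0 ≤ B := by
  obtain ⟨x, y, hxy⟩ := exists_ne_euclid hN
  exact h.hol.nonneg hxy

lemma HolZ.indicator {Ω : Set (Eu N)} {g : Eu N → ℝ} {B : ℝ} (hg : Hol B g) (hB : 0 ≤ B)
    (h0 : ∀ x ∈ frontier Ω, g x = 0) : HolZ Ω (Ω.indicator g) B :=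
  ⟨hg.indicator hB h0, fun _ hx => indicator_of_notMem hx _⟩

lemma exists_dat_of_holZ {Ω : Set (Eu N)} (hN : 0 < N) (hb : Bornology.IsBounded Ω) :
    ∃ D, 0 ≤ D ∧ ∀ φ B, HolZ Ω φ B → Dat φ (D * B) B := by
  obtain ⟨r, hr, hΩ⟩ := hb.subset_closedBall_lt 0 (0 : Eu N)
  refine ⟨√(3 * r), Real.sqrt_nonneg _, fun φ B h => ⟨h.hol.continuous, ?_, fun x => ?_, h.hol⟩⟩
  · exact HasCompactSupport.of_support_subset_isCompact (isCompact_closedBall 0 r) fun x hx =>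
      hΩ (by_contra fun hc => hx (h.zero x hc))
  · by_cases hx : x ∈ Ω
    · have hy : x + (3 * r) • ev ⟨0, hN⟩ ∉ Ω := fun hc => by
        have h1 := hΩ hc
        have h2 := hΩ hx
        rw [mem_closedBall_zero_iff] at h1 h2
        have h3 : ‖(3 * r) • ev (⟨0, hN⟩ : Fin N)‖ ≤ ‖x + (3 * r) • ev ⟨0, hN⟩‖ + ‖x‖ := by
          simpa using norm_sub_le (x + (3 * r) • ev (⟨0, hN⟩ : Fin N)) x
        rw [norm_smul, norm_ev, mul_one, Real.norm_of_nonneg (by positivity)] at h3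
        linarith
      have := h.hol x (x + (3 * r) • ev ⟨0, hN⟩)
      rw [h.zero _ hy, sub_zero, sub_add_cancel_left, norm_neg, norm_smul, norm_ev, mul_one,
        Real.norm_of_nonneg (by positivity)] at this
      rwa [mul_comm]
    · rw [h.zero x hx, abs_zero]
      exact mul_nonneg (Real.sqrt_nonneg _) (h.nonneg hN)

end HolderTools

section ReflectedParametrix

variable {N : ℕ}

lemma exists_comp_bound {c : Eu N → ℝ} (hc : ContDiff ℝ 1 c) (hs : HasCompactSupport c)
    {R : Eu N → Eu N} (hR : ContDiff ℝ 1 R) :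
    ∃ K, 0 ≤ K ∧ ∀ (w : Eu N → ℝ) (C : ℝ), ContDiff ℝ 1 w → (∀ x, |w x| ≤ C) →
      (∀ a x, |pd a w x| ≤ C) → (∀ x, |c x * w (R x)| ≤ K * C) ∧
      ∀ i x, |pd i (fun y => c y * w (R y)) x| ≤ K * C := by
  obtain ⟨M, hM0, hM⟩ := exists_bound hs hc.continuous
  choose b hb0 hb using fun i => exists_bound (hasCompactSupport_pd hs i)
    (contDiff_pd (m := 0) hc (by norm_num) i).continuous
  choose d hd0 hd using fun i a => exists_bound
    (k := fun x => c x * pd i (fun y => R y a) x) hs.mul_right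
    (hc.continuous.mul (contDiff_pd (m := 0) (contDiff_coord hR a) (by norm_num) i).continuous)
  have s1 := Finset.sum_nonneg fun i (_ : i ∈ (Finset.univ : Finset (Fin N))) => hb0 i
  have s2 := fun i => Finset.sum_nonneg fun j (_ : j ∈ (Finset.univ : Finset (Fin N))) => hd0 i j
  have s3 := Finset.sum_nonneg fun i (_ : i ∈ (Finset.univ : Finset (Fin N))) => s2 i
  refine ⟨M + ∑ i, b i + ∑ i, ∑ a, d i a, by positivity, fun w C hw h0 h1 => ?_⟩
  have hC : 0 ≤ C := (abs_nonneg _).trans (h0 0)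
  refine ⟨fun x => ?_, fun i x => ?_⟩
  · rw [abs_mul]
    refine (mul_le_mul (hM x) (h0 _) (abs_nonneg _) hM0).trans ?_
    gcongr
    linarith
  · have dw : DifferentiableAt ℝ w (R x) := hw.diffAt (by simp) _
    have dR : DifferentiableAt ℝ R x := hR.differentiable (by simp) x
    rw [pd_mul (g := fun y => w (R y)) i (hc.diffAt (by simp) x) (dw.comp x dR), pd_comp dw dR, Finset.mul_sum]
    have t1 : |pd i c x * w (R x)| ≤ b i * C := by
      rw [abs_mul]
      exact mul_le_mul (hb i x) (h0 _) (abs_nonneg _) (hb0 i)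
    have t2 : |∑ a, c x * (pd a w (R x) * pd i (fun y => R y a) x)| ≤ ∑ a, d i a * C := by
      refine (Finset.abs_sum_le_sum_abs _ _).trans (Finset.sum_le_sum fun a _ => ?_)
      have : c x * (pd a w (R x) * pd i (fun y => R y a) x) =
        (c x * pd i (fun y => R y a) x) * pd a w (R x) := by ring
      rw [this, abs_mul]
      exact mul_le_mul (hd i a x) (h1 _ _) (abs_nonneg _) (hd0 i a)
    rw [← Finset.sum_mul] at t2
    have t3 := Finset.single_le_sum (fun i _ => hb0 i) (Finset.mem_univ i)
    have t4 := Finset.single_le_sum (fun i _ => s2 i) (Finset.mem_univ i)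
    refine (abs_add_le _ _).trans ((add_le_add t1 t2).trans ?_)
    rw [← add_mul]
    gcongr
    linarith

lemma exists_C2Bd_mul_comp {χ : Eu N → ℝ} (hχ : ContDiff ℝ 2 χ) (hs : HasCompactSupport χ)
    {R : Eu N → Eu N} (hR : ContDiff ℝ 2 R) :
    ∃ K, 0 ≤ K ∧ ∀ (v : Eu N → ℝ) (C : ℝ), C2Bd v C → C2Bd (fun x => χ x * v (R x)) (K * C) := by
  have hR1 : ContDiff ℝ 1 R := hR.of_le (by norm_num)
  have hχ1 : ContDiff ℝ 1 χ := hχ.of_le (by norm_num)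
  have pχ := fun i => contDiff_pd (m := 1) hχ (by norm_num) i
  have pR := fun i a => contDiff_pd (m := 1) (contDiff_coord hR a) (by norm_num) i
  obtain ⟨K0, hK0, h0⟩ := exists_comp_bound hχ1 hs hR1
  choose K1 hK1 h1 using fun i => exists_comp_bound (pχ i) (hasCompactSupport_pd hs i) hR1
  choose K2 hK2 h2 using fun i a =>
    exists_comp_bound (c := fun x => χ x * pd i (fun y => R y a) x) (hχ1.mul (pR i a)) hs.mul_right hR1
  have s1 := Finset.sum_nonneg fun i (_ : i ∈ (Finset.univ : Finset (Fin N))) => hK1 i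
  have s2 := fun i => Finset.sum_nonneg fun j (_ : j ∈ (Finset.univ : Finset (Fin N))) => hK2 i j
  have s3 := Finset.sum_nonneg fun i (_ : i ∈ (Finset.univ : Finset (Fin N))) => s2 i
  refine ⟨K0 + ∑ i, K1 i + ∑ i, ∑ a, K2 i a, by positivity, fun v C hv => ?_⟩
  have hC : 0 ≤ C := (abs_nonneg _).trans (hv.b0 0)
  have hv1 : ContDiff ℝ 1 v := hv.reg.of_le (by norm_num)
  have pv := fun a => contDiff_pd (m := 1) hv.reg (by norm_num) a
  obtain ⟨b0, b1⟩ := h0 v C hv1 hv.b0 hv.b1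
  have le0 : K0 * C ≤ (K0 + ∑ i, K1 i + ∑ i, ∑ a, K2 i a) * C := by gcongr; linarith
  have e1 : ∀ i, pd i (fun x => χ x * v (R x)) = fun x => pd i χ x * v (R x) +
      ∑ a, (χ x * pd i (fun y => R y a) x) * pd a v (R x) := fun i => funext fun x => by
    have dv : DifferentiableAt ℝ v (R x) := hv1.diffAt (by simp) _
    have dR : DifferentiableAt ℝ R x := hR1.differentiable (by simp) x
    rw [pd_mul (g := fun y => v (R y)) i (hχ1.diffAt (by simp) x) (dv.comp x dR), pd_comp dv dR, Finset.mul_sum]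
    congr 1
    exact Finset.sum_congr rfl fun a _ => by ring
  refine ⟨hχ.mul (hv.reg.comp hR), fun x => (b0 x).trans le0, fun i x => (b1 i x).trans le0,
    fun i j x => ?_⟩
  have d1 : ContDiff ℝ 1 fun x => pd i χ x * v (R x) := (pχ i).mul (hv1.comp hR1)
  have d2 : ∀ a, ContDiff ℝ 1 fun x => (χ x * pd i (fun y => R y a) x) * pd a v (R x) := fun a =>
    (hχ1.mul (pR i a)).mul ((pv a).comp hR1)
  rw [e1, pd_add j (d1.diffAt (by simp) x)
    ((ContDiff.sum fun a _ => d2 a : ContDiff ℝ 1 _).diffAt (by simp) x),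
    pd_sum _ j fun a _ => (d2 a).diffAt (by simp) x]
  have t1 := (h1 i v C hv1 hv.b0 hv.b1).2 j x
  have t2 : |∑ a, pd j (fun x => (χ x * pd i (fun y => R y a) x) * pd a v (R x)) x| ≤
      ∑ a, K2 i a * C :=
    (Finset.abs_sum_le_sum_abs _ _).trans (Finset.sum_le_sum fun a _ =>
      (h2 i a (pd a v) C (pv a) (hv.b1 a) fun b x => hv.b2 a b x).2 j x)
  rw [← Finset.sum_mul] at t2
  have t3 := Finset.single_le_sum (fun i _ => hK1 i) (Finset.mem_univ i)
  have t4 := Finset.single_le_sum (fun i _ => s2 i) (Finset.mem_univ i)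
  refine (abs_add_le _ _).trans ((add_le_add t1 t2).trans ?_)
  rw [← add_mul]
  gcongr
  linarith

/-- Summation of approximate solutions with telescoping right-hand sides. -/
lemma telescope_solution {Ω : Set (Eu N)} {s : ℝ} {u d : ℕ → Eu N → ℝ} {b : ℕ → ℝ}
    (hb : Summable b) (hu : ∀ n, C2Bd (u n) (b n)) (hd : ∀ x, Summable fun n => d n x)
    (h0 : ∀ n, ∀ x ∈ frontier Ω, u n x = 0)
    (heq : ∀ n, ∀ x ∈ Ω, -lapl (u n) x + s * u n x = d n x - d (n + 1) x) :
    C2Bd (fun x => ∑' n, u n x) (∑' n, b n) ∧ (∀ x ∈ frontier Ω, ∑' n, u n x = 0) ∧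
      ∀ x ∈ Ω, -lapl (fun x => ∑' n, u n x) x + s * ∑' n, u n x = d 0 x := by
  obtain ⟨h1, h2⟩ := C2Bd.tsum hb hu
  refine ⟨h1, fun x hx => by simp [h0 _ x hx], fun x hx => ?_⟩
  have su : Summable fun n => u n x := Summable.of_norm_bounded hb fun n => (hu n).b0 x
  have sd := (summable_nat_add_iff (f := fun n => d n x) 1).2 (hd x)
  have e : ∀ n, lapl (u n) x = s * u n x - (d n x - d (n + 1) x) := fun n => by
    linarith [heq n x hx]
  rw [h2, tsum_congr e, Summable.tsum_sub (su.mul_left s) ((hd x).sub sd),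
    Summable.tsum_sub (hd x) sd, tsum_mul_left, (hd x).tsum_eq_zero_add]
  ring

end ReflectedParametrix

section Halving

variable {N : ℕ}

/-- The Gram matrix of the gradients of the components of `R`. -/
def gram (R : Eu N → Eu N) (a b : Fin N) (x : Eu N) : ℝ :=
  ∑ i, pd i (fun y => R y a) x * pd i (fun y => R y b) x

/-- The first order coefficients produced by reflecting with cutoff `χ`. -/
def driftCoeff (χ : Eu N → ℝ) (R : Eu N → Eu N) (a : Fin N) (x : Eu N) : ℝ :=
  -(χ x * lapl (fun y => R y a) x + 2 * ∑ i, pd i χ x * pd i (fun y => R y a) x)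

lemma contDiff_gram {R : Eu N → Eu N} (hR : ContDiff ℝ 3 R) (a b : Fin N) :
    ContDiff ℝ 2 (gram R a b) :=
  ContDiff.sum fun i _ => (contDiff_pd (m := 2) (contDiff_coord hR a) (by norm_num) i).mul
    (contDiff_pd (m := 2) (contDiff_coord hR b) (by norm_num) i)

lemma contDiff_lapl {f : Eu N → ℝ} (hf : ContDiff ℝ 3 f) : ContDiff ℝ 1 (lapl f) := by
  have : lapl f = fun x => ∑ i, pd i (pd i f) x := funext fun x => lapl_eq f x
  rw [this]
  exact ContDiff.sum fun i _ =>
    contDiff_pd (m := 1) (contDiff_pd (m := 2) hf (by norm_num) i) (by norm_num) i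

lemma contDiff_driftCoeff {χ : Eu N → ℝ} {R : Eu N → Eu N} (hχ : ContDiff ℝ 3 χ)
    (hR : ContDiff ℝ 3 R) (a : Fin N) : ContDiff ℝ 1 (driftCoeff χ R a) :=
  (((hχ.of_le (by norm_num)).mul (contDiff_lapl (contDiff_coord hR a))).add
    (contDiff_const.mul (ContDiff.sum fun i _ => (contDiff_pd (m := 1) hχ (by norm_num) i).mul
      (contDiff_pd (m := 1) (contDiff_coord hR a) (by norm_num) i)))).neg

lemma hasCompactSupport_lapl {f : Eu N → ℝ} (hf : HasCompactSupport f) :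
    HasCompactSupport (lapl f) := by
  refine hf.mono' fun x hx => by_contra fun hc => hx ?_
  have h0 : f =ᶠ[nhds x] fun _ => 0 := notMem_tsupport_iff_eventuallyEq.1 hc
  rw [lapl_congr h0, lapl_const]

lemma hasCompactSupport_driftCoeff {χ : Eu N → ℝ} (hχ : HasCompactSupport χ) (R : Eu N → Eu N)
    (a : Fin N) : HasCompactSupport (driftCoeff χ R a) := by
  refine hχ.mono' fun x hx => by_contra fun hc => hx ?_
  have h1 : ∀ i, pd i χ x = 0 := fun i => by
    rw [pd_congr (notMem_tsupport_iff_eventuallyEq.1 hc)]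
    simp [pd]
  simp [driftCoeff, h1, image_eq_zero_of_notMem_tsupport hc]

/-- The error density created by the reflected potential. -/
def reflErr (χ : Eu N → ℝ) (R : Eu N → Eu N) (v : Eu N → ℝ) (x : Eu N) : ℝ :=
  (∑ a, ∑ b, (-(χ x * (gram R a b x - if a = b then 1 else 0))) * pd b (pd a v) (R x)) +
    (∑ a, driftCoeff χ R a x * pd a v (R x)) + -lapl χ x * v (R x)

lemma lapl_reflect {χ : Eu N → ℝ} {R : Eu N → Eu N} {v : Eu N → ℝ} (hχ : ContDiff ℝ 2 χ)
    (hR : ContDiff ℝ 2 R) (hv : ContDiff ℝ 2 v) (x : Eu N) :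
    -lapl (fun y => χ y * v (R y)) x = reflErr χ R v x - χ x * lapl v (R x) := by
  have dv : DifferentiableAt ℝ v (R x) := hv.diffAt (by simp) _
  have dR : DifferentiableAt ℝ R x := hR.differentiable (by simp) x
  rw [lapl_mul (g := fun y => v (R y)) hχ (hv.comp hR), lapl_comp hv hR]
  simp only [pd_comp dv dR]
  rw [lapl_eq v]
  have e1 : ∑ i, pd i (pd i v) (R x) =
      ∑ a, ∑ b, (if a = b then 1 else 0) * pd b (pd a v) (R x) := by simp
  have e2 : ∑ i, pd i χ x * ∑ a, pd a v (R x) * pd i (fun y => R y a) x =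
      ∑ a, (∑ i, pd i χ x * pd i (fun y => R y a) x) * pd a v (R x) := by
    simp only [Finset.mul_sum, Finset.sum_mul]
    rw [Finset.sum_comm]
    exact Finset.sum_congr rfl fun a _ => Finset.sum_congr rfl fun i _ => by ring
  have e3 : ∀ (A : Fin N → Fin N → ℝ), χ x * ∑ a, ∑ b, A a b * pd b (pd a v) (R x) =
      ∑ a, ∑ b, χ x * A a b * pd b (pd a v) (R x) := fun A => by
    simp only [Finset.mul_sum]
    exact Finset.sum_congr rfl fun a _ => Finset.sum_congr rfl fun i _ => by ring
  have e4 : ∑ a, driftCoeff χ R a x * pd a v (R x) =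
      -(χ x * ∑ a, lapl (fun y => R y a) x * pd a v (R x) +
        2 * ∑ a, (∑ i, pd i χ x * pd i (fun y => R y a) x) * pd a v (R x)) := by
    rw [Finset.mul_sum, Finset.mul_sum, ← Finset.sum_add_distrib, ← Finset.sum_neg_distrib]
    exact Finset.sum_congr rfl fun a _ => by simp only [driftCoeff]; ring
  have e5 : ∑ a, ∑ b, (-(χ x * (gram R a b x - if a = b then 1 else 0))) * pd b (pd a v) (R x) =
      χ x * (∑ a, ∑ b, (if a = b then 1 else 0) * pd b (pd a v) (R x)) -
        χ x * ∑ a, ∑ b, gram R a b x * pd b (pd a v) (R x) := by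
    rw [e3, e3, ← Finset.sum_sub_distrib]
    refine Finset.sum_congr rfl fun a _ => ?_
    rw [← Finset.sum_sub_distrib]
    exact Finset.sum_congr rfl fun a _ => by ring
  rw [e1, e2, reflErr, e4, e5]
  simp only [gram]
  ring

end Halving

section LinearLarge

variable {N : ℕ}

lemma exists_rpow_small {T δ : ℝ} (hδ : 0 < δ) : ∃ s : ℝ, 2 ≤ s ∧ (s / 2) ^ (-1 / 4 : ℝ) * T ≤ δ := by
  have h : Filter.Tendsto (fun s : ℝ => (s / 2) ^ (-(1 / 4) : ℝ) * T) Filter.atTop (nhds (0 * T)) :=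
    ((tendsto_rpow_neg_atTop (by norm_num)).comp
      (Filter.tendsto_id.atTop_div_const (by norm_num : (0:ℝ) < 2))).mul_const T
  rw [zero_mul] at h
  obtain ⟨s, h1, h2⟩ := ((h.eventually (ge_mem_nhds hδ)).and (Filter.eventually_ge_atTop 2)).exists
  refine ⟨s, h2, ?_⟩
  rw [neg_div]
  exact h1

lemma hol_reflErr {χ : Eu N → ℝ} {R : Eu N → Eu N} (hχ : ContDiff ℝ 3 χ) (hs : HasCompactSupport χ)
    (hR : ContDiff ℝ 3 R) {L : ℝ} (hL : 0 ≤ L) (hlip : ∀ x y, ‖R x - R y‖ ≤ L * ‖x - y‖) {ε : ℝ}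
    (hε : ∀ a b x, |χ x * (gram R a b x - if a = b then 1 else 0)| ≤ ε) {C D : ℝ} (hC : 0 ≤ C)
    (hD : 0 ≤ D) :
    ∃ T, ∀ (v : Eu N → ℝ) (κ B : ℝ), 0 ≤ κ → 0 ≤ B → ContDiff ℝ 2 v →
      (∀ x, |v x| ≤ C * (D * B) * κ) → (∀ i x, |pd i v x| ≤ C * (D * B) * κ) →
      (∀ i j x, |pd j (pd i v) x| ≤ C * B * κ) → (∀ i j, Hol (C * B) (pd j (pd i v))) →
      Hol (B * (N * N * ε * C * √L + κ * T)) (reflErr χ R v) := by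
  have ca : ∀ a b, ContDiff ℝ 1 fun x => -(χ x * (gram R a b x - if a = b then 1 else 0)) :=
    fun a b => ((hχ.of_le (by norm_num)).mul
      (((contDiff_gram hR a b).of_le (by norm_num)).sub contDiff_const)).neg
  have sa : ∀ a b, HasCompactSupport fun x => -(χ x * (gram R a b x - if a = b then 1 else 0)) :=
    fun a b => (hs.mul_right (f' := fun x => (gram R a b x - if a = b then 1 else 0))).neg
  have cl : ContDiff ℝ 1 fun x => -lapl χ x := (contDiff_lapl hχ).neg
  have sl : HasCompactSupport fun x => -lapl χ x := (hasCompactSupport_lapl hs).neg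
  have cb := contDiff_driftCoeff hχ hR
  have sb := hasCompactSupport_driftCoeff hs R
  choose Ha hHa0 hHa using fun a b => exists_hol (ca a b) (sa a b)
  choose Hb hHb0 hHb using fun a => exists_hol (cb a) (sb a)
  choose βb hβb0 hβb using fun a => exists_bound (sb a) (cb a).continuous
  obtain ⟨Hc, hHc0, hHc⟩ := exists_hol cl sl
  obtain ⟨βc, hβc0, hβc⟩ := exists_bound sl cl.continuous
  refine ⟨∑ a, ∑ b, Ha a b * C + ∑ a, (βb a * ((2 * (C * D) + N * C) * √L) + Hb a * (C * D)) +
    (βc * ((2 * (C * D) + N * (C * D)) * √L) + Hc * (C * D)), fun v κ B hκ hB hv h0 h1 h2 h3 => ?_⟩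
  have p1 := fun a => contDiff_pd (m := 1) hv (by norm_num) a
  have k1 : ∀ a, Hol (2 * (C * (D * B) * κ) + N * (C * B * κ)) (pd a v) := fun a =>
    hol_of_C1_bounds (p1 a) (by positivity) (h1 a) fun i x => h2 a i x
  have k0 : Hol (2 * (C * (D * B) * κ) + N * (C * (D * B) * κ)) v :=
    hol_of_C1_bounds (hv.of_le (by norm_num)) (by positivity) h0 h1
  have t2 := Hol.sum (N := N) Finset.univ fun a => Hol.sum (N := N) Finset.univ fun b =>
    Hol.mul_comp hL (fun x => by rw [abs_neg]; exact hε a b x) (hHa a b) (hHa0 a b)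
      (h2 a b) (h3 a b) (mul_nonneg hC hB) hlip
  have t1 := Hol.sum (N := N) Finset.univ fun a =>
    Hol.mul_comp hL (hβb a) (hHb a) (hHb0 a) (h1 a) (k1 a) (by positivity) hlip
  have t0 := Hol.mul_comp hL hβc hHc hHc0 h0 k0 (by positivity) hlip
  refine ((t2.add t1).add t0).mono (le_of_eq ?_)
  have e2 : ∑ a, ∑ b, (ε * (C * B * √L) + Ha a b * (C * B * κ)) =
      B * (N * N * ε * C * √L) + B * κ * ∑ a, ∑ b, Ha a b * C := by
    simp only [Finset.sum_add_distrib, Finset.mul_sum, Finset.sum_const, Finset.card_univ,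
      Fintype.card_fin, nsmul_eq_mul]
    congr 1
    · ring
    · exact Finset.sum_congr rfl fun a _ => Finset.sum_congr rfl fun b _ => by ring
  have e1 : ∑ a, (βb a * ((2 * (C * (D * B) * κ) + N * (C * B * κ)) * √L) +
      Hb a * (C * (D * B) * κ)) =
      B * κ * ∑ a, (βb a * ((2 * (C * D) + N * C) * √L) + Hb a * (C * D)) := by
    rw [Finset.mul_sum]
    exact Finset.sum_congr rfl fun a _ => by ring
  rw [e2, e1]
  ring

lemma reflErr_eq_zero {Ω : Set (Eu N)} {R : Eu N → Eu N} (hR : IsBdryReflection Ω R) {χ : Eu N → ℝ}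
    {W : Set (Eu N)} (hW : IsOpen W) (hW1 : ∀ x ∈ W, χ x = 1) (v : Eu N → ℝ) {x : Eu N}
    (hx : x ∈ frontier Ω) (hxW : x ∈ W) : reflErr χ R v x = 0 := by
  have hev : χ =ᶠ[nhds x] fun _ => 1 := by
    filter_upwards [hW.mem_nhds hxW] with y hy using hW1 y hy
  have h1 : ∀ i, pd i χ x = 0 := fun i => by rw [pd_congr hev]; simp [pd]
  have h2 : lapl χ x = 0 := by rw [lapl_congr hev, lapl_const]
  simp [reflErr, driftCoeff, gram, h1, h2, hR.orth x hx, hR.harm x hx]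

/-- One step of the parametrix construction, for a large zero order coefficient. -/
lemma exists_halving {Ω : Set (Eu N)} (hΩ : IsC3Domain Ω) (hN : 0 < N) :
    ∃ s, 2 ≤ s ∧ ∃ C, 0 ≤ C ∧ ∀ φ B, HolZ Ω φ B → ∃ φ' u : Eu N → ℝ, HolZ Ω φ' (B / 2) ∧
      C2Bd u (C * B) ∧ (∀ x ∈ frontier Ω, u x = 0) ∧
      ∀ x ∈ Ω, -lapl u x + s * u x = φ x - φ' x := by
  obtain ⟨R, hR⟩ := exists_reflection hΩ
  obtain ⟨L, hL, hlip⟩ := hR.lip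
  obtain ⟨V, hV, hVs, hout⟩ := hR.out
  obtain ⟨C, hC, hpot⟩ := pot_spec N
  obtain ⟨D, hD, hdat⟩ := exists_dat_of_holZ hN hΩ.2.2.1
  set ε : ℝ := 1 / (4 * (N * N * C * √L + 1)) with hεd
  have hε : 0 < ε := by positivity
  have hU : IsOpen (V ∩ ⋂ a, ⋂ b, {x | |gram R a b x - if a = b then 1 else 0| < ε}) :=
    hV.inter (isOpen_iInter_of_finite fun a => isOpen_iInter_of_finite fun b =>
      isOpen_lt (((contDiff_gram hR.reg a b).continuous.sub continuous_const).abs) continuous_const)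
  obtain ⟨χ, hχ, hχs, hχU, hχ0, hχ1, W, hW, hWs, hW1⟩ := exists_cutoff
    (isCompact_frontier hΩ.2.2.1) hU (fun x hx => ⟨hVs hx, by
      simp only [mem_iInter, mem_ofPred_eq]
      intro a b
      rw [gram, hR.orth x hx, sub_self, abs_zero]
      exact hε⟩)
  have hb : ∀ a b x, |χ x * (gram R a b x - if a = b then 1 else 0)| ≤ ε := fun a b x => by
    by_cases hx : x ∈ tsupport χ
    · have h := (hχU hx).2
      simp only [mem_iInter, mem_ofPred_eq] at h
      rw [abs_mul, abs_of_nonneg (hχ0 x)]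
      nlinarith [h a b, hχ1 x, hχ0 x, abs_nonneg (gram R a b x - if a = b then 1 else 0)]
    · rw [image_eq_zero_of_notMem_tsupport hx, zero_mul, abs_zero]
      exact hε.le
  have hR2 : ContDiff ℝ 2 R := hR.reg.of_le (by norm_num)
  obtain ⟨T, hT⟩ := hol_reflErr (hχ 3) hχs hR.reg hL hlip hb hC hD
  obtain ⟨s, hs2, hsT⟩ := exists_rpow_small (T := T) (δ := 1 / 4) (by norm_num)
  obtain ⟨K, hK, hmul⟩ := exists_C2Bd_mul_comp (hχ 2) hχs hR2
  set κ : ℝ := (s / 2) ^ (-1 / 4 : ℝ) with hκd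
  have hκ : 0 ≤ κ := Real.rpow_nonneg (by linarith) _
  refine ⟨s, hs2, C * (D + 1) * κ + K * (C * (D + 1) * κ), by positivity, fun φ B hφ => ?_⟩
  have hB := hφ.nonneg hN
  have hd := hdat φ B hφ
  set v := pot s φ with hv
  have hvc : ContDiff ℝ 2 v := contDiff_pot (by linarith) hd hB
  obtain ⟨q0, q1, q2, q3⟩ := hpot s (D * B) B φ hs2 hB hd
  have hvb : C2Bd v (C * (D + 1) * κ * B) := by
    have l1 : C * (D * B) * κ ≤ C * (D + 1) * κ * B := by
      have : 0 ≤ C * κ * B := by positivity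
      nlinarith
    have l2 : C * B * κ ≤ C * (D + 1) * κ * B := by
      have : 0 ≤ D * (C * κ * B) := by positivity
      nlinarith
    exact ⟨hvc, fun x => (q0 x).trans l1, fun i x => (q1 i x).trans l1,
      fun i j x => (q2 i j x).trans l2⟩
  have hm := hmul v _ hvb
  have hH := hT v κ B hκ hB hvc q0 q1 q2 q3
  have hle : B * (N * N * ε * C * √L + κ * T) ≤ B / 2 := by
    have : N * N * ε * C * √L ≤ 1 / 4 := by
      rw [hεd]
      have hp : 0 < 4 * (N * N * C * √L + 1) := by positivity
      have : (N:ℝ) * N * (1 / (4 * (N * N * C * √L + 1))) * C * √L =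
        (N * N * C * √L) / (4 * (N * N * C * √L + 1)) := by ring
      rw [this, div_le_iff₀ hp]
      linarith
    nlinarith
  refine ⟨Ω.indicator (reflErr χ R v), fun x => v x + (-1) * (χ x * v (R x)),
    HolZ.indicator (hH.mono hle) (by positivity) fun x hx => reflErr_eq_zero hR hW hW1 v hx (hWs hx),
    (hvb.add (hm.const_mul (-1))).mono (le_of_eq ?_), fun x hx => ?_, fun x hx => ?_⟩
  · rw [abs_neg, abs_one]
    ring
  · simp [hR.fix x hx, hW1 x (hWs hx)]
  · have e1 := lapl_reflect (hχ 2) hR2 hvc x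
    have e2 : lapl (fun x => v x + (-1) * (χ x * v (R x))) x =
        lapl v x + lapl (fun x => (-1) * (χ x * v (R x))) x :=
      lapl_add hvc (hm.const_mul (-1)).reg x
    have e3 : -lapl v (R x) + s * v (R x) = φ (R x) := lapl_pot (by linarith) hd hB (R x)
    have e4 : -lapl v x + s * v x = φ x := lapl_pot (by linarith) hd hB x
    have e5 : χ x * φ (R x) = 0 := by
      by_cases hxs : x ∈ tsupport χ
      · rw [hφ.zero _ (hout x ⟨hx, (hχU hxs).1⟩), mul_zero]
      · rw [image_eq_zero_of_notMem_tsupport hxs, zero_mul]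
    rw [indicator_of_mem hx, e2, lapl_const_mul]
    have e6 : lapl (fun y => χ y * v (R y)) x = -(reflErr χ R v x - χ x * lapl v (R x)) := by
      linarith
    rw [e6]
    linear_combination e4 - χ x * e3 - e5

/-- Solvability of the Dirichlet problem with estimates, for constant plus Hölder data. -/
def LinSolv (Ω : Set (Eu N)) (s : ℝ) : Prop :=
  ∃ C, 0 ≤ C ∧ ∀ (f : Eu N → ℝ) (B c : ℝ), HolZ Ω f B → ∃ u : Eu N → ℝ, C2Bd u (C * (B + |c|)) ∧
    (∀ x ∈ frontier Ω, u x = 0) ∧ ∀ x ∈ Ω, -lapl u x + s * u x = f x + c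

lemma exists_linSolv {Ω : Set (Eu N)} (hΩ : IsC3Domain Ω) (hN : 0 < N) :
    ∃ s, 2 ≤ s ∧ LinSolv Ω s := by
  obtain ⟨s, hs, C, hC, step⟩ := exists_halving hΩ hN
  obtain ⟨D, hD, hdat⟩ := exists_dat_of_holZ hN hΩ.2.2.1
  obtain ⟨w, hw, hws, hw0, hw1⟩ := exists_bdry_corrector hΩ
  have hw2 : ContDiff ℝ 2 w := hw.of_le (by norm_num)
  obtain ⟨K, hK, hwK⟩ := exists_C2Bd hw2 hws
  have main : ∀ f B, HolZ Ω f B → ∃ u : Eu N → ℝ, C2Bd u (2 * C * B) ∧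
      (∀ x ∈ frontier Ω, u x = 0) ∧ ∀ x ∈ Ω, -lapl u x + s * u x = f x := fun f B hf => by
    have hB := hf.nonneg hN
    choose! k v hk hv hv0 hv1 using step
    let d : ℕ → Eu N → ℝ := fun n => Nat.rec f (fun n g => k g (B / 2 ^ n)) n
    have hds : ∀ n, d (n + 1) = k (d n) (B / 2 ^ n) := fun n => rfl
    have hd : ∀ n, HolZ Ω (d n) (B / 2 ^ n) := fun n => by
      induction n with
      | zero => simpa [d] using hf
      | succ n ih =>
        have := hk _ _ ih
        rw [div_div, ← pow_succ] at this
        exact this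
    have hg : HasSum (fun n : ℕ => B / 2 ^ n) (B * 2) := by
      have := hasSum_geometric_two.mul_left B
      simpa [div_eq_mul_inv] using this
    have hds : ∀ x, Summable fun n => d n x := fun x =>
      Summable.of_norm_bounded (hg.summable.mul_left D) fun n => (hdat _ _ (hd n)).bdd x
    obtain ⟨r1, r2, r3⟩ := telescope_solution (Ω := Ω) (s := s)
      (u := fun n => v (d n) (B / 2 ^ n)) (hg.summable.mul_left C) (fun n => hv _ _ (hd n)) hds
      (fun n => hv0 _ _ (hd n)) fun n => hv1 _ _ (hd n)
    refine ⟨_, r1.mono (le_of_eq ?_), r2, r3⟩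
    rw [tsum_mul_left, hg.tsum_eq]
    ring
  obtain ⟨H1, hH10, hH1⟩ := exists_hol (contDiff_lapl hw) (hasCompactSupport_lapl hws)
  obtain ⟨H2, hH20, hH2⟩ := exists_hol (hw.of_le (by norm_num)) hws
  have hE : Hol (H1 + s * H2) fun x => -lapl w x + s * w x - 1 := fun x y => by
    have h := ((hH1.const_mul (-1)).add (hH2.const_mul s)) x y
    rw [abs_neg, abs_one, one_mul, abs_of_nonneg (by linarith : (0:ℝ) ≤ s)] at h
    convert h using 2
    ring
  have hE0 : 0 ≤ H1 + s * H2 := by positivity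
  set e := Ω.indicator fun x => -lapl w x + s * w x - 1 with hed
  have heZ : HolZ Ω e (H1 + s * H2) := HolZ.indicator hE hE0 fun x hx => by
    rw [hw0 x hx, hw1 x hx]
    ring
  refine ⟨s, hs, 2 * C * (1 + (H1 + s * H2)) + K, by positivity, fun f B c hf => ?_⟩
  have hB := hf.nonneg hN
  obtain ⟨u, hu, hu0, hu1⟩ := main (fun x => f x + -c * e x) (B + |-c| * (H1 + s * H2))
    ⟨hf.hol.add (heZ.hol.const_mul _), fun x hx => by simp [hf.zero x hx, heZ.zero x hx]⟩
  refine ⟨fun x => u x + c * w x, (hu.add (hwK.const_mul c)).mono ?_, fun x hx => ?_,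
    fun x hx => ?_⟩
  · rw [abs_neg]
    have : 0 ≤ 2 * C * (|c| + B * (H1 + s * H2)) + K * B := by positivity
    nlinarith
  · simp [hu0 x hx, hw0 x hx]
  · have e2 : lapl (fun x => u x + c * w x) x = lapl u x + lapl (fun x => c * w x) x :=
      lapl_add hu.reg (contDiff_const.mul hw2) x
    have e3 := hu1 x hx
    rw [hed, indicator_of_mem hx] at e3
    rw [e2, lapl_const_mul]
    linear_combination e3

end LinearLarge

section LinearZero

variable {N : ℕ}

/-- The quadratic barrier. -/
def bar (r : ℝ) (x : Eu N) : ℝ := r ^ 2 + 1 - nsq x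

lemma contDiff_bar {n : WithTop ℕ∞} (r : ℝ) : ContDiff ℝ n (bar r : Eu N → ℝ) :=
  contDiff_const.sub contDiff_nsq

lemma lapl_bar (r : ℝ) (x : Eu N) : lapl (bar r : Eu N → ℝ) x = -(2 * N) := by
  have := lapl_sub (f := fun _ => r ^ 2 + 1) (g := (nsq : Eu N → ℝ)) contDiff_const contDiff_nsq x
  rw [lapl_const, lapl_nsq, zero_sub] at this
  exact this

lemma one_le_bar {r : ℝ} {x : Eu N} (hx : ‖x‖ ≤ r) : 1 ≤ bar r x := by
  rw [bar, nsq_eq]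
  nlinarith [norm_nonneg x]

lemma bar_le (r : ℝ) (x : Eu N) : bar r x ≤ r ^ 2 + 1 := by
  rw [bar, nsq_eq]
  nlinarith [norm_nonneg x]

lemma norm_le_of_mem_closure {Ω : Set (Eu N)} {r : ℝ} (hr : Ω ⊆ closedBall 0 r) {x : Eu N}
    (hx : x ∈ closure Ω) : ‖x‖ ≤ r :=
  mem_closedBall_zero_iff.1 (closure_minimal hr isClosed_closedBall hx)

lemma le_bar_of_lapl {Ω : Set (Eu N)} (hN : 0 < N) (hΩ : IsOpen Ω) {r : ℝ}
    (hr : Ω ⊆ closedBall 0 r) {u : Eu N → ℝ} (hu : ContDiff ℝ 2 u) {s a : ℝ} (hs : 0 ≤ s)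
    (ha : 0 ≤ a) (hle : ∀ x ∈ Ω, -lapl u x + s * u x ≤ a * (2 * N + s * bar r x))
    (h0 : ∀ x ∈ frontier Ω, u x ≤ 0) : ∀ x ∈ closure Ω, u x ≤ a * bar r x := fun x hx => by
  have hw : ContDiff ℝ 2 fun x => u x - a * bar r x := hu.sub (contDiff_const.mul (contDiff_bar r))
  have := max_principle hN hΩ (isBounded_closedBall.subset hr) hw hs (fun x hx => ?_)
    (fun x hx => ?_) x hx
  · linarith
  · rw [lapl_sub hu (contDiff_const.mul (contDiff_bar r)), lapl_const_mul, lapl_bar]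
    have := hle x hx
    linarith
  · have h1 := one_le_bar (norm_le_of_mem_closure hr (frontier_subset_closure hx))
    have := mul_nonneg ha (zero_le_one.trans h1)
    linarith [h0 x hx]

lemma abs_le_bar_of_lapl {Ω : Set (Eu N)} (hN : 0 < N) (hΩ : IsOpen Ω) {r : ℝ}
    (hr : Ω ⊆ closedBall 0 r) {u : Eu N → ℝ} (hu : ContDiff ℝ 2 u) {s a : ℝ} (hs : 0 ≤ s)
    (ha : 0 ≤ a) (hle : ∀ x ∈ Ω, |-lapl u x + s * u x| ≤ a * (2 * N + s * bar r x))
    (h0 : ∀ x ∈ frontier Ω, u x = 0) : ∀ x ∈ closure Ω, |u x| ≤ a * bar r x := fun x hx => by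
  have h1 := le_bar_of_lapl hN hΩ hr hu hs ha (fun x hx => (le_abs_self _).trans (hle x hx))
    (fun x hx => (h0 x hx).le) x hx
  have h2 := le_bar_of_lapl hN hΩ hr (u := fun x => (-1) * u x) (contDiff_const.mul hu) hs ha
    (fun x hx => by
      have := (neg_le_abs _).trans (hle x hx)
      rw [lapl_const_mul]
      linarith)
    (fun x hx => by rw [h0 x hx]; simp) x hx
  exact abs_le.2 ⟨by linarith, h1⟩

lemma exists_frontier_norm_le {Ω : Set (Eu N)} {x y : Eu N} (hx : x ∈ Ω) (hy : y ∉ Ω) :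
    ∃ z ∈ frontier Ω, ‖x - z‖ ≤ ‖x - y‖ := by
  obtain ⟨z, hz, hzf⟩ := exists_mem_frontier (convex_segment x y).isPreconnected
      (left_mem_segment ℝ x y) hx (right_mem_segment ℝ x y) hy
  refine ⟨z, hzf, ?_⟩
  obtain ⟨a, b, ha, hb, hab, rfl⟩ := hz
  have : x - (a • x + b • y) = b • (x - y) := by
    obtain rfl : a = 1 - b := by linarith
    module
  rw [this, norm_smul, Real.norm_of_nonneg hb]
  nlinarith [norm_nonneg (x - y)]

/-- Interpolation between the sup norm on `Ω` and the Lipschitz constant. -/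
lemma holZ_indicator_of_sup {Ω : Set (Eu N)} {u : Eu N → ℝ} {C m : ℝ} (hu : C2Bd u C)
    (h0 : ∀ x ∈ frontier Ω, u x = 0) (hm0 : 0 ≤ m) (hm : ∀ x ∈ Ω, |u x| ≤ m) :
    HolZ Ω (Ω.indicator u) √(2 * m * (N * C)) := by
  have hC : 0 ≤ C := (abs_nonneg _).trans (hu.b0 0)
  refine ⟨fun x y => ?_, fun _ hx => indicator_of_notMem hx _⟩
  have hb : ∀ x, |Ω.indicator u x| ≤ m := fun x => by
    by_cases hx : x ∈ Ω
    · rw [indicator_of_mem hx]; exact hm x hx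
    · rw [indicator_of_notMem hx, abs_zero]; exact hm0
  have key : ∀ x ∈ Ω, ∀ y ∉ Ω, |u x| ≤ N * C * ‖x - y‖ := fun x hx y hy => by
    obtain ⟨z, hz, hzn⟩ := exists_frontier_norm_le hx hy
    have := hu.lip x z
    rw [h0 z hz, sub_zero] at this
    exact this.trans (by gcongr)
  have hl : |Ω.indicator u x - Ω.indicator u y| ≤ N * C * ‖x - y‖ := by
    by_cases hx : x ∈ Ω <;> by_cases hy : y ∈ Ω
    · simpa [hx, hy] using hu.lip x y
    · simpa [hx, hy] using key x hx y hy
    · have := key y hy x hx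
      rw [norm_sub_rev]
      simpa [hx, hy] using this
    · simp only [indicator_of_notMem hx, indicator_of_notMem hy, sub_self, abs_zero]
      positivity
  have h2 : |Ω.indicator u x - Ω.indicator u y| ≤ 2 * m :=
    (abs_sub _ _).trans (by linarith [hb x, hb y])
  rw [← Real.sqrt_mul (by positivity)]
  refine Real.abs_le_sqrt ?_
  rw [← sq_abs, pow_two, mul_assoc]
  exact mul_le_mul h2 hl (abs_nonneg _) (by positivity)

lemma linSolv_zero {Ω : Set (Eu N)} (hΩ : IsC3Domain Ω) (hN : 0 < N) : LinSolv Ω 0 := by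
  obtain ⟨s, hs, C, hC, solve⟩ := exists_linSolv hΩ hN
  obtain ⟨r, hr, hrΩ⟩ := hΩ.2.2.1.subset_closedBall_lt 0 (0 : Eu N)
  choose! sol hb hbd hsol using solve
  have hNR : (0 : ℝ) < N := by exact_mod_cast hN
  set Z := r ^ 2 + 1 with hZ
  have hZ0 : 0 < Z := by positivity
  set θ := s * Z / (2 * N + s * Z) with hθ
  have hsZ : 0 < s * Z := by positivity
  have hθ0 : 0 < θ := by positivity
  have hθ1 : θ < 1 := by rw [hθ, div_lt_one (by positivity)]; linarith
  have hθs : ∀ x : Eu N, s * bar r x ≤ θ * (2 * N + s * bar r x) := fun x => by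
    have h1 : θ * (2 * N + s * Z) = s * Z := by rw [hθ]; field_simp
    have h2 := mul_le_mul_of_nonneg_left (bar_le r x) (by linarith : 0 ≤ s)
    nlinarith
  set β := 2 * Z * N * (1 + C * s / θ) + 1 with hβ
  have hβ1 : 1 ≤ β := by
    have : 0 ≤ 2 * Z * N * (1 + C * s / θ) := by positivity
    linarith
  have hββ : 2 * Z * N * (1 + C * s * β / θ) ≤ β ^ 2 := by
    have h1 : 1 + C * s * β / θ ≤ β * (1 + C * s / θ) := by
      have : β * (1 + C * s / θ) = β + C * s * β / θ := by ring
      linarith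
    have h2 := mul_le_mul_of_nonneg_left h1 (by positivity : 0 ≤ 2 * Z * N)
    nlinarith
  refine ⟨C * (1 + C * s * β / θ) / (1 - θ),
    div_nonneg (by positivity) (by linarith), fun f B c hf => ?_⟩
  have hB := hf.nonneg hN
  set S := C * (B + |c|) with hS
  have hS0 : 0 ≤ S := by positivity
  set A := S * (1 + C * s * β / θ) with hA
  have hA0 : 0 ≤ A := by positivity
  let u : ℕ → Eu N → ℝ := fun n => Nat.rec (sol f B c)
    (fun n g => sol (fun x => s * Ω.indicator g x) (|s| * (S * β * θ ^ n)) 0) n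
  have hrec : ∀ n, u (n + 1) =
    sol (fun x => s * Ω.indicator (u n) x) (|s| * (S * β * θ ^ n)) 0 := fun n => rfl
  have hu0 : u 0 = sol f B c := rfl
  have hstep : ∀ n, C2Bd (u n) (A * θ ^ n) → (∀ x ∈ frontier Ω, u n x = 0) →
      (∀ x ∈ Ω, |u n x| ≤ S * θ ^ n * bar r x) →
      HolZ Ω (fun x => s * Ω.indicator (u n) x) (|s| * (S * β * θ ^ n)) := fun n h1 h2 h3 => by
    have h4 := holZ_indicator_of_sup h1 h2 (m := S * θ ^ n * Z) (by positivity) fun x hx =>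
      (h3 x hx).trans (mul_le_mul_of_nonneg_left (bar_le r x) (by positivity))
    have h5 : √(2 * (S * θ ^ n * Z) * (N * (A * θ ^ n))) ≤ S * β * θ ^ n := by
      refine Real.sqrt_le_iff.2 ⟨by positivity, ?_⟩
      have : 2 * (S * θ ^ n * Z) * (N * (A * θ ^ n)) =
          (2 * Z * N * (1 + C * s * β / θ)) * (S * θ ^ n) ^ 2 := by rw [hA]; ring
      rw [this]
      have h6 := mul_le_mul_of_nonneg_right hββ (sq_nonneg (S * θ ^ n))
      linarith [h6]
    exact ⟨(h4.hol.mono h5).const_mul s, fun x hx => by simp [hx]⟩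
  have hind : ∀ n, C2Bd (u n) (A * θ ^ n) ∧ (∀ x ∈ frontier Ω, u n x = 0) ∧
      ∀ x ∈ Ω, |u n x| ≤ S * θ ^ n * bar r x := fun n => by
    induction n with
    | zero =>
      have h1 := hb f B c hf
      have hA1 : S ≤ A := by
        have : 0 ≤ S * (C * s * β / θ) := by positivity
        rw [hA]; linarith
      refine ⟨by rw [pow_zero, mul_one]; exact h1.mono hA1, hbd f B c hf, fun x hx => ?_⟩
      have h2 := one_le_bar (norm_le_of_mem_closure hrΩ (subset_closure hx))
      have h3 : |u 0 x| ≤ S := h1.b0 x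
      rw [pow_zero, mul_one]
      nlinarith
    | succ n ih =>
      have hz := hstep n ih.1 ih.2.1 ih.2.2
      have h1 := hb _ _ 0 hz
      have h2 := hbd _ _ 0 hz
      have h3 := hsol _ _ 0 hz
      rw [← hrec] at h1 h2 h3
      refine ⟨h1.mono ?_, h2, fun x hx => abs_le_bar_of_lapl hN hΩ.1 hrΩ h1.reg
        (s := s) (by linarith) (by positivity) (fun x hx => ?_) h2 x (subset_closure hx)⟩
      · have e : A * θ ^ (n + 1) = S * θ ^ (n + 1) + C * (s * (S * β * θ ^ n)) := by
          rw [hA, pow_succ]; field_simp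
        rw [abs_zero, add_zero, abs_of_nonneg (by linarith : 0 ≤ s), e]
        have : 0 ≤ S * θ ^ (n + 1) := by positivity
        linarith
      · rw [h3 x hx, indicator_of_mem hx, add_zero, abs_mul, abs_of_nonneg (by linarith : 0 ≤ s)]
        have h4 := mul_le_mul_of_nonneg_left (ih.2.2 x hx) (by linarith : 0 ≤ s)
        have h5 := mul_le_mul_of_nonneg_left (hθs x) (by positivity : 0 ≤ S * θ ^ n)
        rw [pow_succ]
        linarith
  let d : ℕ → Eu N → ℝ := fun n => Nat.casesOn n (fun x => f x + c) fun n x => s * u n x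
  have hds : ∀ x, Summable fun n => d n x := fun x => by
    rw [← summable_nat_add_iff 1]
    exact (Summable.of_norm_bounded ((summable_geometric_of_lt_one hθ0.le hθ1).mul_left A)
      fun n => (hind n).1.b0 x).mul_left s
  obtain ⟨r1, r2, r3⟩ := telescope_solution (Ω := Ω) (s := 0) (u := u) (d := d)
    ((summable_geometric_of_lt_one hθ0.le hθ1).mul_left A) (fun n => (hind n).1) hds
    (fun n => (hind n).2.1) fun n x hx => by
      cases n with
      | zero =>
        have := hsol f B c hf x hx
        change -lapl (sol f B c) x + 0 * _ = (f x + c) - s * sol f B c x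
        linarith
      | succ n =>
        have hz := hstep n (hind n).1 (hind n).2.1 (hind n).2.2
        have := hsol _ _ 0 hz x hx
        rw [← hrec, indicator_of_mem hx] at this
        change -lapl (u (n + 1)) x + 0 * _ = s * u n x - s * u (n + 1) x
        linarith
  refine ⟨_, r1.mono (le_of_eq ?_), r2, r3⟩
  rw [tsum_mul_left, tsum_geometric_of_lt_one hθ0.le hθ1, hA, hS]
  ring

end LinearZero

section Mollify

variable {N : ℕ}

lemma abs_clm_ev_le (L : Eu N →L[ℝ] ℝ) (i : Fin N) : |L (ev i)| ≤ ‖L‖ := by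
  simpa [norm_ev] using L.le_opNorm (ev i)

lemma exists_mollify {Ω : Set (Eu N)} (hΩ : IsOpen Ω) {w : Eu N → ℝ} (hw : ContDiff ℝ 1 w)
    (hc : HasCompactSupport w) (hs : tsupport w ⊆ Ω) {ε : ℝ} (hε : 0 < ε) :
    ∃ v : Eu N → ℝ, ContDiff ℝ (⊤ : ℕ∞) v ∧ HasCompactSupport v ∧ tsupport v ⊆ Ω ∧
      (∀ x, |v x - w x| ≤ ε) ∧ ∀ i x, |pd i v x - pd i w x| ≤ ε := by
  obtain ⟨δ₀, hδ₀, hδΩ⟩ := IsCompact.exists_cthickening_subset_open hc hΩ hs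
  have hdw : Continuous (fderiv ℝ w) := hw.continuous_fderiv one_ne_zero
  obtain ⟨δ₁, hδ₁, h1⟩ := Metric.uniformContinuous_iff.1
    (hc.uniformContinuous_of_continuous hw.continuous) ε hε
  obtain ⟨δ₂, hδ₂, h2⟩ := Metric.uniformContinuous_iff.1
    ((hc.fderiv ℝ).uniformContinuous_of_continuous hdw) ε hε
  have hδ : 0 < min δ₀ (min δ₁ δ₂) := by positivity
  let φ : ContDiffBump (0 : Eu N) := ⟨min δ₀ (min δ₁ δ₂) / 2, min δ₀ (min δ₁ δ₂), by positivity,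
    by linarith⟩
  have hr0 : φ.rOut ≤ δ₀ := min_le_left _ _
  have hr1 : φ.rOut ≤ δ₁ := (min_le_right _ _).trans (min_le_left _ _)
  have hr2 : φ.rOut ≤ δ₂ := (min_le_right _ _).trans (min_le_right _ _)
  have hloc : LocallyIntegrable (φ.normed volume) :=
    (φ.continuous_normed (μ := volume)).locallyIntegrable
  let v := convolution (φ.normed volume) w (ContinuousLinearMap.lsmul ℝ ℝ) volume
  have hsupp : tsupport v ⊆ cthickening δ₀ (tsupport w) := by
    refine closure_minimal (fun x hx => ?_) isClosed_cthickening
    by_contra hxn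
    refine hx ?_
    have hz : ∀ y ∈ ball x φ.rOut, w y = 0 := fun y hy => by
      by_contra hy0
      refine hxn (mem_cthickening_of_dist_le x y δ₀ _ (subset_tsupport w hy0) ?_)
      rw [dist_comm]
      exact (mem_ball.1 hy).le.trans hr0
    have h0 := hz x (mem_ball_self φ.rOut_pos)
    have := φ.normed_convolution_eq_right (μ := volume) (g := w) (x₀ := x)
      fun y hy => by rw [hz y hy, h0]
    exact this.trans h0
  refine ⟨v, φ.hasCompactSupport_normed.contDiff_convolution_left _ φ.contDiff_normed
    hw.continuous.locallyIntegrable, ?_, hsupp.trans hδΩ, fun x => ?_, fun i x => ?_⟩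
  · exact hc.cthickening.of_isClosed_subset (isClosed_tsupport _) hsupp
  · have := φ.dist_normed_convolution_le (μ := volume) (g := w) (x₀ := x) (ε := ε)
      hw.continuous.aestronglyMeasurable fun y hy => (h1 ((mem_ball.1 hy).trans_le hr1)).le
    exact this
  · have e : pd i v x = convolution (φ.normed volume) (pd i w) (ContinuousLinearMap.lsmul ℝ ℝ)
        volume x := by
      rw [pd, (hc.hasFDerivAt_convolution_right _ hloc hw x).fderiv,
        convolution_precompR_apply _ hloc (hc.fderiv ℝ) hdw]
      rfl
    have := φ.dist_normed_convolution_le (μ := volume) (g := pd i w) (x₀ := x) (ε := ε)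
      (hdw.clm_apply continuous_const).aestronglyMeasurable fun y hy => by
        have h3 := (h2 ((mem_ball.1 hy).trans_le hr2)).le
        rw [dist_eq_norm] at h3 ⊢
        have h4 := abs_clm_ev_le (fderiv ℝ w y - fderiv ℝ w x) i
        exact h4.trans h3
    rw [e]
    exact this

end Mollify

section Lam

variable {N : ℕ}

lemma norm_gradient_sq (w : Eu N → ℝ) (x : Eu N) : ‖gradient w x‖ ^ 2 = ∑ i, pd i w x ^ 2 := by
  rw [EuclideanSpace.norm_sq_eq]
  refine Finset.sum_congr rfl fun i _ => ?_
  rw [Real.norm_eq_abs, sq_abs, pd, ← inner_gradient_left, ev, EuclideanSpace.inner_single_right]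
  simp

lemma lam_mul_le_of_smooth {Ω : Set (Eu N)} {t : ℝ} (ht : 0 < t) {w : Eu N → ℝ}
    (hw : ContDiff ℝ (⊤ : ℕ∞) w) (hc : HasCompactSupport w) (hs : tsupport w ⊆ Ω) :
    Lam Ω t * (∫ x in Ω, |w x| ^ t) ^ (2 / t) ≤ ∫ x in Ω, ∑ i, pd i w x ^ 2 := by
  simp_rw [← norm_gradient_sq]
  have h0 : 0 ≤ ∫ x in Ω, |w x| ^ t := integral_nonneg fun x => by positivity
  have hR : 0 ≤ ∫ x in Ω, ‖gradient w x‖ ^ 2 := integral_nonneg fun x => by positivity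
  rcases h0.eq_or_lt with h | h
  · rw [← h, Real.zero_rpow (by positivity), mul_zero]
    exact hR
  · rw [← le_div_iff₀ (by positivity)]
    refine csInf_le ⟨0, ?_⟩ ⟨w, hw, hc, hs, ?_, rfl⟩
    · rintro r ⟨w, -, -, -, -, rfl⟩
      positivity
    · rintro rfl
      simp [Real.zero_rpow ht.ne'] at h

lemma lam_mul_le {Ω : Set (Eu N)} (hΩ : IsOpen Ω) (hfin : volume Ω ≠ ⊤) {t : ℝ} (ht : 0 < t)
    {w : Eu N → ℝ} (hw : ContDiff ℝ 1 w) (hc : HasCompactSupport w) (hs : tsupport w ⊆ Ω) :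
    Lam Ω t * (∫ x in Ω, |w x| ^ t) ^ (2 / t) ≤ ∫ x in Ω, ∑ i, pd i w x ^ 2 := by
  have : IsFiniteMeasure (volume.restrict Ω) := ⟨by simpa using hfin.lt_top⟩
  choose v hv hvc hvs hv0 hv1 using fun n : ℕ =>
    exists_mollify hΩ hw hc hs (Nat.one_div_pos_of_nat (α := ℝ) (n := n))
  have hn1 : ∀ n : ℕ, 1 / ((n : ℝ) + 1) ≤ 1 := fun n => by
    rw [div_le_one (by positivity)]; linarith [(n.cast_nonneg : (0 : ℝ) ≤ n)]
  have conv : ∀ {g : ℕ → ℝ} {a : ℝ}, (∀ n : ℕ, |g n - a| ≤ 1 / ((n : ℝ) + 1)) →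
      Filter.Tendsto g Filter.atTop (nhds a) := fun h => by
    rw [tendsto_iff_dist_tendsto_zero]
    exact squeeze_zero (fun _ => dist_nonneg) (fun n => h n) tendsto_one_div_add_atTop_nhds_zero_nat
  obtain ⟨M, hM0, hM⟩ := exists_bound hc hw.continuous
  have hcp : ∀ {f : Eu N → ℝ}, ContDiff ℝ 1 f → ∀ i, Continuous (pd i f) := fun hf i =>
    (contDiff_pd (m := 0) hf (by simp) i).continuous
  choose K hK0 hK using fun i => exists_bound (hasCompactSupport_pd hc i) (hcp hw i)
  have le1 : ∀ {a b m : ℝ} {n : ℕ}, |a - b| ≤ 1 / ((n : ℝ) + 1) → |b| ≤ m → |a| ≤ m + 1 :=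
    fun {a b m n} h1 h2 => by
      have := abs_add_le (a - b) b
      rw [sub_add_cancel] at this
      linarith [hn1 n]
  have L1 : Filter.Tendsto (fun n => ∫ x in Ω, |v n x| ^ t) Filter.atTop
      (nhds (∫ x in Ω, |w x| ^ t)) := by
    refine tendsto_integral_filter_of_norm_le_const (.of_forall fun n => ?_)
      ⟨(M + 1) ^ t, .of_forall fun n => .of_forall fun x => ?_⟩ (.of_forall fun x => ?_)
    · exact ((hv n).continuous.abs.rpow_const fun _ => .inr ht.le).aestronglyMeasurable
    · rw [Real.norm_of_nonneg (by positivity)]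
      exact Real.rpow_le_rpow (abs_nonneg _) (le1 (hv0 n x) (hM x)) ht.le
    · exact (conv fun n => hv0 n x).abs.rpow_const (.inr ht.le)
  have L2 : Filter.Tendsto (fun n => ∫ x in Ω, ∑ i, pd i (v n) x ^ 2) Filter.atTop
      (nhds (∫ x in Ω, ∑ i, pd i w x ^ 2)) := by
    refine tendsto_integral_filter_of_norm_le_const (.of_forall fun n => ?_)
      ⟨∑ i, (K i + 1) ^ 2, .of_forall fun n => .of_forall fun x => ?_⟩ (.of_forall fun x => ?_)
    · exact (continuous_finsetSum _ fun i _ =>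
        (hcp ((hv n).of_le (by exact_mod_cast le_top)) i).pow 2).aestronglyMeasurable
    · rw [Real.norm_of_nonneg (by positivity)]
      refine Finset.sum_le_sum fun i _ => ?_
      rw [← sq_abs]
      exact pow_le_pow_left₀ (abs_nonneg _) (le1 (hv1 n i x) (hK i x)) 2
    · exact tendsto_finsetSum _ fun i _ => (conv fun n => hv1 n i x).pow 2
  exact le_of_tendsto_of_tendsto' ((L1.rpow_const (.inr (by positivity))).const_mul _) L2
    fun n => lam_mul_le_of_smooth ht (hv n) (hvc n) (hvs n)

end Lam

section Energy

variable {N : ℕ}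

lemma exists_trunc {ε : ℝ} (hε : 0 < ε) : ∃ η h : ℝ → ℝ, (∀ s, HasDerivAt η (h s) s) ∧
    Continuous h ∧ (∀ s, 0 ≤ h s ∧ h s ≤ 1) ∧ (∀ s, |s| ≤ ε → η s = 0) ∧ (∀ s, |η s| ≤ |s|) ∧
    ∀ s, |η s - s| ≤ 4 * ε := by
  let k : ℝ → ℝ := fun t => max 0 (min 1 (2 - |t| / ε))
  have hk : Continuous k := by fun_prop
  have hk0 : ∀ t, 0 ≤ k t := fun t => le_max_left _ _
  have hk1 : ∀ t, k t ≤ 1 := fun t => max_le zero_le_one (min_le_left _ _)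
  have hh : Continuous fun t => 1 - k t := by fun_prop
  refine ⟨fun s => ∫ t in (0 : ℝ)..s, (1 - k t), fun t => 1 - k t, fun s => ?_, hh,
    fun s => ⟨by linarith [hk1 s], by linarith [hk0 s]⟩, fun s hs => ?_, fun s => ?_, fun s => ?_⟩
  · exact intervalIntegral.integral_hasDerivAt_right (hh.intervalIntegrable _ _)
      (hh.stronglyMeasurableAtFilter _ _) hh.continuousAt
  · have : ∀ t ∈ uIcc 0 s, 1 - k t = 0 := fun t ht => by
      have h1 : |t| ≤ |s| := by simpa using abs_sub_left_of_mem_uIcc ht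
      have h2 : |t| / ε ≤ 1 := by rw [div_le_one hε]; linarith
      have h3 : k t = 1 := by
        change max 0 (min 1 (2 - |t| / ε)) = 1
        rw [min_eq_left (by linarith), max_eq_right zero_le_one]
      rw [h3, sub_self]
    change ∫ t in (0 : ℝ)..s, (1 - k t) = 0
    rw [intervalIntegral.integral_congr (g := fun _ => 0) this, intervalIntegral.integral_zero]
  · have := intervalIntegral.norm_integral_le_of_norm_le_const (a := 0) (b := s) (C := 1)
      (f := fun t => 1 - k t) fun t _ => by
        rw [Real.norm_eq_abs, abs_le]; constructor <;> linarith [hk0 t, hk1 t]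
    simpa using this
  · have e : (∫ t in (0 : ℝ)..s, (1 - k t)) - s = -∫ t in (0 : ℝ)..s, k t := by
      rw [intervalIntegral.integral_sub (by simp) (hk.intervalIntegrable _ _)]
      simp
    change |(∫ t in (0 : ℝ)..s, (1 - k t)) - s| ≤ _
    rw [e, abs_neg]
    have hle : ∀ t, k t ≤ (Icc (-(2 * ε)) (2 * ε)).indicator (fun _ => (1 : ℝ)) t := fun t => by
      by_cases ht : t ∈ Icc (-(2 * ε)) (2 * ε)
      · rw [indicator_of_mem ht]; exact hk1 t
      · rw [indicator_of_notMem ht]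
        have : 2 * ε < |t| := by
          by_contra hcon
          exact ht (abs_le.1 (not_lt.1 hcon))
        have : 2 < |t| / ε := by rwa [lt_div_iff₀ hε]
        exact max_le le_rfl ((min_le_right _ _).trans (by linarith))
    have hI : Integrable ((Icc (-(2 * ε)) (2 * ε)).indicator (fun _ => (1 : ℝ))) :=
      (integrable_indicator_iff measurableSet_Icc).2 (by simp [integrableOn_const_iff])
    have hki : Integrable k := hI.mono' hk.aestronglyMeasurable (.of_forall fun t => by
      rw [Real.norm_of_nonneg (hk0 t)]; exact hle t)
    have h1 := intervalIntegral.norm_integral_le_integral_norm_uIoc (μ := volume) (a := 0)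
      (b := s) (f := k)
    have h2 : ∫ t in uIoc 0 s, ‖k t‖ ≤ ∫ t, ‖k t‖ :=
      setIntegral_le_integral hki.norm (.of_forall fun t => norm_nonneg _)
    have h3 : ∫ t, ‖k t‖ ≤ ∫ t, (Icc (-(2 * ε)) (2 * ε)).indicator (fun _ => (1 : ℝ)) t :=
      integral_mono hki.norm hI fun t => by
        change ‖k t‖ ≤ _
        rw [Real.norm_of_nonneg (hk0 t)]; exact hle t
    rw [integral_indicator measurableSet_Icc] at h3
    simp [hε.le] at h3
    rw [Real.norm_eq_abs] at h1
    have h4 : ∫ t, ‖k t‖ ≤ 4 * ε := h3.trans (le_of_eq (by ring))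
    linarith

lemma integral_pd_mul_eq {w g : Eu N → ℝ} (hw : ContDiff ℝ 1 w) (hc : HasCompactSupport w)
    (hg : ContDiff ℝ 1 g) (i : Fin N) : ∫ x, pd i w x * g x = -∫ x, w x * pd i g x := by
  have hdw := (contDiff_pd (m := 0) hw (by simp) i).continuous
  have hdg := (contDiff_pd (m := 0) hg (by simp) i).continuous
  have := integral_mul_fderiv_eq_neg_fderiv_mul_of_integrable (μ := volume) (f := w) (g := g)
    (v := ev i)
    ((hdw.mul hg.continuous).integrable_of_hasCompactSupport (hasCompactSupport_pd hc i).mul_right)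
    ((hw.continuous.mul hdg).integrable_of_hasCompactSupport hc.mul_right)
    ((hw.continuous.mul hg.continuous).integrable_of_hasCompactSupport hc.mul_right)
    (fun x _ => (hw.differentiable one_ne_zero) x) (fun x _ => (hg.differentiable one_ne_zero) x)
  change ∫ x, fderiv ℝ w x (ev i) * g x = -∫ x, w x * fderiv ℝ g x (ev i)
  rw [this, neg_neg]

lemma integral_sum_pd_mul_pd {w z : Eu N → ℝ} (hw : ContDiff ℝ 1 w) (hc : HasCompactSupport w)
    (hz : ContDiff ℝ 2 z) : ∫ x, ∑ i, pd i w x * pd i z x = ∫ x, w x * -lapl z x := by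
  have hdz : ∀ i, ContDiff ℝ 1 (pd i z) := fun i => contDiff_pd hz (by norm_num) i
  have hdw : ∀ i, Continuous (pd i w) := fun i => (contDiff_pd (m := 0) hw (by simp) i).continuous
  have hddz : ∀ i, Continuous (pd i (pd i z)) :=
    fun i => (contDiff_pd (m := 0) (hdz i) (by simp) i).continuous
  have I1 : ∀ i, Integrable fun x => pd i w x * pd i z x := fun i =>
    ((hdw i).mul (hdz i).continuous).integrable_of_hasCompactSupport
      (hasCompactSupport_pd hc i).mul_right
  have I2 : ∀ i, Integrable fun x => w x * pd i (pd i z) x := fun i =>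
    (hw.continuous.mul (hddz i)).integrable_of_hasCompactSupport hc.mul_right
  rw [integral_finsetSum _ fun i _ => I1 i]
  simp_rw [lapl_eq, integral_pd_mul_eq hw hc (hdz _)]
  rw [Finset.sum_neg_distrib, ← integral_finsetSum _ fun i _ => I2 i, ← integral_neg]
  refine integral_congr_ae (.of_forall fun x => ?_)
  simp only [Finset.mul_sum, mul_neg]

lemma energy_le {Ω : Set (Eu N)} (hΩ : IsOpen Ω) (hb : Bornology.IsBounded Ω) {t : ℝ} (ht : 0 < t)
    {z : Eu N → ℝ} (hz : ContDiff ℝ 2 z) (h0 : ∀ x ∈ frontier Ω, z x = 0) :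
    Lam Ω t * (∫ x in Ω, |z x| ^ t) ^ (2 / t) ≤ ∫ x in Ω, z x * -lapl z x := by
  have hfin : volume Ω ≠ ⊤ := hb.measure_lt_top.ne
  have : IsFiniteMeasure (volume.restrict Ω) := ⟨by simpa using hfin.lt_top⟩
  have hcl : IsCompact (closure Ω) := hb.isCompact_closure
  have hlz : Continuous (lapl z) := by
    have : lapl z = fun x => ∑ i, pd i (pd i z) x := funext fun x => lapl_eq z x
    rw [this]
    exact continuous_finsetSum _ fun i _ => (contDiff_pd (m := 0)
      (contDiff_pd (m := 1) hz (by norm_num) i) (by simp) i).continuous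
  obtain ⟨M, hM⟩ := hcl.exists_bound_of_continuousOn hz.continuous.continuousOn
  obtain ⟨L, hL⟩ := hcl.exists_bound_of_continuousOn hlz.continuousOn
  have step : ∀ ε : ℝ, 0 < ε → ∃ w : Eu N → ℝ, Continuous w ∧ (∀ x, |w x| ≤ |z x|) ∧
      (∀ x ∈ Ω, |w x - z x| ≤ 4 * ε) ∧
      Lam Ω t * (∫ x in Ω, |w x| ^ t) ^ (2 / t) ≤ ∫ x in Ω, w x * -lapl z x := fun ε hε => by
    obtain ⟨η, h, hη, hh, hh01, hη0, hη1, hη2⟩ := exists_trunc hε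
    have hηc : ContDiff ℝ 1 η := contDiff_one_iff_deriv.2
      ⟨fun s => (hη s).differentiableAt, by rwa [show deriv η = h from funext fun s => (hη s).deriv]⟩
    set w : Eu N → ℝ := Ω.indicator fun x => η (z x) with hw
    have hwΩ : ∀ x ∈ Ω, w =ᶠ[nhds x] fun x => η (z x) := fun x hx => by
      filter_upwards [hΩ.mem_nhds hx] with y hy
      exact indicator_of_mem hy _
    have hVo : IsOpen ({x | |z x| < ε} ∪ (closure Ω)ᶜ) :=
      (isOpen_lt hz.continuous.abs continuous_const).union isClosed_closure.isOpen_compl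
    have hwV : ∀ x ∈ {x | |z x| < ε} ∪ (closure Ω)ᶜ, w x = 0 := fun x hx => by
      by_cases hxΩ : x ∈ Ω
      · rw [hw, indicator_of_mem hxΩ]
        rcases hx with hx | hx
        · exact hη0 _ (le_of_lt hx)
        · exact absurd (subset_closure hxΩ) hx
      · exact indicator_of_notMem hxΩ _
    have hcov : ∀ x ∉ Ω, x ∈ {x | |z x| < ε} ∪ (closure Ω)ᶜ := fun x hx => by
      by_cases hxc : x ∈ closure Ω
      · left
        have : x ∈ frontier Ω := by rw [hΩ.frontier_eq]; exact ⟨hxc, hx⟩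
        change |z x| < ε
        rw [h0 x this, abs_zero]; exact hε
      · exact .inr hxc
    have hwc : ContDiff ℝ 1 w := contDiff_iff_contDiffAt.2 fun x => by
      by_cases hx : x ∈ Ω
      · exact (hηc.comp (hz.of_le one_le_two)).contDiffAt.congr_of_eventuallyEq (hwΩ x hx)
      · refine (contDiffAt_const (c := (0 : ℝ))).congr_of_eventuallyEq ?_
        filter_upwards [hVo.mem_nhds (hcov x hx)] with y hy
        exact hwV y hy
    have hts : tsupport w ⊆ ({x | |z x| < ε} ∪ (closure Ω)ᶜ)ᶜ :=
      closure_minimal (fun x hx hxV => hx (hwV x hxV)) hVo.isClosed_compl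
    have htsΩ : tsupport w ⊆ Ω := fun x hx => by
      by_contra hxn
      exact hts hx (hcov x hxn)
    have hcs : HasCompactSupport w :=
      hcl.of_isClosed_subset (isClosed_tsupport _) (htsΩ.trans subset_closure)
    have hpd : ∀ x ∈ Ω, ∀ i, pd i w x = h (z x) * pd i z x := fun x hx i => by
      rw [pd_congr (hwΩ x hx) i, pd, pd]
      have := (hη (z x)).comp_hasFDerivAt x (hz.differentiable two_ne_zero x).hasFDerivAt
      rw [show (fun x => η (z x)) = η ∘ z from rfl, this.fderiv]
      simp
    have hwz : ∀ x ∉ Ω, w x = 0 := fun x hx => indicator_of_notMem hx _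
    have hpdz : ∀ x ∉ Ω, ∀ i, pd i w x = 0 := fun x hx i => by
      have : fderiv ℝ w x = 0 := image_eq_zero_of_notMem_tsupport
        fun hx' => hx (htsΩ (tsupport_fderiv_subset ℝ hx'))
      rw [pd, this]; rfl
    refine ⟨w, hwc.continuous, fun x => ?_, fun x hx => ?_,
      (lam_mul_le hΩ hfin ht hwc hcs htsΩ).trans ?_⟩
    · by_cases hx : x ∈ Ω
      · rw [hw, indicator_of_mem hx]; exact hη1 _
      · rw [hwz x hx, abs_zero]; positivity
    · rw [hw, indicator_of_mem hx]; exact hη2 _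
    · rw [setIntegral_eq_integral_of_forall_compl_eq_zero (f := fun x => w x * -lapl z x)
        fun x hx => by rw [hwz x hx, zero_mul], ← integral_sum_pd_mul_pd hwc hcs hz,
        setIntegral_eq_integral_of_forall_compl_eq_zero fun x hx =>
          Finset.sum_eq_zero fun i _ => by rw [hpdz x hx i, zero_pow two_ne_zero]]
      have hdw : ∀ i, Continuous (pd i w) :=
        fun i => (contDiff_pd (m := 0) hwc (by simp) i).continuous
      have hdz : ∀ i, Continuous (pd i z) :=
        fun i => (contDiff_pd (m := 0) hz (by norm_num) i).continuous
      refine integral_mono ?_ ?_ fun x => ?_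
      · refine integrable_finsetSum _ fun i _ => ?_
        simp_rw [pow_two]
        exact ((hdw i).mul (hdw i)).integrable_of_hasCompactSupport
          (hasCompactSupport_pd hcs i).mul_right
      · exact integrable_finsetSum _ fun i _ => ((hdw i).mul (hdz i)).integrable_of_hasCompactSupport
          (hasCompactSupport_pd hcs i).mul_right
      · refine Finset.sum_le_sum fun i _ => ?_
        by_cases hx : x ∈ Ω
        · rw [hpd x hx i]
          have := hh01 (z x)
          have h1 : 0 ≤ h (z x) * (1 - h (z x)) := mul_nonneg this.1 (by linarith)
          nlinarith [mul_nonneg h1 (sq_nonneg (pd i z x))]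
        · rw [hpdz x hx i]; simp
  choose w hwc hw1 hw2 hw3 using fun n : ℕ => step (1 / ((n : ℝ) + 1)) Nat.one_div_pos_of_nat
  have hlim : ∀ x ∈ Ω, Filter.Tendsto (fun n => w n x) Filter.atTop (nhds (z x)) := fun x hx => by
    rw [tendsto_iff_dist_tendsto_zero]
    refine squeeze_zero (fun _ => dist_nonneg) (fun n => hw2 n x hx) ?_
    simpa using (tendsto_one_div_add_atTop_nhds_zero_nat (𝕜 := ℝ)).const_mul 4
  have hΩm := hΩ.measurableSet
  have bd : ∀ n, ∀ x ∈ Ω, |w n x| ≤ M := fun n x hx => (hw1 n x).trans (hM x (subset_closure hx))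
  have L1 : Filter.Tendsto (fun n => ∫ x in Ω, |w n x| ^ t) Filter.atTop
      (nhds (∫ x in Ω, |z x| ^ t)) := by
    refine tendsto_integral_filter_of_norm_le_const (.of_forall fun n => ?_)
      ⟨M ^ t, .of_forall fun n => (ae_restrict_iff' hΩm).2 (.of_forall fun x hx => ?_)⟩
      ((ae_restrict_iff' hΩm).2 (.of_forall fun x hx => ?_))
    · exact ((hwc n).abs.rpow_const fun _ => .inr ht.le).aestronglyMeasurable
    · rw [Real.norm_of_nonneg (by positivity)]
      exact Real.rpow_le_rpow (abs_nonneg _) (bd n x hx) ht.le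
    · exact (hlim x hx).abs.rpow_const (.inr ht.le)
  have L2 : Filter.Tendsto (fun n => ∫ x in Ω, w n x * -lapl z x) Filter.atTop
      (nhds (∫ x in Ω, z x * -lapl z x)) := by
    refine tendsto_integral_filter_of_norm_le_const (.of_forall fun n => ?_)
      ⟨M * L, .of_forall fun n => (ae_restrict_iff' hΩm).2 (.of_forall fun x hx => ?_)⟩
      ((ae_restrict_iff' hΩm).2 (.of_forall fun x hx => ?_))
    · exact ((hwc n).mul hlz.neg).aestronglyMeasurable
    · rw [norm_mul, norm_neg]
      exact mul_le_mul (bd n x hx) (hL x (subset_closure hx)) (norm_nonneg _)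
        ((abs_nonneg _).trans (bd n x hx))
    · exact (hlim x hx).mul_const _
  exact le_of_tendsto_of_tendsto' ((L1.rpow_const (.inr (by positivity))).const_mul _) L2 hw3

end Energy

section Slope

/-- Strict Hermite–Hadamard inequality for the concave power `t ^ σ`. -/
lemma mul_midpoint_rpow_lt {σ A B : ℝ} (hσ0 : 0 < σ) (hσ1 : σ < 1) (hB : 0 ≤ B) (hBA : B < A) :
    σ * (A - B) * ((A + B) / 2) ^ (σ - 1) < A ^ σ - B ^ σ := by
  set m := (A + B) / 2 with hm
  have hm0 : 0 < m := by rw [hm]; linarith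
  let F : ℝ → ℝ := fun t => (m + t) ^ σ - (m - t) ^ σ - 2 * σ * t * m ^ (σ - 1)
  have hcont : ContinuousOn F (Icc 0 m) := by
    refine Continuous.continuousOn ?_
    have h1 : Continuous fun t : ℝ => (m + t) ^ σ :=
      (continuous_const.add continuous_id).rpow_const fun _ => .inr hσ0.le
    have h2 : Continuous fun t : ℝ => (m - t) ^ σ :=
      (continuous_const.sub continuous_id).rpow_const fun _ => .inr hσ0.le
    exact (h1.sub h2).sub ((continuous_const.mul continuous_id).mul continuous_const)
  have hder : ∀ t ∈ interior (Icc 0 m), 0 < deriv F t := fun t ht => by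
    rw [interior_Icc] at ht
    have hp1 : 0 < m + t := by linarith [ht.1]
    have hp2 : 0 < m - t := by linarith [ht.2]
    have d1 : HasDerivAt (fun t : ℝ => (m + t) ^ σ) (σ * (m + t) ^ (σ - 1)) t := by
      have := ((hasDerivAt_id t).const_add m).rpow_const (p := σ) (.inl hp1.ne')
      simpa using this
    have d2 : HasDerivAt (fun t : ℝ => (m - t) ^ σ) (-(σ * (m - t) ^ (σ - 1))) t := by
      have := ((hasDerivAt_id t).const_sub m).rpow_const (p := σ) (.inl hp2.ne')
      simpa using this
    have d3 : HasDerivAt (fun t : ℝ => 2 * σ * t * m ^ (σ - 1)) (2 * σ * m ^ (σ - 1)) t := by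
      have := ((hasDerivAt_id t).const_mul (2 * σ)).mul_const (m ^ (σ - 1))
      simpa using this
    have hd : deriv F t = σ * (m + t) ^ (σ - 1) - -(σ * (m - t) ^ (σ - 1)) - 2 * σ * m ^ (σ - 1) :=
      ((d1.sub d2).sub d3).deriv
    rw [hd]
    set q := (σ - 1) / 2 with hq
    have hq0 : q < 0 := by rw [hq]; linarith
    have e1 : (m + t) ^ (σ - 1) = ((m + t) ^ q) ^ 2 := by
      rw [← Real.rpow_natCast, ← Real.rpow_mul hp1.le]; congr 1; rw [hq]; push_cast; ring
    have e2 : (m - t) ^ (σ - 1) = ((m - t) ^ q) ^ 2 := by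
      rw [← Real.rpow_natCast, ← Real.rpow_mul hp2.le]; congr 1; rw [hq]; push_cast; ring
    have e3 : m ^ (σ - 1) = (m * m) ^ q := by
      rw [Real.mul_rpow hm0.le hm0.le, ← Real.rpow_add hm0]; congr 1; rw [hq]; ring
    have h3 : (m * m) ^ q < ((m + t) * (m - t)) ^ q :=
      Real.rpow_lt_rpow_of_neg (by positivity) (by nlinarith [ht.1]) hq0
    rw [Real.mul_rpow hp1.le hp2.le] at h3
    rw [e1, e2, e3]
    nlinarith [sq_nonneg ((m + t) ^ q - (m - t) ^ q)]
  have hmono := strictMonoOn_of_deriv_pos (convex_Icc 0 m) hcont hder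
  have h := hmono (left_mem_Icc.2 hm0.le) (b := (A - B) / 2) ⟨by linarith, by rw [hm]; linarith⟩
    (by linarith)
  have h1 : F 0 = 0 := by simp [F]
  have h2 : F ((A - B) / 2) = A ^ σ - B ^ σ - σ * (A - B) * m ^ (σ - 1) := by
    simp only [F]
    have e1 : m + (A - B) / 2 = A := by rw [hm]; ring
    have e2 : m - (A - B) / 2 = B := by rw [hm]; ring
    rw [e1, e2]; ring
  rw [h1, h2] at h
  linarith

/-- The nonlinearity `u ↦ u₊ ^ p`. -/
def pospow (p u : ℝ) : ℝ := max u 0 ^ p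

lemma pospow_nonneg (p u : ℝ) : 0 ≤ pospow p u := Real.rpow_nonneg (le_max_right _ _) _

lemma continuous_pospow {p : ℝ} (hp : 0 ≤ p) : Continuous (pospow p) :=
  (continuous_id.max continuous_const).rpow_const fun _ => .inr hp

lemma pospow_mono {p : ℝ} (hp : 0 ≤ p) : Monotone (pospow p) := fun _ _ h =>
  Real.rpow_le_rpow (le_max_right _ _) (max_le_max h le_rfl) hp

/-- The difference quotient of `pospow p`. -/
def pslope (p u v : ℝ) : ℝ := (pospow p u - pospow p v) / (u - v)

/-- The upper bound for `pslope p`. -/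
def pweight (p u v : ℝ) : ℝ := p * ((pospow p u + pospow p v) / 2) ^ (1 - 1 / p)

lemma pslope_comm (p u v : ℝ) : pslope p u v = pslope p v u := by
  rw [pslope, pslope, ← neg_sub, ← neg_sub v u, neg_div_neg_eq]

lemma pweight_comm (p u v : ℝ) : pweight p u v = pweight p v u := by
  rw [pweight, pweight, add_comm]

lemma pweight_nonneg {p : ℝ} (hp : 0 ≤ p) (u v : ℝ) : 0 ≤ pweight p u v :=
  mul_nonneg hp (Real.rpow_nonneg (by
    have := pospow_nonneg p u
    have := pospow_nonneg p v
    linarith) _)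

lemma pslope_mul {p u v : ℝ} : pslope p u v * (u - v) = pospow p u - pospow p v := by
  rcases eq_or_ne u v with rfl | h
  · simp
  · rw [pslope, div_mul_cancel₀ _ (sub_ne_zero.2 h)]

lemma pslope_lt {p : ℝ} (hp : 1 < p) {u v : ℝ} (h : pospow p u ≠ pospow p v) :
    pslope p u v < pweight p u v := by
  wlog hlt : v < u generalizing u v
  · rw [pslope_comm, pweight_comm]
    refine this h.symm (lt_of_le_of_ne (not_lt.1 hlt) ?_)
    rintro rfl
    exact h rfl
  have hp0 : 0 < p := by linarith
  have hlt' : pospow p v < pospow p u := lt_of_le_of_ne (pospow_mono hp0.le hlt.le) h.symm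
  have hab : max v 0 < max u 0 := by
    by_contra hcon
    exact absurd (Real.rpow_le_rpow (le_max_right u 0) (not_lt.1 hcon) hp0.le) (not_le.2 hlt')
  have hmm : max u 0 - max v 0 ≤ u - v := by
    have hu : 0 < u := by
      by_contra hcon
      rw [max_eq_right (not_lt.1 hcon)] at hab
      exact absurd hab (not_lt.2 (le_max_right _ _))
    rw [max_eq_left hu.le]
    linarith [le_max_left v 0]
  have key := mul_midpoint_rpow_lt (σ := 1 / p) (by positivity) (by rw [div_lt_one hp0]; exact hp)
    (pospow_nonneg p v) hlt'
  have hpow : ∀ x, pospow p x ^ (1 / p) = max x 0 := fun x => by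
    rw [pospow, ← Real.rpow_mul (le_max_right _ _), mul_one_div_cancel hp0.ne', Real.rpow_one]
  rw [hpow, hpow] at key
  have hv := pospow_nonneg p v
  have hm0 : 0 < (pospow p u + pospow p v) / 2 := by linarith
  rw [pslope, pweight, div_lt_iff₀ (by linarith)]
  set m := (pospow p u + pospow p v) / 2
  have hmk : m ^ (1 / p - 1) * m ^ (1 - 1 / p) = 1 := by
    rw [← Real.rpow_add hm0]; simp
  have hk : 0 < m ^ (1 - 1 / p) := Real.rpow_pos_of_pos hm0 _
  have h1 := mul_lt_mul_of_pos_right (key.trans_le hmm) (mul_pos hp0 hk)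
  have h2 : 1 / p * (pospow p u - pospow p v) * m ^ (1 / p - 1) * (p * m ^ (1 - 1 / p)) =
      (p * (1 / p)) * (pospow p u - pospow p v) * (m ^ (1 / p - 1) * m ^ (1 - 1 / p)) := by ring
  rw [h2, hmk, mul_one_div_cancel hp0.ne'] at h1
  linarith

lemma pslope_le {p : ℝ} (hp : 1 < p) (u v : ℝ) : pslope p u v ≤ pweight p u v := by
  by_cases h : pospow p u = pospow p v
  · rw [pslope, h, sub_self, zero_div]
    exact pweight_nonneg (by linarith) _ _
  · exact (pslope_lt hp h).le

lemma pslope_nonneg {p : ℝ} (hp : 0 ≤ p) (u v : ℝ) : 0 ≤ pslope p u v := by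
  rcases le_total u v with h | h
  · exact div_nonneg_of_nonpos (sub_nonpos.2 (pospow_mono hp h)) (sub_nonpos.2 h)
  · exact div_nonneg (sub_nonneg.2 (pospow_mono hp h)) (sub_nonneg.2 h)

end Slope

section EssBdd

variable {X : Type*} [MeasurableSpace X] {μ : Measure X}

/-- Essentially bounded real functions. -/
structure EB (μ : Measure X) (f : X → ℝ) : Prop where
  meas : AEStronglyMeasurable f μ
  bdd : ∃ M, ∀ᵐ x ∂μ, |f x| ≤ M

lemma EB.comp {f : X → ℝ} (hf : EB μ f) {g : ℝ → ℝ} (hg : Continuous g) :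
    EB μ fun x => g (f x) := by
  obtain ⟨M, hM⟩ := hf.bdd
  obtain ⟨K, hK⟩ := (isCompact_Icc (a := -M) (b := M)).exists_bound_of_continuousOn hg.continuousOn
  exact ⟨hg.comp_aestronglyMeasurable hf.meas, K, hM.mono fun x hx => hK _ (abs_le.1 hx)⟩

lemma EB.of_le {f g : X → ℝ} (hg : EB μ g) (hf : AEStronglyMeasurable f μ)
    (h : ∀ x, |f x| ≤ g x) : EB μ f := by
  obtain ⟨M, hM⟩ := hg.bdd
  exact ⟨hf, M, hM.mono fun x hx => (h x).trans ((le_abs_self _).trans hx)⟩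

lemma EB.add {f g : X → ℝ} (hf : EB μ f) (hg : EB μ g) : EB μ fun x => f x + g x := by
  obtain ⟨M, hM⟩ := hf.bdd
  obtain ⟨K, hK⟩ := hg.bdd
  refine ⟨hf.meas.add hg.meas, M + K, ?_⟩
  filter_upwards [hM, hK] with x h1 h2
  exact (abs_add_le _ _).trans (add_le_add h1 h2)

lemma EB.mul {f g : X → ℝ} (hf : EB μ f) (hg : EB μ g) : EB μ fun x => f x * g x := by
  obtain ⟨M, hM⟩ := hf.bdd
  obtain ⟨K, hK⟩ := hg.bdd
  refine ⟨hf.meas.mul hg.meas, M * K, ?_⟩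
  filter_upwards [hM, hK] with x h1 h2
  rw [abs_mul]
  exact mul_le_mul h1 h2 (abs_nonneg _) ((abs_nonneg _).trans h1)

lemma EB.sub {f g : X → ℝ} (hf : EB μ f) (hg : EB μ g) : EB μ fun x => f x - g x := by
  simpa [sub_eq_add_neg] using hf.add (hg.comp continuous_neg)

lemma EB.integrable [IsFiniteMeasure μ] {f : X → ℝ} (hf : EB μ f) : Integrable f μ := by
  obtain ⟨M, hM⟩ := hf.bdd
  exact Integrable.of_bound hf.meas M hM

lemma EB.memLp [IsFiniteMeasure μ] {f : X → ℝ} (hf : EB μ f) (q : ENNReal) : MemLp f q μ := by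
  obtain ⟨M, hM⟩ := hf.bdd
  exact MemLp.of_bound hf.meas M hM

lemma EB.abs_rpow {f : X → ℝ} (hf : EB μ f) {t : ℝ} (ht : 0 ≤ t) : EB μ fun x => |f x| ^ t :=
  hf.comp (g := fun s => |s| ^ t) (continuous_abs.rpow_const fun _ => .inr ht)

/-- Weighted Cauchy–Schwarz inequality. -/
lemma sq_integral_mul_le [IsFiniteMeasure μ] {c f g : X → ℝ} (hc : EB μ c) (hc0 : ∀ x, 0 ≤ c x)
    (hf : EB μ f) (hg : EB μ g) :
    (∫ x, c x * f x * g x ∂μ) ^ 2 ≤ (∫ x, c x * f x ^ 2 ∂μ) * ∫ x, c x * g x ^ 2 ∂μ := by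
  have i1 := (hc.mul (hf.comp (continuous_pow 2))).integrable
  have i2 := ((hc.mul hf).mul hg).integrable
  have i3 := (hc.mul (hg.comp (continuous_pow 2))).integrable
  have i4 (t : ℝ) : Integrable (fun x => c x * g x ^ 2 * (t * t) + 2 * (c x * f x * g x) * t) μ :=
    (i3.mul_const _).add ((i2.const_mul 2).mul_const _)
  have h : ∀ t : ℝ, 0 ≤ (∫ x, c x * g x ^ 2 ∂μ) * (t * t) + (2 * ∫ x, c x * f x * g x ∂μ) * t +
      ∫ x, c x * f x ^ 2 ∂μ := fun t => by
    have e : ∫ x, c x * (f x + t * g x) ^ 2 ∂μ = (∫ x, c x * g x ^ 2 ∂μ) * (t * t) +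
        (2 * ∫ x, c x * f x * g x ∂μ) * t + ∫ x, c x * f x ^ 2 ∂μ := by
      rw [← integral_const_mul, ← integral_mul_const, ← integral_mul_const,
        ← integral_add (i3.mul_const _) ((i2.const_mul 2).mul_const _),
        ← integral_add (i4 t) i1]
      exact integral_congr_ae (.of_forall fun x => by ring)
    rw [← e]
    exact integral_nonneg fun x => mul_nonneg (hc0 x) (sq_nonneg _)
  have := discrim_le_zero h
  rw [discrim] at this
  nlinarith

/-- The square of the norm of `f` with exponent `2 * p`. -/
def nrmsq (μ : Measure X) (p : ℝ) (f : X → ℝ) : ℝ := (∫ x, |f x| ^ (2 * p) ∂μ) ^ (2 / (2 * p))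

lemma nrmsq_nonneg (p : ℝ) (f : X → ℝ) : 0 ≤ nrmsq μ p f :=
  Real.rpow_nonneg (integral_nonneg fun _ => by positivity) _

lemma nrmsq_const_mul {p : ℝ} (hp : 0 < p) (a : ℝ) (f : X → ℝ) :
    nrmsq μ p (fun x => a * f x) = a ^ 2 * nrmsq μ p f := by
  rw [nrmsq, nrmsq]
  simp_rw [abs_mul, Real.mul_rpow (abs_nonneg a) (abs_nonneg _)]
  rw [integral_const_mul, Real.mul_rpow (by positivity) (integral_nonneg fun _ => by positivity),
    ← Real.rpow_mul (abs_nonneg a), show 2 * p * (2 / (2 * p)) = 2 by field_simp]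
  simp

lemma integral_pweight_mul_sq_le [IsProbabilityMeasure μ] {p : ℝ} (hp : 1 < p) {u v g : X → ℝ}
    (hu : EB μ u) (hv : EB μ v) (hg : EB μ g) (h1 : ∫ x, pospow p (u x) ∂μ = 1)
    (h2 : ∫ x, pospow p (v x) ∂μ = 1) :
    ∫ x, pweight p (u x) (v x) * g x ^ 2 ∂μ ≤ p * nrmsq μ p g := by
  have hp0 : 0 < p := by linarith
  have hpu := hu.comp (continuous_pospow hp0.le)
  have hpv := hv.comp (continuous_pospow hp0.le)
  set m : X → ℝ := fun x => (pospow p (u x) + pospow p (v x)) / 2 with hm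
  have hm0 : ∀ x, 0 ≤ m x := fun x => by
    have := pospow_nonneg p (u x)
    have := pospow_nonneg p (v x)
    simp only [hm]; linarith
  have hmE : EB μ m := (hpu.add hpv).comp (continuous_id.div_const 2)
  have hm1 : ∫ x, m x ∂μ = 1 := by
    simp only [hm]
    rw [integral_div, integral_add hpu.integrable hpv.integrable, h1, h2]; norm_num
  have hq0 : 0 < 1 - 1 / p := by
    have : 1 / p < 1 := by rw [div_lt_one hp0]; exact hp
    linarith
  have hmr : EB μ fun x => m x ^ (1 - 1 / p) :=
    hmE.comp (g := fun s => s ^ (1 - 1 / p)) (continuous_id.rpow_const fun _ => .inr hq0.le)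
  have hpq : (1 / (1 - 1 / p)).HolderConjugate p := by
    have : (1 - 1 / p)⁻¹⁻¹ + p⁻¹ = 1 := by rw [inv_inv, one_div]; ring
    rw [one_div]
    exact Real.holderConjugate_iff.2 ⟨(one_lt_inv₀ hq0).2 (by
      have : 0 < 1 / p := by positivity
      linarith), this⟩
  have H := integral_mul_le_Lp_mul_Lq_of_nonneg hpq (μ := μ) (f := fun x => m x ^ (1 - 1 / p))
    (g := fun x => g x ^ 2) (.of_forall fun x => Real.rpow_nonneg (hm0 x) _)
    (.of_forall fun x => sq_nonneg _) (hmr.memLp _) ((hg.comp (continuous_pow 2)).memLp _)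
  have e1 : ∀ x, (m x ^ (1 - 1 / p)) ^ (1 / (1 - 1 / p)) = m x := fun x => by
    rw [← Real.rpow_mul (hm0 x), mul_one_div_cancel hq0.ne', Real.rpow_one]
  have e2 : ∀ x, (g x ^ 2) ^ p = |g x| ^ (2 * p) := fun x => by
    rw [← sq_abs, ← Real.rpow_natCast, ← Real.rpow_mul (abs_nonneg _)]; norm_num
  simp_rw [e1, e2] at H
  rw [hm1, Real.one_rpow, one_mul] at H
  have e3 : ∀ x, pweight p (u x) (v x) * g x ^ 2 = p * (m x ^ (1 - 1 / p) * g x ^ 2) := fun x => by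
    rw [pweight, mul_assoc]
  simp_rw [e3]
  rw [integral_const_mul, nrmsq, show 2 / (2 * p) = 1 / p by field_simp]
  exact mul_le_mul_of_nonneg_left H hp0.le

lemma EB.pweight {p : ℝ} (hp : 1 < p) {u v : X → ℝ} (hu : EB μ u) (hv : EB μ v) :
    EB μ fun x => pweight p (u x) (v x) := by
  have hp0 : 0 < p := by linarith
  have hq0 : 0 ≤ 1 - 1 / p := by
    have : 1 / p < 1 := by rw [div_lt_one hp0]; exact hp
    linarith
  exact ((hu.comp (continuous_pospow hp0.le)).add (hv.comp (continuous_pospow hp0.le))).comp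
    (g := fun s => p * (s / 2) ^ (1 - 1 / p))
    (continuous_const.mul ((continuous_id.div_const 2).rpow_const fun _ => .inr hq0))

lemma EB.pslope {p : ℝ} (hp : 1 < p) {u v : X → ℝ} (hu : EB μ u) (hv : EB μ v) :
    EB μ fun x => pslope p (u x) (v x) := by
  have hp0 : 0 < p := by linarith
  refine (hu.pweight hp hv).of_le ?_ fun x => ?_
  · exact (((hu.comp (continuous_pospow hp0.le)).sub
      (hv.comp (continuous_pospow hp0.le))).meas.aemeasurable.div
        (hu.sub hv).meas.aemeasurable).aestronglyMeasurable
  · rw [abs_of_nonneg (pslope_nonneg hp0.le _ _)]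
    exact pslope_le hp _ _

variable [IsProbabilityMeasure μ] {p : ℝ} {u v w : X → ℝ} {δ : ℝ}

lemma integral_pslope_mul_sq_le (hp : 1 < p) (hu : EB μ u) (hv : EB μ v)
    (h1 : ∫ x, pospow p (u x) ∂μ = 1) (h2 : ∫ x, pospow p (v x) ∂μ = 1) {g : X → ℝ}
    (hg : EB μ g) : ∫ x, pslope p (u x) (v x) * g x ^ 2 ∂μ ≤ p * nrmsq μ p g :=
  (integral_mono ((hu.pslope hp hv).mul (hg.comp (continuous_pow 2))).integrable
    ((hu.pweight hp hv).mul (hg.comp (continuous_pow 2))).integrable fun _ =>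
      mul_le_mul_of_nonneg_right (pslope_le hp _ _) (sq_nonneg _)).trans
    (integral_pweight_mul_sq_le hp hu hv hg h1 h2)

lemma integral_pslope_variance (hp : 1 < p) (hu : EB μ u) (hv : EB μ v)
    (h1 : ∫ x, pospow p (u x) ∂μ = 1) (h2 : ∫ x, pospow p (v x) ∂μ = 1)
    (huv : ∀ x, u x - v x = w x + δ) :
    (∫ x, (pospow p (u x) - pospow p (v x)) * w x ∂μ =
      ∫ x, pslope p (u x) (v x) * (u x - v x) ^ 2 ∂μ) ∧
    (∫ x, pslope p (u x) (v x) * (u x - v x) ^ 2 ∂μ) + δ ^ 2 * ∫ x, pslope p (u x) (v x) ∂μ =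
      ∫ x, pslope p (u x) (v x) * w x ^ 2 ∂μ := by
  have hp0 : 0 < p := by linarith
  have hpu := hu.comp (continuous_pospow hp0.le)
  have hpv := hv.comp (continuous_pospow hp0.le)
  have hc := hu.pslope hp hv
  have hd := hu.sub hv
  have h0 : ∫ x, pslope p (u x) (v x) * (u x - v x) ∂μ = 0 := by
    simp_rw [pslope_mul]
    rw [integral_sub hpu.integrable hpv.integrable, h1, h2, sub_self]
  have i1 := (hc.mul (hd.comp (continuous_pow 2))).integrable
  have i2 := (hc.mul hd).integrable
  have i3 := hc.integrable
  have i4 : Integrable (fun x => pslope p (u x) (v x) * (u x - v x) ^ 2 -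
      2 * δ * (pslope p (u x) (v x) * (u x - v x))) μ := i1.sub (i2.const_mul _)
  constructor
  · have : ∀ x, (pospow p (u x) - pospow p (v x)) * w x =
        pslope p (u x) (v x) * (u x - v x) ^ 2 - δ * (pslope p (u x) (v x) * (u x - v x)) :=
      fun x => by
        rw [← pslope_mul, eq_sub_of_add_eq (huv x).symm]; ring
    simp_rw [this]
    rw [integral_sub i1 (i2.const_mul δ), integral_const_mul, h0, mul_zero, sub_zero]
  · have : ∀ x, pslope p (u x) (v x) * w x ^ 2 = pslope p (u x) (v x) * (u x - v x) ^ 2 -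
        2 * δ * (pslope p (u x) (v x) * (u x - v x)) + δ ^ 2 * pslope p (u x) (v x) := fun x => by
      rw [eq_sub_of_add_eq (huv x).symm]; ring
    simp_rw [this]
    rw [integral_add i4 (i3.const_mul _), integral_sub i1 (i2.const_mul _),
      integral_const_mul, integral_const_mul, h0, mul_zero, sub_zero]

lemma sq_integral_pospow_sub_mul_le (hp : 1 < p) (hu : EB μ u) (hv : EB μ v)
    (h1 : ∫ x, pospow p (u x) ∂μ = 1) (h2 : ∫ x, pospow p (v x) ∂μ = 1)
    (hw : EB μ w) (huv : ∀ x, u x - v x = w x + δ) {z : X → ℝ} (hz : EB μ z) :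
    (∫ x, (pospow p (u x) - pospow p (v x)) * z x ∂μ) ^ 2 ≤
      p ^ 2 * (nrmsq μ p w * nrmsq μ p z) := by
  have hp0 : 0 < p := by linarith
  obtain ⟨-, hvar⟩ := integral_pslope_variance hp hu hv h1 h2 huv
  have hc := hu.pslope hp hv
  have hc0 : ∀ x, 0 ≤ pslope p (u x) (v x) := fun x => pslope_nonneg hp0.le _ _
  have cs := sq_integral_mul_le hc hc0 (hu.sub hv) hz
  simp_rw [pslope_mul] at cs
  have a1 := integral_pslope_mul_sq_le hp hu hv h1 h2 hw
  have a2 := integral_pslope_mul_sq_le hp hu hv h1 h2 hz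
  have a3 : 0 ≤ δ ^ 2 * ∫ x, pslope p (u x) (v x) ∂μ :=
    mul_nonneg (sq_nonneg _) (integral_nonneg hc0)
  have a4 : 0 ≤ ∫ x, pslope p (u x) (v x) * z x ^ 2 ∂μ :=
    integral_nonneg fun x => mul_nonneg (hc0 x) (sq_nonneg _)
  refine cs.trans ((mul_le_mul (by linarith) a2 a4
    (mul_nonneg hp0.le (nrmsq_nonneg (μ := μ) p w))).trans (le_of_eq (by ring)))

lemma pospow_ae_eq (hp : 1 < p) (hu : EB μ u) (hv : EB μ v)
    (h1 : ∫ x, pospow p (u x) ∂μ = 1) (h2 : ∫ x, pospow p (v x) ∂μ = 1)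
    (hw : EB μ w) (huv : ∀ x, u x - v x = w x + δ)
    (hle : p * nrmsq μ p w ≤ ∫ x, (pospow p (u x) - pospow p (v x)) * w x ∂μ) :
    ∀ᵐ x ∂μ, pospow p (u x) = pospow p (v x) := by
  have hp0 : 0 < p := by linarith
  obtain ⟨hv1, hvar⟩ := integral_pslope_variance hp hu hv h1 h2 huv
  have hc := hu.pslope hp hv
  have hk := hu.pweight hp hv
  have hw2 := hw.comp (continuous_pow 2)
  have hc0 : ∀ x, 0 ≤ pslope p (u x) (v x) := fun x => pslope_nonneg hp0.le _ _
  have a0 := integral_pweight_mul_sq_le hp hu hv hw h1 h2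
  have a1 : ∫ x, pslope p (u x) (v x) * w x ^ 2 ∂μ ≤ ∫ x, pweight p (u x) (v x) * w x ^ 2 ∂μ :=
    integral_mono (hc.mul hw2).integrable (hk.mul hw2).integrable fun x =>
      mul_le_mul_of_nonneg_right (pslope_le hp _ _) (sq_nonneg _)
  have a2 : 0 ≤ ∫ x, pslope p (u x) (v x) ∂μ := integral_nonneg hc0
  have a3 : 0 ≤ δ ^ 2 * ∫ x, pslope p (u x) (v x) ∂μ := mul_nonneg (sq_nonneg _) a2
  rw [hv1] at hle
  rcases eq_or_ne δ 0 with hδ | hδ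
  · have hz : ∫ x, (pweight p (u x) (v x) - pslope p (u x) (v x)) * w x ^ 2 ∂μ = 0 := by
      simp_rw [sub_mul]
      rw [integral_sub (hk.mul hw2).integrable (hc.mul hw2).integrable]
      linarith
    have := (integral_eq_zero_iff_of_nonneg (fun x => mul_nonneg (sub_nonneg.2 (pslope_le hp _ _))
      (sq_nonneg (w x))) ((hk.sub hc).mul hw2).integrable).1 hz
    filter_upwards [this] with x hx
    by_contra hne
    have hlt := pslope_lt hp hne
    rcases mul_eq_zero.1 hx with h | h
    · linarith
    · have hw0 : w x = 0 := by simpa using h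
      have huvx := huv x
      rw [hw0, hδ, add_zero, sub_eq_zero] at huvx
      exact hne (by rw [huvx])
  · have hz : ∫ x, pslope p (u x) (v x) ∂μ = 0 := by
      have : δ ^ 2 * ∫ x, pslope p (u x) (v x) ∂μ = 0 := by linarith
      exact (mul_eq_zero.1 this).resolve_left (pow_ne_zero 2 hδ)
    have := (integral_eq_zero_iff_of_nonneg hc0 hc.integrable).1 hz
    filter_upwards [this] with x hx
    have hx' : pslope p (u x) (v x) = 0 := hx
    have e := pslope_mul (p := p) (u := u x) (v := v x)
    rw [hx', zero_mul] at e
    linarith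

end EssBdd

section Uniqueness

variable {N : ℕ} {Ω : Set (Eu N)}

lemma eb_restrict (hb : Bornology.IsBounded Ω) (hΩ : MeasurableSet Ω) {f : Eu N → ℝ}
    (hf : Continuous f) : EB (volume.restrict Ω) f := by
  obtain ⟨M, hM⟩ := hb.isCompact_closure.exists_bound_of_continuousOn hf.continuousOn
  exact ⟨hf.aestronglyMeasurable, M, (ae_restrict_iff' hΩ).2 (.of_forall fun x hx =>
    hM x (subset_closure hx))⟩

lemma isProbabilityMeasure_restrict (hvol : volume Ω = 1) :
    IsProbabilityMeasure (volume.restrict Ω) := ⟨by simpa using hvol⟩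

lemma mul_nrmsq_le (hΩ : IsOpen Ω) (hb : Bornology.IsBounded Ω) {p L : ℝ} (hp : 0 < p)
    (hL : L ≤ Lam Ω (2 * p)) {z g : Eu N → ℝ} (hz : ContDiff ℝ 2 z)
    (h0 : ∀ x ∈ frontier Ω, z x = 0) (hg : ∀ x ∈ Ω, -lapl z x = g x) :
    L * nrmsq (volume.restrict Ω) p z ≤ ∫ x in Ω, g x * z x := by
  refine (mul_le_mul_of_nonneg_right hL (nrmsq_nonneg _ _)).trans
    ((energy_le hΩ hb (by linarith) hz h0).trans (le_of_eq ?_))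
  exact setIntegral_congr_fun hΩ.measurableSet fun x hx => by
    rw [hg x hx, mul_comm]

lemma eqOn_of_ae_restrict (hΩ : IsOpen Ω) {f g : Eu N → ℝ} (hf : Continuous f) (hg : Continuous g)
    (h : ∀ᵐ x ∂volume.restrict Ω, f x = g x) : ∀ x ∈ Ω, f x = g x :=
  Measure.eqOn_open_of_ae_eq h hΩ hf.continuousOn hg.continuousOn

theorem IsSol.unique (hN : 0 < N) (hΩ : IsOpen Ω) (hb : Bornology.IsBounded Ω)
    (hvol : volume Ω = 1) {p lam : ℝ} (hp : 1 < p) (hlam : 0 ≤ lam)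
    (hle : lam * p ≤ Lam Ω (2 * p)) {α₁ α₂ : ℝ} {ψ₁ ψ₂ : Eu N → ℝ} (h₁ : IsSol Ω p lam α₁ ψ₁)
    (h₂ : IsSol Ω p lam α₂ ψ₂) : α₁ = α₂ ∧ ∀ x ∈ closure Ω, ψ₁ x = ψ₂ x := by
  have hp0 : 0 < p := by linarith
  have := isProbabilityMeasure_restrict hvol
  obtain ⟨r1, e1, b1, i1⟩ := h₁
  obtain ⟨r2, e2, b2, i2⟩ := h₂
  set U : Eu N → ℝ := fun x => α₁ + lam * ψ₁ x with hU
  set V : Eu N → ℝ := fun x => α₂ + lam * ψ₂ x with hV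
  have cU : Continuous U := by have := r1.continuous; fun_prop
  have cV : Continuous V := by have := r2.continuous; fun_prop
  have hz : ContDiff ℝ 2 fun x => ψ₁ x - ψ₂ x := r1.sub r2
  have hz0 : ∀ x ∈ frontier Ω, ψ₁ x - ψ₂ x = 0 := fun x hx => by rw [b1 x hx, b2 x hx, sub_zero]
  have hzl : ∀ x ∈ Ω, -lapl (fun x => ψ₁ x - ψ₂ x) x = pospow p (U x) - pospow p (V x) :=
    fun x hx => by
      rw [lapl_sub r1 r2]
      have := e1 x hx
      have := e2 x hx
      simp only [pospow, hU, hV]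
      linarith
  have hE := mul_nrmsq_le hΩ hb hp0 hle hz hz0 hzl
  have hae := pospow_ae_eq (μ := volume.restrict Ω) (p := p) (u := U) (v := V)
    (w := fun x => lam * (ψ₁ x - ψ₂ x)) (δ := α₁ - α₂) hp (eb_restrict hb hΩ.measurableSet cU)
    (eb_restrict hb hΩ.measurableSet cV) i1 i2
    (eb_restrict hb hΩ.measurableSet (continuous_const.mul hz.continuous))
    (fun x => by simp only [hU, hV]; ring) (by
      rw [nrmsq_const_mul hp0]
      have : ∀ x, (pospow p (U x) - pospow p (V x)) * (lam * (ψ₁ x - ψ₂ x)) =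
        lam * ((pospow p (U x) - pospow p (V x)) * (ψ₁ x - ψ₂ x)) := fun x => by ring
      simp_rw [this]
      rw [integral_const_mul]
      have := mul_le_mul_of_nonneg_left hE hlam
      linarith)
  have heq := eqOn_of_ae_restrict hΩ ((continuous_pospow hp0.le).comp cU)
    ((continuous_pospow hp0.le).comp cV) hae
  have hψ : ∀ x ∈ closure Ω, ψ₁ x - ψ₂ x = 0 :=
    eq_zero_of_max_principle hN hΩ hb hz le_rfl (fun x hx => by
      have := heq x hx
      simp only [Function.comp_apply] at this
      rw [hzl x hx, this]; ring) hz0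
  refine ⟨?_, fun x hx => sub_eq_zero.1 (hψ x hx)⟩
  obtain ⟨x, hx, hpos⟩ : ∃ x ∈ Ω, 0 < pospow p (U x) := by
    by_contra! hc
    have : ∫ x in Ω, pospow p (U x) = 0 :=
      setIntegral_eq_zero_of_forall_eq_zero fun x hx => le_antisymm (hc x hx) (pospow_nonneg _ _)
    rw [show ∫ x in Ω, pospow p (U x) = 1 from i1] at this
    norm_num at this
  have h := heq x hx
  simp only [Function.comp_apply] at h
  have e := hψ x (subset_closure hx)
  have hU0 : 0 < U x := by
    by_contra! hc
    rw [pospow, max_eq_right hc, Real.zero_rpow hp0.ne'] at hpos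
    exact lt_irrefl _ hpos
  have hV0 : 0 < V x := by
    by_contra! hc
    rw [h, pospow, max_eq_right hc, Real.zero_rpow hp0.ne'] at hpos
    exact lt_irrefl _ hpos
  rw [pospow, pospow, max_eq_left hU0.le, max_eq_left hV0.le] at h
  have h' := (Real.rpow_left_inj hU0.le hV0.le hp0.ne').1 h
  simp only [hU, hV, sub_eq_zero.1 e] at h'
  linarith

end Uniqueness

section Step

lemma exists_interp_exponent {N : ℕ} (hN : 2 ≤ N) {p : ℝ} (hp : 1 < p)
    (hpN : N = 2 ∨ p < (N : ℝ) / ((N : ℝ) - 2)) :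
    ∃ θ : ℝ, 0 < θ ∧ θ < 1 ∧ N * (1 - θ) < 2 ∧ p * θ < 1 := by
  have hNR : (2 : ℝ) ≤ N := by exact_mod_cast hN
  have hp0 : 0 < p := by linarith
  have h0 : 0 ≤ 1 - 2 / (N : ℝ) := by
    rw [sub_nonneg, div_le_one (by linarith)]; exact hNR
  have h1 : 1 - 2 / (N : ℝ) < 1 / p := by
    rcases hpN with rfl | h
    · norm_num; exact hp0
    · rcases hNR.eq_or_lt with h2 | h2
      · rw [← h2]; norm_num; exact hp0
      · rw [lt_div_iff₀ (by linarith)] at h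
        rw [lt_div_iff₀ hp0, sub_mul, one_mul, sub_lt_iff_lt_add, div_mul_eq_mul_div,
          ← sub_lt_iff_lt_add', lt_div_iff₀ (by linarith)]
        linarith
  obtain ⟨θ, hθ1, hθ2⟩ := exists_between h1
  have h3 : p * θ < 1 := by rwa [lt_div_iff₀ hp0, mul_comm] at hθ2
  refine ⟨θ, by linarith, ?_, ?_, h3⟩
  · by_contra! hc
    nlinarith
  · have : (N : ℝ) * (1 - 2 / N) = N - 2 := by field_simp
    have := mul_lt_mul_of_pos_left hθ1 (by linarith : (0 : ℝ) < N)
    linarith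

/-- A sublinear power growth has an invariant interval. -/
lemma exists_sublinear_bound {q A K l : ℝ} (hq : q < 1) (hA : 0 ≤ A) (hK : 0 ≤ K) (hl : 0 ≤ l) :
    ∃ M, 0 ≤ M ∧ A + K * (1 + l * M) ^ q ≤ M := by
  rcases hl.eq_or_lt with rfl | hl
  · exact ⟨A + K, by positivity, by simp⟩
  have ht : Filter.Tendsto (fun x : ℝ => K * l * x ^ (q - 1) + (1 + l * A) * x⁻¹) Filter.atTop
      (nhds (K * l * 0 + (1 + l * A) * 0)) := by
    refine (Filter.Tendsto.const_mul _ ?_).add (tendsto_inv_atTop_zero.const_mul _)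
    simpa using tendsto_rpow_neg_atTop (y := 1 - q) (by linarith)
  rw [mul_zero, mul_zero, add_zero] at ht
  obtain ⟨x, hx, hx1⟩ := ((ht.eventually_lt_const one_pos).and
    (Filter.eventually_ge_atTop 1)).exists
  have hx0 : 0 < x := by linarith
  refine ⟨(x - 1) / l, div_nonneg (by linarith) hl.le, ?_⟩
  have e : 1 + l * ((x - 1) / l) = x := by field_simp; ring
  rw [e, le_div_iff₀ hl]
  have h1 : x ^ (q - 1) * x = x ^ q := by
    rw [← Real.rpow_add_one hx0.ne', sub_add_cancel]
  have := mul_lt_mul_of_pos_right hx hx0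
  have h2 : (K * l * x ^ (q - 1) + (1 + l * A) * x⁻¹) * x = K * l * (x ^ (q - 1) * x) + (1 + l * A) := by
    field_simp
  rw [h2, h1] at this
  linarith

lemma pospow_sub_le {p T a b : ℝ} (hp : 1 < p) (hT : 0 ≤ T) (ha : a ≤ T) (hb : b ≤ T) :
    |pospow p a - pospow p b| ≤ p * (T ^ p) ^ (1 - 1 / p) * |a - b| := by
  have hp0 : 0 < p := by linarith
  have hq : 0 ≤ 1 - 1 / p := by
    have : 1 / p < 1 := by rw [div_lt_one hp0]; exact hp
    linarith
  have hle : ∀ s ≤ T, pospow p s ≤ T ^ p := fun s hs =>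
    Real.rpow_le_rpow (le_max_right _ _) (max_le hs hT) hp0.le
  have h1 := pospow_nonneg p a
  have h2 := pospow_nonneg p b
  rw [← pslope_mul, abs_mul, abs_of_nonneg (pslope_nonneg hp0.le _ _)]
  refine mul_le_mul_of_nonneg_right ((pslope_le hp _ _).trans ?_) (abs_nonneg _)
  rw [pweight]
  exact mul_le_mul_of_nonneg_left (Real.rpow_le_rpow (by linarith)
    (by linarith [hle a ha, hle b hb]) hq) hp0.le

variable {N : ℕ} {Ω : Set (Eu N)}

lemma exists_multiplier (hb : Bornology.IsBounded Ω) (hΩ : MeasurableSet Ω) (hvol : volume Ω = 1)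
    {p lam M : ℝ} (hp : 0 < p) (hlam : 0 ≤ lam) {ψ : Eu N → ℝ} (hc : Continuous ψ)
    (h0 : ∀ x, 0 ≤ ψ x) (hM : ∀ x, ψ x ≤ M) :
    ∃ α, -(lam * M) ≤ α ∧ α ≤ 1 ∧ ∫ x in Ω, pospow p (α + lam * ψ x) = 1 := by
  have := isProbabilityMeasure_restrict hvol
  have hM0 : 0 ≤ M := (h0 0).trans (hM 0)
  have hlM : 0 ≤ lam * M := by positivity
  have hle : -(lam * M) ≤ 1 := by linarith
  have hcont : ContinuousOn (fun α => ∫ x in Ω, pospow p (α + lam * ψ x)) (Icc (-(lam * M)) 1) := by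
    refine continuousOn_of_dominated (bound := fun _ => (1 + lam * M) ^ p) (fun α _ => ?_)
      (fun α hα => .of_forall fun x => ?_) (integrable_const _) (.of_forall fun x => ?_)
    · exact ((continuous_pospow hp.le).comp (by fun_prop)).aestronglyMeasurable
    · rw [Real.norm_eq_abs, abs_of_nonneg (pospow_nonneg _ _)]
      have := mul_le_mul_of_nonneg_left (hM x) hlam
      exact Real.rpow_le_rpow (le_max_right _ _) (max_le (by linarith [hα.2]) (by linarith)) hp.le
    · exact ((continuous_pospow hp.le).comp (by fun_prop)).continuousOn
  suffices h1 : (1 : ℝ) ∈ Icc (∫ x in Ω, pospow p (-(lam * M) + lam * ψ x))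
      (∫ x in Ω, pospow p (1 + lam * ψ x)) by
    obtain ⟨α, hα, h⟩ := intermediate_value_Icc hle hcont h1
    exact ⟨α, hα.1, hα.2, h⟩
  constructor
  · refine (le_of_eq ?_).trans zero_le_one
    refine integral_eq_zero_of_ae (.of_forall fun x => ?_)
    have := mul_le_mul_of_nonneg_left (hM x) hlam
    simp only [pospow, Pi.zero_apply]
    rw [max_eq_right (by linarith), Real.zero_rpow hp.ne']
  · have h1 : ∫ _ in Ω, (1 : ℝ) = 1 := by simp [Measure.real]
    rw [← h1]
    refine integral_mono (integrable_const _) (eb_restrict hb hΩ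
      ((continuous_pospow hp.le).comp (by fun_prop))).integrable fun x => ?_
    have := mul_nonneg hlam (h0 x)
    exact Real.one_le_rpow (le_max_of_le_left (by linarith)) hp.le

/-- Admissible potentials: Hölder, bounded, nonnegative, vanishing outside `Ω`. -/
structure Adm (Ω : Set (Eu N)) (M H : ℝ) (ψ : Eu N → ℝ) : Prop where
  holz : HolZ Ω ψ H
  nonneg : ∀ x, 0 ≤ ψ x
  le : ∀ x, ψ x ≤ M

/-- `ζ` solves the Dirichlet problem with the density generated by `(α, ψ)`. -/
structure IsStep (Ω : Set (Eu N)) (p lam α : ℝ) (ψ ζ : Eu N → ℝ) : Prop where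
  reg : ContDiff ℝ 2 ζ
  eqn : ∀ x ∈ Ω, -lapl ζ x = pospow p (α + lam * ψ x)
  bdry : ∀ x ∈ frontier Ω, ζ x = 0

lemma exists_step (hΩ : IsC3Domain Ω) (hN : 2 ≤ N) (hvol : volume Ω = 1) {p lam : ℝ} (hp : 1 < p)
    (hpN : N = 2 ∨ p < (N : ℝ) / ((N : ℝ) - 2)) (hlam : 0 ≤ lam) :
    ∃ M H, 0 ≤ M ∧ 0 ≤ H ∧ ∀ ψ α, Adm Ω M H ψ → -(lam * M) ≤ α → α ≤ 1 →
      ∫ x in Ω, pospow p (α + lam * ψ x) = 1 →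
      ∃ ζ, IsStep Ω p lam α ψ ζ ∧ Adm Ω M H (Ω.indicator ζ) := by
  have hp0 : 0 < p := by linarith
  have hN0 : 0 < N := by linarith
  have hNR : (2 : ℝ) ≤ N := by exact_mod_cast hN
  have := isProbabilityMeasure_restrict hvol
  have hΩo := hΩ.1
  have hb := hΩ.2.2.1
  obtain ⟨r, hr, hrΩ⟩ := hb.subset_closedBall_lt 0 (0 : Eu N)
  obtain ⟨θ, hθ0, hθ1, hNθ, hpθ⟩ := exists_interp_exponent hN hp hpN
  obtain ⟨K, hK, hpot⟩ := pot_sup_le (N := N) hθ0 hθ1 hNθ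
  obtain ⟨D, hD, hdat⟩ := exists_dat_of_holZ hN0 hb
  obtain ⟨C, hC, solve⟩ := linSolv_zero hΩ hN0
  obtain ⟨M, hM, hMle⟩ := exists_sublinear_bound (A := r ^ 2 + 1) (K := K + 2 * K * (r ^ 2 + 1)) hpθ
    (by positivity) (by positivity) hlam
  set T := 1 + lam * M with hT
  have hT0 : 0 ≤ T := by positivity
  set L := p * (T ^ p) ^ (1 - 1 / p) with hL
  have hL0 : 0 ≤ L := by positivity
  set H := 2 * M * (N * (C * (L * lam + 1))) + 1 with hH
  have hH0 : 1 ≤ H := by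
    have : 0 ≤ 2 * M * (N * (C * (L * lam + 1))) := by positivity
    linarith
  refine ⟨M, H, hM, by linarith, fun ψ α hψ hα0 hα1 hInt => ?_⟩
  have hψc := hψ.holz.hol.continuous
  have hUle : ∀ x, α + lam * ψ x ≤ T := fun x => by
    have := mul_le_mul_of_nonneg_left (hψ.le x) hlam
    linarith
  have hαT : α ≤ T := by
    have : 0 ≤ lam * M := by positivity
    linarith
  set c := pospow p α with hc
  have hc0 : 0 ≤ c := pospow_nonneg _ _
  have hc1 : c ≤ 1 := Real.rpow_le_one (le_max_right _ _) (max_le hα1 zero_le_one) hp0.le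
  set φ : Eu N → ℝ := fun x => pospow p (α + lam * ψ x) - c with hφ
  have hφz : HolZ Ω φ (L * (lam * H)) := by
    refine ⟨fun x y => ?_, fun x hx => ?_⟩
    · simp only [hφ]
      rw [sub_sub_sub_cancel_right]
      refine (pospow_sub_le hp hT0 (hUle x) (hUle y)).trans ?_
      rw [← hL, mul_assoc L]
      refine mul_le_mul_of_nonneg_left ?_ hL0
      rw [add_sub_add_left_eq_sub, ← mul_sub, abs_mul, abs_of_nonneg hlam, mul_assoc]
      exact mul_le_mul_of_nonneg_left (hψ.holz.hol x y) hlam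
    · simp only [hφ]
      rw [hψ.holz.zero x hx, mul_zero, add_zero, sub_self]
  have hφ0 : ∀ x, 0 ≤ φ x := fun x => sub_nonneg.2 (pospow_mono hp0.le (by
    have := mul_nonneg hlam (hψ.nonneg x)
    linarith))
  have hφT : ∀ x, φ x ≤ T ^ p := fun x => by
    have : pospow p (α + lam * ψ x) ≤ T ^ p :=
      Real.rpow_le_rpow (le_max_right _ _) (max_le (hUle x) hT0) hp0.le
    simp only [hφ]; linarith
  have hd0 := hdat _ _ hφz
  have hd : Dat φ (T ^ p) (L * (lam * H)) :=
    ⟨hd0.cont, hd0.supp, fun x => by rw [abs_of_nonneg (hφ0 x)]; exact hφT x, hd0.hol⟩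
  have hφ1 : ∫ y, |φ y| ≤ 1 := by
    rw [← setIntegral_eq_integral_of_forall_compl_eq_zero (s := Ω)
      (fun x hx => by rw [hφz.zero x hx, abs_zero]), ← hInt]
    have hUc : Continuous fun x => α + lam * ψ x := by fun_prop
    refine integral_mono (eb_restrict hb hΩo.measurableSet hd.cont.abs).integrable
      (eb_restrict hb hΩo.measurableSet ((continuous_pospow hp0.le).comp hUc)).integrable fun x => ?_
    rw [abs_of_nonneg (hφ0 x)]
    simp only [hφ]; linarith
  have hv := hpot φ _ _ hd hφ1
  have hv0 := pot_nonneg hφ0 2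
  set V := K * (T ^ p) ^ θ with hV
  have hV0 : 0 ≤ V := by positivity
  obtain ⟨ζ, hζC, hζ0, hζ⟩ := solve φ _ c hφz
  have hζe : ∀ x ∈ Ω, -lapl ζ x = pospow p (α + lam * ψ x) := fun x hx => by
    have := hζ x hx
    simp only [hφ] at this
    linarith
  have hpos : ∀ x ∈ closure Ω, 0 ≤ ζ x := fun x hx => by
    have := max_principle hN0 hΩo hb (w := fun x => (-1) * ζ x) (contDiff_const.mul hζC.reg) le_rfl
      (fun x hx => by
        rw [lapl_const_mul]
        have := hζe x hx
        have := pospow_nonneg p (α + lam * ψ x)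
        linarith) (fun x hx => by rw [hζ0 x hx]; simp) x hx
    linarith
  have hsup : ∀ x ∈ closure Ω, ζ x ≤ M := fun x hx => by
    have hB0 : 0 ≤ L * (lam * H) := by positivity
    have hpc := contDiff_pot two_pos hd hB0
    have hz := le_bar_of_lapl hN0 hΩo hrΩ (u := fun x => ζ x - pot 2 φ x) (s := 0)
      (a := (1 + 2 * V) / (2 * N)) (hζC.reg.sub hpc) le_rfl (by positivity) (fun x hx => by
        rw [lapl_sub hζC.reg hpc, zero_mul, add_zero, zero_mul, add_zero,
          div_mul_cancel₀ _ (by positivity)]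
        have h1 := hζ x hx
        have h2 := lapl_pot two_pos hd hB0 x
        have h3 := hv x
        linarith) (fun x hx => by rw [hζ0 x hx, zero_sub]; exact neg_nonpos.2 (hv0 x)) x hx
    have h1 : (1 + 2 * V) / (2 * N) * bar r x ≤ (1 + 2 * V) * (r ^ 2 + 1) := by
      refine mul_le_mul (div_le_self (by positivity) (by linarith)) (bar_le r x) ?_ (by positivity)
      linarith [one_le_bar (norm_le_of_mem_closure hrΩ hx)]
    have h2 : V = K * T ^ (p * θ) := by rw [hV, Real.rpow_mul hT0]
    have h3 := hv x
    calc ζ x ≤ V + (1 + 2 * V) * (r ^ 2 + 1) := by linarith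
      _ = r ^ 2 + 1 + (K + 2 * K * (r ^ 2 + 1)) * T ^ (p * θ) := by rw [h2]; ring
      _ ≤ M := hMle
  refine ⟨ζ, ⟨hζC.reg, hζe, hζ0⟩, ⟨?_, fun x => ?_, fun x => ?_⟩⟩
  · have := holZ_indicator_of_sup hζC hζ0 hM fun x hx => by
      rw [abs_of_nonneg (hpos x (subset_closure hx))]
      exact hsup x (subset_closure hx)
    refine ⟨this.hol.mono ?_, this.zero⟩
    rw [abs_of_nonneg hc0]
    refine Real.sqrt_le_iff.2 ⟨by linarith, ?_⟩
    have h1 : L * (lam * H) + c ≤ (L * lam + 1) * H := by nlinarith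
    calc 2 * M * (N * (C * (L * (lam * H) + c)))
        ≤ 2 * M * (N * (C * ((L * lam + 1) * H))) := by gcongr
      _ = (H - 1) * H := by rw [hH]; ring
      _ ≤ H ^ 2 := by nlinarith
  · exact indicator_nonneg (fun x hx => hpos x (subset_closure hx)) x
  · by_cases hx : x ∈ Ω
    · rw [indicator_of_mem hx]; exact hsup x (subset_closure hx)
    · rw [indicator_of_notMem hx]; exact hM

end Step

section Iteration

variable {N : ℕ} {Ω : Set (Eu N)}

lemma nrmsq_restrict_congr (hΩ : MeasurableSet Ω) {f g : Eu N → ℝ} (p : ℝ)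
    (h : ∀ x ∈ Ω, f x = g x) :
    nrmsq (volume.restrict Ω) p f = nrmsq (volume.restrict Ω) p g := by
  rw [nrmsq, nrmsq, setIntegral_congr_fun hΩ fun x hx => by rw [h x hx]]

lemma IsStep.nrmsq_sub_le (hΩ : IsOpen Ω) (hb : Bornology.IsBounded Ω) (hvol : volume Ω = 1)
    {p lam : ℝ} (hp : 1 < p) (hlam : 0 < lam) (hle : lam * p ≤ Lam Ω (2 * p)) {α₁ α₂ : ℝ}
    {ψ₁ ψ₂ ζ₁ ζ₂ : Eu N → ℝ} (h₁ : IsStep Ω p lam α₁ ψ₁ ζ₁) (h₂ : IsStep Ω p lam α₂ ψ₂ ζ₂)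
    (hc₁ : Continuous ψ₁) (hc₂ : Continuous ψ₂) (i₁ : ∫ x in Ω, pospow p (α₁ + lam * ψ₁ x) = 1)
    (i₂ : ∫ x in Ω, pospow p (α₂ + lam * ψ₂ x) = 1) :
    nrmsq (volume.restrict Ω) p (fun x => ζ₁ x - ζ₂ x) ≤
      nrmsq (volume.restrict Ω) p (fun x => ψ₁ x - ψ₂ x) := by
  have hp0 : 0 < p := by linarith
  have := isProbabilityMeasure_restrict hvol
  have hz : ContDiff ℝ 2 fun x => ζ₁ x - ζ₂ x := h₁.reg.sub h₂.reg
  have hm := hΩ.measurableSet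
  have hE := mul_nrmsq_le hΩ hb hp0 hle (z := fun x => ζ₁ x - ζ₂ x)
    (g := fun x => pospow p (α₁ + lam * ψ₁ x) - pospow p (α₂ + lam * ψ₂ x)) hz
    (fun x hx => by rw [h₁.bdry x hx, h₂.bdry x hx, sub_zero]) fun x hx => by
      rw [lapl_sub h₁.reg h₂.reg, ← h₁.eqn x hx, ← h₂.eqn x hx]; ring
  have hcs := sq_integral_pospow_sub_mul_le (μ := volume.restrict Ω) (δ := α₁ - α₂)
    (u := fun x => α₁ + lam * ψ₁ x) (v := fun x => α₂ + lam * ψ₂ x)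
    (w := fun x => lam * (ψ₁ x - ψ₂ x)) hp (eb_restrict hb hm (by fun_prop))
    (eb_restrict hb hm (by fun_prop)) i₁ i₂ (eb_restrict hb hm (by fun_prop)) (fun x => by ring)
    (eb_restrict hb hm hz.continuous)
  rw [nrmsq_const_mul hp0] at hcs
  have n0 := nrmsq_nonneg (μ := volume.restrict Ω) p fun x => ζ₁ x - ζ₂ x
  have m0 := nrmsq_nonneg (μ := volume.restrict Ω) p fun x => ψ₁ x - ψ₂ x
  set n := nrmsq (volume.restrict Ω) p fun x => ζ₁ x - ζ₂ x
  set m := nrmsq (volume.restrict Ω) p fun x => ψ₁ x - ψ₂ x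
  rcases n0.eq_or_lt with h | h
  · rwa [← h]
  have hl : 0 < lam * p := by positivity
  have h1 := pow_le_pow_left₀ (by positivity) hE 2
  have h2 : (lam * p) ^ 2 * n * n ≤ (lam * p) ^ 2 * n * m := by
    refine le_trans (le_of_eq ?_) (h1.trans (hcs.trans (le_of_eq ?_))) <;> ring
  exact le_of_mul_le_mul_left h2 (by positivity)

lemma Adm.const_mul {M H s : ℝ} {f : Eu N → ℝ} (hf : Adm Ω M H f) (hN : 0 < N) (hs : 0 ≤ s)
    (hs1 : s ≤ 1) : Adm Ω M H fun x => s * f x := by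
  have hH := hf.holz.nonneg hN
  refine ⟨⟨(hf.holz.hol.const_mul s).mono ?_, fun x hx => by rw [hf.holz.zero x hx, mul_zero]⟩,
    fun x => mul_nonneg hs (hf.nonneg x), fun x => ?_⟩
  · rw [abs_of_nonneg hs]; exact mul_le_of_le_one_left hH hs1
  · exact (mul_le_of_le_one_left (hf.nonneg x) hs1).trans (hf.le x)

lemma Adm.zero {M H : ℝ} (hM : 0 ≤ M) (hH : 0 ≤ H) : Adm Ω M H fun _ => 0 :=
  ⟨⟨fun x y => by simp only [sub_self, abs_zero]; positivity, fun _ _ => rfl⟩, fun _ => le_rfl,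
    fun _ => hM⟩

/-- A family of approximate fixed points. -/
lemma exists_approx (hΩ : IsC3Domain Ω) (hN : 2 ≤ N) (hvol : volume Ω = 1) {p lam : ℝ}
    (hp : 1 < p) (hlam : 0 < lam) (hle : lam * p ≤ Lam Ω (2 * p)) {M H : ℝ} (hM : 0 ≤ M)
    (hH : 0 ≤ H) (hstep : ∀ ψ α, Adm Ω M H ψ → -(lam * M) ≤ α → α ≤ 1 →
      ∫ x in Ω, pospow p (α + lam * ψ x) = 1 →
      ∃ ζ, IsStep Ω p lam α ψ ζ ∧ Adm Ω M H (Ω.indicator ζ)) {s ε : ℝ} (hs : 0 ≤ s) (hs1 : s < 1)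
    (hε : 0 < ε) :
    ∃ ψ α ζ, Adm Ω M H ψ ∧ -(lam * M) ≤ α ∧ α ≤ 1 ∧ ∫ x in Ω, pospow p (α + lam * ψ x) = 1 ∧
      IsStep Ω p lam α ψ ζ ∧ Adm Ω M H (Ω.indicator ζ) ∧
      nrmsq (volume.restrict Ω) p (fun x => s * ζ x - ψ x) ≤ ε := by
  have hN0 : 0 < N := by linarith
  have hΩo := hΩ.1
  have hb := hΩ.2.2.1
  have hm := hΩo.measurableSet
  have key : ∀ ψ, Adm Ω M H ψ → ∃ α ζ, -(lam * M) ≤ α ∧ α ≤ 1 ∧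
      ∫ x in Ω, pospow p (α + lam * ψ x) = 1 ∧ IsStep Ω p lam α ψ ζ ∧
      Adm Ω M H (Ω.indicator ζ) := fun ψ hψ => by
    obtain ⟨α, h1, h2, h3⟩ := exists_multiplier hb hm hvol (p := p) (by linarith) hlam.le
      hψ.holz.hol.continuous hψ.nonneg hψ.le
    obtain ⟨ζ, h4, h5⟩ := hstep ψ α hψ h1 h2 h3
    exact ⟨α, ζ, h1, h2, h3, h4, h5⟩
  choose! A Z hA0 hA1 hInt hS hZ using key
  set u : ℕ → Eu N → ℝ := fun k => (fun ψ x => s * Ω.indicator (Z ψ) x)^[k] fun _ => 0 with hu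
  have hsucc : ∀ k, u (k + 1) = fun x => s * Ω.indicator (Z (u k)) x := fun k => by
    simp only [hu, Function.iterate_succ_apply']
  have hadm : ∀ k, Adm Ω M H (u k) := fun k => by
    induction k with
    | zero => exact Adm.zero hM hH
    | succ k ih => rw [hsucc]; exact (hZ _ ih).const_mul hN0 hs hs1.le
  set d : ℕ → ℝ := fun k => nrmsq (volume.restrict Ω) p fun x => s * Z (u k) x - u k x with hd
  have hdle : ∀ k, d (k + 1) ≤ s ^ 2 * d k := fun k => by
    have h1 : d (k + 1) = nrmsq (volume.restrict Ω) p
        fun x => s * (Z (u (k + 1)) x - Z (u k) x) := nrmsq_restrict_congr hm p fun x hx => by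
      have : u (k + 1) x = s * Z (u k) x := by rw [hsucc]; simp only [indicator_of_mem hx]
      rw [this]; ring
    have h2 : d k = nrmsq (volume.restrict Ω) p fun x => u (k + 1) x - u k x :=
      nrmsq_restrict_congr hm p fun x hx => by
        have : u (k + 1) x = s * Z (u k) x := by rw [hsucc]; simp only [indicator_of_mem hx]
        rw [this]
    rw [h1, h2, nrmsq_const_mul (by linarith)]
    exact mul_le_mul_of_nonneg_left ((hS _ (hadm (k + 1))).nrmsq_sub_le hΩo hb hvol hp hlam hle
      (hS _ (hadm k)) (hadm _).holz.hol.continuous (hadm _).holz.hol.continuous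
      (hInt _ (hadm _)) (hInt _ (hadm _))) (sq_nonneg _)
  have hpow : ∀ k, d k ≤ (s ^ 2) ^ k * d 0 := fun k => by
    induction k with
    | zero => simp
    | succ k ih =>
      rw [pow_succ', mul_assoc]
      exact (hdle k).trans (mul_le_mul_of_nonneg_left ih (sq_nonneg _))
  have ht := (tendsto_pow_atTop_nhds_zero_of_lt_one (sq_nonneg s)
    (by nlinarith : s ^ 2 < 1)).mul_const (d 0)
  rw [zero_mul] at ht
  obtain ⟨k, hk⟩ := (ht.eventually_le_const hε).exists
  exact ⟨u k, A (u k), Z (u k), hadm k, hA0 _ (hadm k), hA1 _ (hadm k), hInt _ (hadm k),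
    hS _ (hadm k), hZ _ (hadm k), (hpow k).trans hk⟩

/-- Uniform compactness of the set of admissible potentials. -/
lemma exists_adm_limit (hb : Bornology.IsBounded Ω) {M H a b : ℝ} (hH : 0 ≤ H)
    {ψ : ℕ → Eu N → ℝ} {α : ℕ → ℝ} (hψ : ∀ n, Adm Ω M H (ψ n)) (ha : ∀ n, a ≤ α n)
    (hb' : ∀ n, α n ≤ b) :
    ∃ ψ' α', Adm Ω M H ψ' ∧ a ≤ α' ∧ α' ≤ b ∧ ∀ ε > 0, ∀ n₀ : ℕ, ∃ n ≥ n₀, |α n - α'| ≤ ε ∧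
      ∀ x, |ψ n x - ψ' x| ≤ ε := by
  have hlim : ∀ (c d : ℝ) (f : ℕ → ℝ), (∀ n, c ≤ f n) → (∀ n, f n ≤ d) →
      ∃ l, Filter.Tendsto f (Filter.hyperfilter ℕ : Filter ℕ) (nhds l) := fun c d f h1 h2 => by
    obtain ⟨l, -, hl⟩ := (isCompact_Icc (a := c) (b := d)).ultrafilter_le_nhds'
      ((Filter.hyperfilter ℕ).map f)
      (Ultrafilter.mem_map.2 (Filter.univ_mem' fun n => ⟨h1 n, h2 n⟩))
    exact ⟨l, hl⟩
  obtain ⟨α', hα'⟩ := hlim a b α ha hb'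
  choose ψ' hψ' using fun x => hlim 0 M (fun n => ψ n x) (fun n => (hψ n).nonneg x)
    fun n => (hψ n).le x
  have hadm : Adm Ω M H ψ' := by
    refine ⟨⟨fun x y => ?_, fun x hx => ?_⟩, fun x => ?_, fun x => ?_⟩
    · exact le_of_tendsto' ((hψ' x).sub (hψ' y)).abs fun n => (hψ n).holz.hol x y
    · refine tendsto_nhds_unique (hψ' x) ?_
      simp only [(hψ _).holz.zero x hx]
      exact tendsto_const_nhds
    · exact ge_of_tendsto' (hψ' x) fun n => (hψ n).nonneg x
    · exact le_of_tendsto' (hψ' x) fun n => (hψ n).le x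
  refine ⟨ψ', α', hadm, ge_of_tendsto' hα' ha, le_of_tendsto' hα' hb', fun ε hε n₀ => ?_⟩
  obtain ⟨δ, hδ, hδε⟩ : ∃ δ > 0, H * √δ ≤ ε / 3 := by
    refine ⟨(ε / (3 * (H + 1))) ^ 2, by positivity, ?_⟩
    rw [Real.sqrt_sq (by positivity), mul_div_assoc', div_le_div_iff₀ (by positivity) (by norm_num)]
    nlinarith
  obtain ⟨t, -, ht, hcov⟩ := hb.isCompact_closure.finite_cover_balls hδ
  have hev : ∀ᶠ n in (Filter.hyperfilter ℕ : Filter ℕ), ∀ y ∈ t, |ψ n y - ψ' y| ≤ ε / 3 :=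
    (Filter.eventually_all_finite ht).2 fun y _ => by
      filter_upwards [Metric.tendsto_nhds.1 (hψ' y) (ε / 3) (by positivity)] with n hn
      rw [Real.dist_eq] at hn
      exact hn.le
  have hev2 : ∀ᶠ n in (Filter.hyperfilter ℕ : Filter ℕ), |α n - α'| ≤ ε := by
    filter_upwards [Metric.tendsto_nhds.1 hα' ε hε] with n hn
    rw [Real.dist_eq] at hn
    exact hn.le
  have hev3 : ∀ᶠ n in (Filter.hyperfilter ℕ : Filter ℕ), n₀ ≤ n := by
    have := Filter.hyperfilter_le_cofinite (α := ℕ)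
    rw [Nat.cofinite_eq_atTop] at this
    exact this (Filter.eventually_ge_atTop n₀)
  obtain ⟨n, h1, h2, h3⟩ := (hev.and (hev2.and hev3)).exists
  refine ⟨n, h3, h2, fun x => ?_⟩
  by_cases hx : x ∈ Ω
  · obtain ⟨y, hy, hxy⟩ := mem_iUnion₂.1 (hcov (subset_closure hx))
    rw [mem_ball, dist_eq_norm] at hxy
    have hs : H * √‖x - y‖ ≤ ε / 3 :=
      (mul_le_mul_of_nonneg_left (Real.sqrt_le_sqrt hxy.le) hH).trans hδε
    have e1 := abs_le.1 (((hψ n).holz.hol x y).trans hs)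
    have e2 := abs_le.1 ((hadm.holz.hol x y).trans hs)
    have e3 := abs_le.1 (h1 y hy)
    exact abs_le.2 ⟨by linarith [e1.1, e2.2, e3.1], by linarith [e1.2, e2.1, e3.2]⟩
  · rw [(hψ n).holz.zero x hx, hadm.holz.zero x hx, sub_self, abs_zero]
    exact hε.le

end Iteration

section Existence

variable {N : ℕ} {Ω : Set (Eu N)}

lemma integral_abs_rpow_le_of_nrmsq_le {X : Type*} [MeasurableSpace X] {μ : Measure X} {p ε : ℝ}
    (hp : 1 < p) {f : X → ℝ} (hε0 : 0 ≤ ε) (hε1 : ε ≤ 1) (h : nrmsq μ p f ≤ ε) :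
    ∫ x, |f x| ^ (2 * p) ∂μ ≤ ε := by
  have hp0 : 0 < p := by linarith
  have hI : 0 ≤ ∫ x, |f x| ^ (2 * p) ∂μ := integral_nonneg fun _ => by positivity
  have h1 := Real.rpow_le_rpow (nrmsq_nonneg p f) h hp0.le
  rw [nrmsq, ← Real.rpow_mul hI, show 2 / (2 * p) * p = 1 by field_simp, Real.rpow_one] at h1
  exact h1.trans (Real.rpow_le_self_of_le_one hε0 hε1 hp.le)

lemma abs_rpow_le_of_le_add {a b c t : ℝ} (ht : 0 ≤ t) (hc : 0 ≤ c) (h : |a| ≤ |b| + c) :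
    |a| ^ t ≤ 2 ^ t * (|b| ^ t + c ^ t) := by
  have hb := abs_nonneg b
  have h1 : |a| ≤ 2 * max |b| c := by linarith [le_max_left |b| c, le_max_right |b| c]
  have hm : 0 ≤ max |b| c := le_max_of_le_left hb
  refine (Real.rpow_le_rpow (abs_nonneg a) h1 ht).trans ?_
  rw [Real.mul_rpow two_pos.le hm]
  refine mul_le_mul_of_nonneg_left ?_ (by positivity)
  have e1 : 0 ≤ |b| ^ t := by positivity
  have e2 : 0 ≤ c ^ t := by positivity
  rcases max_choice |b| c with h | h <;> rw [h] <;> linarith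

lemma eq_zero_of_forall_le_mul {a C : ℝ} (h0 : 0 ≤ a) (h : ∀ ε, 0 < ε → ε ≤ 1 → a ≤ C * ε) :
    a = 0 := by
  by_contra hne
  have ha : 0 < a := lt_of_le_of_ne h0 (Ne.symm hne)
  have hC : 0 < C := by have := h 1 one_pos le_rfl; linarith
  have := h (min 1 (a / (2 * C))) (by positivity) (min_le_left _ _)
  have h2 := mul_le_mul_of_nonneg_left (min_le_right 1 (a / (2 * C))) hC.le
  have h3 : C * (a / (2 * C)) = a / 2 := by field_simp
  linarith

theorem exists_isSol_of_pos (hΩ : IsC3Domain Ω) (hN : 2 ≤ N) (hvol : volume Ω = 1) {p lam : ℝ}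
    (hp : 1 < p) (hpN : N = 2 ∨ p < (N : ℝ) / ((N : ℝ) - 2)) (hlam : 0 < lam)
    (hle : lam * p ≤ Lam Ω (2 * p)) : ∃ α ψ, IsSol Ω p lam α ψ := by
  have hp0 : 0 < p := by linarith
  have hN0 : 0 < N := by linarith
  have hNR : (2 : ℝ) ≤ N := by exact_mod_cast hN
  have := isProbabilityMeasure_restrict hvol
  have hΩo := hΩ.1
  have hb := hΩ.2.2.1
  have hm := hΩo.measurableSet
  obtain ⟨r, hr, hrΩ⟩ := hb.subset_closedBall_lt 0 (0 : Eu N)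
  obtain ⟨M, H, hM, hH, hstep⟩ := exists_step hΩ hN hvol hp hpN hlam.le
  choose ψ α ζ hψ hα0 hα1 hInt hS hZ happ using fun n : ℕ =>
    exists_approx hΩ hN hvol hp hlam hle hM hH hstep (s := 1 - 1 / ((n : ℝ) + 1))
      (ε := 1 / ((n : ℝ) + 1)) (by
        rw [sub_nonneg, div_le_one (by positivity)]
        linarith [(n.cast_nonneg : (0 : ℝ) ≤ n)])
      (by
        have : 0 < 1 / ((n : ℝ) + 1) := by positivity
        linarith) (by positivity)
  obtain ⟨ψ', α', hψ', hα0', hα1', hlim⟩ := exists_adm_limit hb hH hψ hα0 hα1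
  have happrox : ∀ ε, 0 < ε → ∃ n : ℕ, 1 / ((n : ℝ) + 1) ≤ ε ∧ |α n - α'| ≤ ε ∧
      ∀ x, |ψ n x - ψ' x| ≤ ε := fun ε hε => by
    obtain ⟨n₀, hn₀⟩ := exists_nat_one_div_lt hε
    obtain ⟨n, hn, h1, h2⟩ := hlim ε hε n₀
    refine ⟨n, le_trans ?_ hn₀.le, h1, h2⟩
    have : (n₀ : ℝ) ≤ n := by exact_mod_cast hn
    gcongr
  have hψc := fun n => (hψ n).holz.hol.continuous
  have hψc' := hψ'.holz.hol.continuous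
  set T := 1 + lam * M with hT
  have hT0 : 0 ≤ T := by positivity
  set L := p * (T ^ p) ^ (1 - 1 / p) * (1 + lam) with hL
  have hL0 : 0 ≤ L := by positivity
  have hρ : ∀ ε n, |α n - α'| ≤ ε → (∀ x, |ψ n x - ψ' x| ≤ ε) →
      ∀ x, |pospow p (α n + lam * ψ n x) - pospow p (α' + lam * ψ' x)| ≤ L * ε :=
    fun ε n h1 h2 x => by
      have e1 := mul_le_mul_of_nonneg_left ((hψ n).le x) hlam.le
      have e2 := mul_le_mul_of_nonneg_left (hψ'.le x) hlam.le
      refine (pospow_sub_le hp hT0 (by linarith [hα1 n]) (by linarith)).trans ?_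
      rw [hL, mul_assoc _ (1 + lam)]
      refine mul_le_mul_of_nonneg_left ?_ (by positivity)
      have : α n + lam * ψ n x - (α' + lam * ψ' x) = (α n - α') + lam * (ψ n x - ψ' x) := by ring
      rw [this]
      refine (abs_add_le _ _).trans ?_
      rw [abs_mul, abs_of_pos hlam]
      have := mul_le_mul_of_nonneg_left (h2 x) hlam.le
      linarith
  have iρ : ∀ (a : ℝ) (f : Eu N → ℝ), Continuous f →
      Integrable (fun x => pospow p (a + lam * f x)) (volume.restrict Ω) := fun a f hf =>
    (eb_restrict hb hm ((continuous_pospow hp0.le).comp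
      (by fun_prop : Continuous fun x => a + lam * f x))).integrable
  have hInt' : ∫ x in Ω, pospow p (α' + lam * ψ' x) = 1 := by
    have : |1 - ∫ x in Ω, pospow p (α' + lam * ψ' x)| = 0 := by
      refine eq_zero_of_forall_le_mul (C := L) (abs_nonneg _) fun ε hε _ => ?_
      obtain ⟨n, -, h1, h2⟩ := happrox ε hε
      rw [← hInt n, ← integral_sub (iρ _ _ (hψc n)) (iρ _ _ hψc')]
      have := norm_integral_le_of_norm_le_const (μ := volume.restrict Ω) (C := L * ε)
        (f := fun x => pospow p (α n + lam * ψ n x) - pospow p (α' + lam * ψ' x))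
        (.of_forall fun x => hρ ε n h1 h2 x)
      simpa using this
    rw [abs_eq_zero] at this
    linarith
  obtain ⟨ξ, hξ, hξA⟩ := hstep ψ' α' hψ' hα0' hα1' hInt'
  set K := L * (r ^ 2 + 1) + M + 1 with hK
  have hK0 : 0 ≤ K := by positivity
  have hdiff : ∀ (ε : ℝ) (n : ℕ), 1 / ((n : ℝ) + 1) ≤ ε → |α n - α'| ≤ ε → (∀ x, |ψ n x - ψ' x| ≤ ε) →
      ∀ x ∈ Ω, |ξ x - ψ' x| ≤ |(1 - 1 / ((n : ℝ) + 1)) * ζ n x - ψ n x| + K * ε :=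
    fun ε n h0 h1 h2 x hx => by
      have hε : 0 ≤ ε := (abs_nonneg _).trans h1
      have e1 : |ζ n x - ξ x| ≤ L * ε * (r ^ 2 + 1) := by
        refine (abs_le_bar_of_lapl hN0 hΩo hrΩ (u := fun x => ζ n x - ξ x) (s := 0) (a := L * ε)
          ((hS n).reg.sub hξ.reg) le_rfl (by positivity) (fun y hy => ?_) (fun y hy => ?_) x
          (subset_closure hx)).trans (mul_le_mul_of_nonneg_left (bar_le r x) (by positivity))
        · rw [lapl_sub (hS n).reg hξ.reg, zero_mul, add_zero, zero_mul, add_zero, neg_sub',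
            (hS n).eqn y hy, hξ.eqn y hy]
          exact (hρ ε n h1 h2 y).trans (le_mul_of_one_le_right (by positivity) (by linarith))
        · rw [(hS n).bdry y hy, hξ.bdry y hy, sub_zero]
      have e2 : |1 / ((n : ℝ) + 1) * ζ n x| ≤ ε * M := by
        have hz0 := (hZ n).nonneg x
        have hz1 := (hZ n).le x
        rw [indicator_of_mem hx] at hz0 hz1
        rw [abs_mul, abs_of_nonneg hz0, abs_of_nonneg (by positivity)]
        exact mul_le_mul h0 hz1 hz0 hε
      have e3 := h2 x
      have : ξ x - ψ' x = ((1 - 1 / ((n : ℝ) + 1)) * ζ n x - ψ n x) + (1 / ((n : ℝ) + 1) * ζ n x) -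
          (ζ n x - ξ x) + (ψ n x - ψ' x) := by ring
      rw [this, hK]
      refine (abs_add_le _ _).trans ?_
      have f1 := abs_sub (((1 - 1 / ((n : ℝ) + 1)) * ζ n x - ψ n x) + (1 / ((n : ℝ) + 1) * ζ n x))
        (ζ n x - ξ x)
      have f2 := abs_add_le ((1 - 1 / ((n : ℝ) + 1)) * ζ n x - ψ n x) (1 / ((n : ℝ) + 1) * ζ n x)
      linarith
  have hp2 : 0 ≤ 2 * p := by linarith
  have hcξ : Continuous fun x => ξ x - ψ' x := hξ.reg.continuous.sub hψc'
  have hzero : ∫ x in Ω, |ξ x - ψ' x| ^ (2 * p) = 0 := by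
    refine eq_zero_of_forall_le_mul (C := 2 ^ (2 * p) * (1 + K ^ (2 * p)))
      (integral_nonneg fun x => by positivity) fun ε hε hε1 => ?_
    obtain ⟨n, h0, h1, h2⟩ := happrox ε hε
    have hI := integral_abs_rpow_le_of_nrmsq_le hp hε.le hε1 ((happ n).trans h0)
    have hcn : Continuous fun x => (1 - 1 / ((n : ℝ) + 1)) * ζ n x - ψ n x :=
      (continuous_const.mul (hS n).reg.continuous).sub (hψc n)
    have in1 := ((eb_restrict hb hm hcn).abs_rpow hp2).integrable
    have in2 := ((eb_restrict hb hm hcξ).abs_rpow hp2).integrable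
    calc ∫ x in Ω, |ξ x - ψ' x| ^ (2 * p)
        ≤ ∫ x in Ω, 2 ^ (2 * p) * (|(1 - 1 / ((n : ℝ) + 1)) * ζ n x - ψ n x| ^ (2 * p) +
            (K * ε) ^ (2 * p)) :=
          setIntegral_mono_on in2 ((in1.add (integrable_const _)).const_mul _) hm fun x hx =>
            abs_rpow_le_of_le_add hp2 (by positivity) (hdiff ε n h0 h1 h2 x hx)
      _ = 2 ^ (2 * p) * ((∫ x in Ω, |(1 - 1 / ((n : ℝ) + 1)) * ζ n x - ψ n x| ^ (2 * p)) +
            (K * ε) ^ (2 * p)) := by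
          rw [integral_const_mul, integral_add in1 (integrable_const _)]
          simp
      _ ≤ 2 ^ (2 * p) * (ε + K ^ (2 * p) * ε) := by
          rw [Real.mul_rpow hK0 hε.le]
          have := Real.rpow_le_self_of_le_one hε.le hε1 (by linarith : 1 ≤ 2 * p)
          gcongr
      _ = 2 ^ (2 * p) * (1 + K ^ (2 * p)) * ε := by ring
  have hae := (integral_eq_zero_iff_of_nonneg (fun x => by positivity)
    ((eb_restrict hb hm hcξ).abs_rpow hp2).integrable).1 hzero
  have heq : ∀ x ∈ Ω, ξ x = ψ' x := eqOn_of_ae_restrict hΩo hξ.reg.continuous hψc' (by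
    filter_upwards [hae] with x hx
    have := (Real.rpow_eq_zero (abs_nonneg _) (by positivity)).1 hx
    exact sub_eq_zero.1 (abs_eq_zero.1 this))
  refine ⟨α', ξ, hξ.reg, fun x hx => ?_, hξ.bdry, ?_⟩
  · rw [hξ.eqn x hx, heq x hx, pospow]
  · rw [← hInt']
    exact setIntegral_congr_fun hm fun x hx => by simp only [heq x hx, pospow]

lemma exists_isSol_zero (hΩ : IsC3Domain Ω) (hN : 0 < N) (hvol : volume Ω = 1) (p : ℝ) :
    ∃ α ψ, IsSol Ω p 0 α ψ := by
  obtain ⟨C, -, solve⟩ := linSolv_zero hΩ hN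
  obtain ⟨u, hu, h0, he⟩ := solve (fun _ => 0) 0 1 ⟨fun x y => by simp, fun _ _ => rfl⟩
  refine ⟨1, u, hu.reg, fun x hx => ?_, h0, ?_⟩
  · have := he x hx
    simp only [zero_mul, add_zero, zero_add] at this
    simpa using this
  · simp [Measure.real, hvol]

end Existence

theorem stmt10 (N : ℕ) (hN : 2 ≤ N) (Ω : Set (EuclideanSpace ℝ (Fin N)))
    (hΩ : IsC3Domain Ω) (hvol : volume Ω = 1) (p : ℝ) (hp1 : 1 < p)
    (hpN : N = 2 ∨ p < (N : ℝ) / ((N : ℝ) - 2))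
    (lam : ℝ) (hlam : 0 ≤ lam) (hle : lam ≤ Lam Ω (2 * p) / p) :
    (∃ (α : ℝ) (ψ : EuclideanSpace ℝ (Fin N) → ℝ), IsSol Ω p lam α ψ) ∧
    (∀ (α₁ α₂ : ℝ) (ψ₁ ψ₂ : EuclideanSpace ℝ (Fin N) → ℝ),
      IsSol Ω p lam α₁ ψ₁ → IsSol Ω p lam α₂ ψ₂ →
      α₁ = α₂ ∧ ∀ x ∈ closure Ω, ψ₁ x = ψ₂ x) := by
  have hN0 : 0 < N := by linarith
  have hle' : lam * p ≤ Lam Ω (2 * p) := (le_div_iff₀ (by linarith)).1 hle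
  refine ⟨?_, fun α₁ α₂ ψ₁ ψ₂ h₁ h₂ => h₁.unique hN0 hΩ.1 hΩ.2.2.1 hvol hp1 hlam hle' h₂⟩
  rcases hlam.eq_or_lt with rfl | hpos
  · exact exists_isSol_zero hΩ hN0 hvol p
  · exact exists_isSol_of_pos hΩ hN hvol hp1 hpN hpos hle'

end
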